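/- Let p and q be arbitrary primes, let d ≥ 1, let F be the free group with free basis x_1, y_1, …, x_d, y_d, and let w = [x_1,y_1][x_2,y_2]⋯[x_d,y_d]. Let u ∈ F. If w and u are measure equivalent in every finite group belonging to the pseudovariety N_p(A_f N_q), then there exists an automorphism φ of F such that u = φ(w). -/

import Mathlib

open scoped commutatorElement

/-- Two words `w, u` of the free group on `α` are *measure equivalent* in a group `Q` if for
every `g : Q` the fibers of the respective word maps `(α → Q) → Q` over `g` have the same
cardinality. -/
def MeasureEquivIn {α : Type*} (w u : FreeGroup α) (Q : Type*) [Group Q] : Prop :=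
  ∀ g : Q, Nat.card {f : α → Q // FreeGroup.lift f w = g} =
    Nat.card {f : α → Q // FreeGroup.lift f u = g}

/-- Membership in the pseudovariety `𝒩_p(𝒜_f 𝒩_q)`: `Q` has normal subgroups `N ≤ M` with
`N` a `p`-group, `M/N` abelian and `Q/M` a `q`-group. -/
def MemNpAfNq (p q : ℕ) (Q : Type*) [Group Q] : Prop :=
  ∃ N M : Subgroup Q, N.Normal ∧ M.Normal ∧ N ≤ M ∧ IsPGroup p N ∧
    (∀ a ∈ M, ∀ b ∈ M, ⁅a, b⁆ ∈ N) ∧ (∀ x : Q, ∃ n : ℕ, x ^ q ^ n ∈ M)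

/-- The orientable surface relator `[x₁,y₁]⋯[x_d,y_d]`, where `xᵢ = (i, false)` and
`yᵢ = (i, true)`. -/
def orientableRelator (d : ℕ) : FreeGroup (Fin d × Bool) :=
  (List.ofFn fun i : Fin d => ⁅FreeGroup.of (i, false), FreeGroup.of (i, true)⁆).prod

namespace SurfaceWord

section Pencil

variable {k F Λ ι S : Type*} [Field k] [Group F] [Fintype Λ] [Fintype ι]
  [MulAction F S]

/-- The operator on finitely supported `kᶥ`-valued functions on an `F`-set `Ω` given by
`∑ l, M l ⊗ (el l)⁻¹`. -/
noncomputable def pencilOp (el : Λ → F) (M : Λ → Matrix ι ι k) (Ω : Type*) [MulAction F Ω] :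
    (Ω × ι →₀ k) →ₗ[k] (Ω × ι →₀ k) :=
  Finsupp.linearCombination k fun x =>
    ∑ l, ∑ i, Finsupp.single ((el l)⁻¹ • x.1, i) (M l i x.2)

/-- The operator acting on the `ι`-coordinate by a constant matrix. -/
noncomputable def constOp (P : Matrix ι ι k) (Ω : Type*) : (Ω × ι →₀ k) →ₗ[k] (Ω × ι →₀ k) :=
  Finsupp.linearCombination k fun x => ∑ i, Finsupp.single (x.1, i) (P i x.2)

theorem pencilOp_single (el : Λ → F) (M : Λ → Matrix ι ι k) {Ω : Type*} [MulAction F Ω]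
    (w : Ω) (j : ι) (r : k) : pencilOp el M Ω (Finsupp.single (w, j) r) =
      ∑ l, ∑ i, Finsupp.single ((el l)⁻¹ • w, i) (r * M l i j) := by
  simp only [pencilOp, Finsupp.linearCombination_single, Finset.smul_sum, Finsupp.smul_single,
    smul_eq_mul]

theorem constOp_single (P : Matrix ι ι k) {Ω : Type*}
    (w : Ω) (j : ι) (r : k) : constOp P Ω (Finsupp.single (w, j) r) =
      ∑ i, Finsupp.single (w, i) (r * P i j) := by
  simp only [constOp, Finsupp.linearCombination_single, Finset.smul_sum, Finsupp.smul_single,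
    smul_eq_mul]

theorem constOp_one [DecidableEq ι] (Ω : Type*) : constOp (1 : Matrix ι ι k) Ω = LinearMap.id := by
  refine Finsupp.lhom_ext fun x r => ?_
  obtain ⟨w, j⟩ := x
  rw [constOp_single, Finset.sum_eq_single j]
  · simp
  · intro i _ hij
    simp [Matrix.one_apply_ne hij]
  · simp

theorem constOp_mul (P Q : Matrix ι ι k) (Ω : Type*) (v : Ω × ι →₀ k) :
    constOp (P * Q) Ω v = constOp P Ω (constOp Q Ω v) := by
  induction v using Finsupp.induction_linear with
  | zero => simp
  | add f g hf hg => simp only [map_add, hf, hg]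
  | single x r =>
    obtain ⟨w, j⟩ := x
    simp only [constOp_single, map_sum, Matrix.mul_apply, Finset.mul_sum, Finsupp.single_finsetSum]
    rw [Finset.sum_comm]
    refine Finset.sum_congr rfl fun i _ => Finset.sum_congr rfl fun l _ => ?_
    congr 1
    ring

theorem pencilOp_conj (el : Λ → F) (M : Λ → Matrix ι ι k) (P Q : Matrix ι ι k) {Ω : Type*}
    [MulAction F Ω] (v : Ω × ι →₀ k) :
    pencilOp el (fun l => Q * M l * P) Ω v = constOp Q Ω (pencilOp el M Ω (constOp P Ω v)) := by
  induction v using Finsupp.induction_linear with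
  | zero => simp
  | add f g hf hg => simp only [map_add, hf, hg]
  | single x r =>
    obtain ⟨w, j⟩ := x
    simp only [constOp_single, pencilOp_single, map_sum, Matrix.mul_apply, Finset.mul_sum,
      Finset.sum_mul, Finsupp.single_finsetSum]
    have e : ∀ l : Λ, ∑ i, ∑ a, ∑ b,
          Finsupp.single ((el l)⁻¹ • w, i) (r * (Q i b * M l b a * P a j))
        = ∑ a, ∑ b, ∑ i, Finsupp.single ((el l)⁻¹ • w, i) (r * P a j * M l b a * Q i b) := by
      intro l
      rw [Finset.sum_comm]
      refine Finset.sum_congr rfl fun a _ => ?_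
      rw [Finset.sum_comm]
      refine Finset.sum_congr rfl fun b _ => Finset.sum_congr rfl fun i _ => ?_
      congr 1
      ring
    simp only [e]
    rw [Finset.sum_comm]

/-- Push-forward of finitely supported functions along a map of `F`-sets. -/
noncomputable def pushOp {Ω Ω' : Type*} (f : Ω → Ω') : (Ω × ι →₀ k) →ₗ[k] (Ω' × ι →₀ k) :=
  Finsupp.lmapDomain k k (Prod.map f id)

omit [Fintype ι] in
theorem pushOp_single {Ω Ω' : Type*} (f : Ω → Ω') (w : Ω) (j : ι) (r : k) :
    pushOp f (Finsupp.single (w, j) r) = Finsupp.single (f w, j) r := by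
  simp [pushOp]

theorem pushOp_pencilOp (el : Λ → F) (M : Λ → Matrix ι ι k) {Ω Ω' : Type*} [MulAction F Ω]
    [MulAction F Ω'] (f : Ω → Ω') (hf : ∀ (g : F) w, f (g • w) = g • f w) (v : Ω × ι →₀ k) :
    pushOp f (pencilOp el M Ω v) = pencilOp el M Ω' (pushOp f v) := by
  induction v using Finsupp.induction_linear with
  | zero => simp
  | add f g hf hg => simp only [map_add, hf, hg]
  | single x r =>
    obtain ⟨w, j⟩ := x
    simp only [pushOp_single, pencilOp_single, map_sum, hf]

theorem pushOp_constOp (P : Matrix ι ι k) {Ω Ω' : Type*} (f : Ω → Ω') (v : Ω × ι →₀ k) :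
    pushOp f (constOp P Ω v) = constOp P Ω' (pushOp f v) := by
  induction v using Finsupp.induction_linear with
  | zero => simp
  | add f g hf hg => simp only [map_add, hf, hg]
  | single x r =>
    obtain ⟨w, j⟩ := x
    simp only [pushOp_single, constOp_single, map_sum]

/-- The part of degree zero of a pencil whose entries carry degrees `δ`. -/
def leadPart (M : Λ → Matrix ι ι k) (δ : Λ → ι → ι → ℤ) : Λ → Matrix ι ι k :=
  fun l i j => if δ l i j = 0 then M l i j else 0

section Graded

variable {Ω : Type*} [MulAction F Ω] (el : Λ → F) (M : Λ → Matrix ι ι k)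
  (δ : Λ → ι → ι → ℤ) (a b : Ω × ι → ℤ)

theorem filter_pencilOp
    (hδ : ∀ l i j, M l i j ≠ 0 → 0 ≤ δ l i j)
    (hab : ∀ l i j w, M l i j ≠ 0 → b ((el l)⁻¹ • w, i) = a (w, j) + δ l i j)
    (e : ℤ) (v : Ω × ι →₀ k) :
    (pencilOp el M Ω v).filter (fun x => b x = e) =
      pencilOp el (leadPart M δ) Ω (v.filter fun x => a x = e) +
        (pencilOp el M Ω (v.filter fun x => a x < e)).filter (fun x => b x = e) := by
  classical
  induction v using Finsupp.induction_linear with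
  | zero => simp only [map_zero, Finsupp.filter_zero, add_zero]
  | add f g hf hg =>
    simp only [map_add, Finsupp.filter_add, hf, hg]
    abel
  | single x r =>
    obtain ⟨w, j⟩ := x
    rcases lt_trichotomy (a (w, j)) e with h | h | h
    · rw [Finsupp.filter_single_of_neg (fun x => a x = e) (by simpa using h.ne),
        Finsupp.filter_single_of_pos (fun x => a x < e) h]
      simp
    · rw [Finsupp.filter_single_of_pos (fun x => a x = e) h,
        Finsupp.filter_single_of_neg (fun x => a x < e) (by simp [h])]
      simp only [pencilOp_single, map_zero, Finsupp.filter_zero, add_zero]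
      rw [Finsupp.filter_sum]
      refine Finset.sum_congr rfl fun l _ => ?_
      rw [Finsupp.filter_sum]
      refine Finset.sum_congr rfl fun i _ => ?_
      by_cases hM : M l i j = 0
      · simp only [leadPart, hM, mul_zero, Finsupp.single_zero, Finsupp.filter_zero, ite_self]
      · by_cases h0 : δ l i j = 0
        · rw [Finsupp.filter_single_of_pos]
          · simp [leadPart, h0]
          · simp [hab l i j w hM, h0, h]
        · rw [Finsupp.filter_single_of_neg]
          · simp [leadPart, h0]
          · simp [hab l i j w hM, h0, h]
    · rw [Finsupp.filter_single_of_neg (fun x => a x = e) (by simpa using h.ne'),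
        Finsupp.filter_single_of_neg (fun x => a x < e) (by simpa using h.le)]
      simp only [pencilOp_single, map_zero, Finsupp.filter_zero, add_zero]
      rw [Finsupp.filter_sum]
      refine Finset.sum_eq_zero fun l _ => ?_
      rw [Finsupp.filter_sum]
      refine Finset.sum_eq_zero fun i _ => ?_
      by_cases hM : M l i j = 0
      · simp only [hM, mul_zero, Finsupp.single_zero, Finsupp.filter_zero]
      · have := hδ l i j hM
        rw [Finsupp.filter_single_of_neg]
        have := hab l i j w hM
        simp only [this]
        omega

theorem le_degree_of_pencilOp
    (hδ : ∀ l i j, M l i j ≠ 0 → 0 ≤ δ l i j)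
    (hab : ∀ l i j w, M l i j ≠ 0 → b ((el l)⁻¹ • w, i) = a (w, j) + δ l i j)
    (hinj : ∀ v, pencilOp el (leadPart M δ) Ω v = 0 → v = 0)
    (e : ℤ) (v : Ω × ι →₀ k) (hv : ∀ x, pencilOp el M Ω v x ≠ 0 → e ≤ b x) :
    ∀ x, v x ≠ 0 → e ≤ a x := by
  classical
  by_contra! hcon
  obtain ⟨x₀, hx₀, hx₀e⟩ := hcon
  obtain ⟨x, hx, hmin⟩ := v.support.exists_min_image a ⟨x₀, by simpa using hx₀⟩
  have hlt : a x < e := (hmin x₀ (by simpa using hx₀)).trans_lt hx₀e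
  have h1 := filter_pencilOp el M δ a b hδ hab (a x) v
  have h2 : v.filter (fun y => a y < a x) = 0 := by
    ext y
    by_cases hy : a y < a x
    · rw [Finsupp.filter_apply_pos (fun y => a y < a x) _ hy]
      by_contra hne
      exact absurd (hmin y (by simpa using hne)) (not_le.2 hy)
    · rw [Finsupp.filter_apply_neg (fun y => a y < a x) _ hy]; rfl
  have h3 : (pencilOp el M Ω v).filter (fun y => b y = a x) = 0 := by
    ext y
    by_cases hy : b y = a x
    · rw [Finsupp.filter_apply_pos (fun y => b y = a x) _ hy]
      by_contra hne
      have := hv y hne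
      omega
    · rw [Finsupp.filter_apply_neg (fun y => b y = a x) _ hy]; rfl
  rw [h2, h3, map_zero, Finsupp.filter_zero, add_zero] at h1
  have h4 := hinj _ h1.symm
  have h5 := DFunLike.congr_fun h4 x
  rw [Finsupp.filter_apply_pos (fun y => a y = a x) _ rfl] at h5
  exact (by simpa using hx : v x ≠ 0) h5

theorem pencilOp_injective_of_leadPart
    (hδ : ∀ l i j, M l i j ≠ 0 → 0 ≤ δ l i j)
    (hab : ∀ l i j w, M l i j ≠ 0 → b ((el l)⁻¹ • w, i) = a (w, j) + δ l i j)
    (hinj : ∀ v, pencilOp el (leadPart M δ) Ω v = 0 → v = 0)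
    (v : Ω × ι →₀ k) (hv : pencilOp el M Ω v = 0) : v = 0 := by
  ext x
  by_contra hne
  have := le_degree_of_pencilOp el M δ a b hδ hab hinj (a x + 1) v (by simp [hv]) x hne
  omega

end Graded

end Pencil

section Step

variable {k F Λ ι S : Type*} [Field k] [Group F] [Fintype Λ] [Fintype ι] [DecidableEq ι]
  [MulAction F S]

/-- Every nonzero entry `(i, j)` of `M l` matches the degrees `dA j` and `el l • dB i`. -/
def IsHomogeneousPencil (el : Λ → F) (dA dB : ι → S) (M : Λ → Matrix ι ι k) : Prop :=
  ∀ l i j, M l i j ≠ 0 → dA j = el l • dB i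

/-- `P` and `P'` are mutually inverse and preserve degrees. -/
structure IsGauge (d : ι → S) (P P' : Matrix ι ι k) : Prop where
  mul_eq_one : P * P' = 1
  hom : ∀ i j, P i j ≠ 0 → d i = d j
  hom' : ∀ i j, P' i j ≠ 0 → d i = d j

/-- No degree-preserving change of bases produces a zero block that is too large. -/
def IsFullPencil (dA dB : ι → S) (M : Λ → Matrix ι ι k) : Prop :=
  ∀ P P' Q Q' : Matrix ι ι k, IsGauge dA P P' → IsGauge dB Q Q' → ∀ A B : Finset ι,
    (∀ l, ∀ j ∈ A, ∀ i ∉ B, (Q * M l * P) i j = 0) → A.card ≤ B.card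

omit [DecidableEq ι] in
theorem exists_ne_zero_of_mul {P Q : Matrix ι ι k} {i j : ι} (h : (P * Q) i j ≠ 0) :
    ∃ l, P i l ≠ 0 ∧ Q l j ≠ 0 := by
  rw [Matrix.mul_apply] at h
  obtain ⟨l, -, hl⟩ := Finset.exists_ne_zero_of_sum_ne_zero h
  exact ⟨l, left_ne_zero_of_mul hl, right_ne_zero_of_mul hl⟩

theorem IsGauge.one (d : ι → S) : IsGauge d (1 : Matrix ι ι k) 1 where
  mul_eq_one := one_mul 1
  hom i j h := by
    by_contra hne
    exact h (Matrix.one_apply_ne fun e => hne (e ▸ rfl))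
  hom' i j h := by
    by_contra hne
    exact h (Matrix.one_apply_ne fun e => hne (e ▸ rfl))

theorem IsGauge.mul {d : ι → S} {P P' R R' : Matrix ι ι k} (hP : IsGauge d P P')
    (hR : IsGauge d R R') : IsGauge d (P * R) (R' * P') where
  mul_eq_one := by
    rw [Matrix.mul_assoc, ← Matrix.mul_assoc R, hR.mul_eq_one, Matrix.one_mul, hP.mul_eq_one]
  hom i j h := by
    obtain ⟨l, h1, h2⟩ := exists_ne_zero_of_mul h
    exact (hP.hom _ _ h1).trans (hR.hom _ _ h2)
  hom' i j h := by
    obtain ⟨l, h1, h2⟩ := exists_ne_zero_of_mul h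
    exact (hR.hom' _ _ h1).trans (hP.hom' _ _ h2)

theorem IsGauge.mul_eq_one' {d : ι → S} {P P' : Matrix ι ι k} (hP : IsGauge d P P') :
    P' * P = 1 := mul_eq_one_comm.1 hP.mul_eq_one

theorem exists_ne_zero_of_conj {dA dB : ι → S} {P P' Q Q' X : Matrix ι ι k}
    (hP : IsGauge dA P P') (hQ : IsGauge dB Q Q') {i j : ι} (h : (Q * X * P) i j ≠ 0) :
    ∃ i' j', X i' j' ≠ 0 ∧ dB i = dB i' ∧ dA j' = dA j := by
  obtain ⟨j', h1, h2⟩ := exists_ne_zero_of_mul h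
  obtain ⟨i', h3, h4⟩ := exists_ne_zero_of_mul h1
  exact ⟨i', j', h4, hQ.hom _ _ h3, hP.hom _ _ h2⟩

omit [Fintype Λ] in
theorem IsHomogeneousPencil.conj {el : Λ → F} {dA dB : ι → S} {M : Λ → Matrix ι ι k}
    (hM : IsHomogeneousPencil el dA dB M) {P P' Q Q' : Matrix ι ι k}
    (hP : IsGauge dA P P') (hQ : IsGauge dB Q Q') :
    IsHomogeneousPencil el dA dB fun l => Q * M l * P := by
  intro l i j h
  obtain ⟨i', j', h1, h2, h3⟩ := exists_ne_zero_of_conj hP hQ h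
  rw [← h3, h2, hM l i' j' h1]

/-- A `ℤ`-valued cocycle on an `F`-set. -/
structure Cocycle (F S : Type*) [Group F] [MulAction F S] where
  /-- the underlying function -/
  toFun : F → S → ℤ
  map_mul : ∀ g h s, toFun (g * h) s = toFun g (h • s) + toFun h s

/-- The opposite cocycle. -/
def Cocycle.neg (c : Cocycle F S) : Cocycle F S where
  toFun g s := -c.toFun g s
  map_mul g h s := by rw [c.map_mul]; ring

theorem Cocycle.map_one (c : Cocycle F S) (s : S) : c.toFun 1 s = 0 := by
  have := c.map_mul 1 1 s
  simp at this
  exact this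

/-- The skew product of an `F`-set with `ℤ` along a cocycle. -/
@[ext] structure Skew (c : Cocycle F S) where
  /-- the base point -/
  base : S
  /-- the height -/
  height : ℤ

instance (c : Cocycle F S) : MulAction F (Skew c) where
  smul g x := ⟨g • x.base, x.height + c.toFun g x.base⟩
  one_smul x := by
    change (⟨_, _⟩ : Skew c) = x
    ext <;> simp [c.map_one]
  mul_smul g h x := by
    change (⟨_, _⟩ : Skew c) = ⟨_, _⟩
    ext
    · exact mul_smul g h x.base
    · change x.height + c.toFun (g * h) x.base =
        x.height + c.toFun h x.base + c.toFun g (h • x.base)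
      rw [c.map_mul]
      ring

theorem Skew.smul_height {c : Cocycle F S} (g : F) (x : Skew c) :
    (g • x).height = x.height + c.toFun g x.base := rfl

/-- The degree of the entries of a pencil relative to heights. -/
def entryDegree (el : Λ → F) (c : Cocycle F S) (dB : ι → S) (μ ν : ι → ℤ) : Λ → ι → ι → ℤ :=
  fun l i j => μ j - ν i - c.toFun (el l) (dB i)

omit [Fintype Λ] [Fintype ι] [DecidableEq ι] in
theorem isHomogeneousPencil_leadPart {el : Λ → F} {c : Cocycle F S} {dA dB : ι → S}
    {μ ν : ι → ℤ} {M : Λ → Matrix ι ι k} (hM : IsHomogeneousPencil el dA dB M) :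
    IsHomogeneousPencil (S := Skew c) el (fun j => ⟨dA j, μ j⟩) (fun i => ⟨dB i, ν i⟩)
      (leadPart M (entryDegree el c dB μ ν)) := by
  intro l i j h
  unfold leadPart at h
  split_ifs at h with h0
  · ext
    · exact hM l i j h
    · rw [Skew.smul_height]
      unfold entryDegree at h0
      simp only
      omega
  · exact absurd rfl h

theorem IsFullPencil.exists_perm {dA dB : ι → S} {M : Λ → Matrix ι ι k}
    (hfull : IsFullPencil dA dB M) {P P' Q Q' : Matrix ι ι k}
    (hP : IsGauge dA P P') (hQ : IsGauge dB Q Q') :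
    ∃ τ : Equiv.Perm ι, ∀ j, ∃ l, (Q * M l * P) (τ j) j ≠ 0 := by
  classical
  let t : ι → Finset ι := fun j => Finset.univ.filter fun i => ∃ l, (Q * M l * P) i j ≠ 0
  obtain ⟨f, hf, hft⟩ := (Finset.all_card_le_biUnion_card_iff_exists_injective t).1 fun A => by
    refine hfull P P' Q Q' hP hQ A (A.biUnion t) fun l j hj i hi => ?_
    by_contra hne
    exact hi (Finset.mem_biUnion.2 ⟨j, hj, by simpa [t] using ⟨l, hne⟩⟩)
  refine ⟨Equiv.ofBijective f (Finite.injective_iff_bijective.1 hf), fun j => ?_⟩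
  simpa [t] using hft j

/-- The possible heights making all entries of a conjugated pencil nonnegative. -/
def IsStepData (el : Λ → F) (c : Cocycle F S) (dA dB : ι → S) (M : Λ → Matrix ι ι k)
    (P P' Q Q' : Matrix ι ι k) (μ ν : ι → ℤ) : Prop :=
  IsGauge dA P P' ∧ IsGauge dB Q Q' ∧
    ∀ l i j, (Q * M l * P) i j ≠ 0 → 0 ≤ entryDegree el c dB μ ν l i j

theorem sum_le_of_isStepData {el : Λ → F} {c : Cocycle F S} {dA dB : ι → S}
    {M : Λ → Matrix ι ι k} (hfull : IsFullPencil dA dB M) :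
    ∃ C : ℤ, ∀ P P' Q Q' μ ν, IsStepData el c dA dB M P P' Q Q' μ ν →
      ∑ i, ν i - ∑ j, μ j ≤ C := by
  classical
  let C₀ : ℤ := ∑ l, ∑ i, |c.toFun (el l) (dB i)|
  have hC₀ : ∀ l i, -c.toFun (el l) (dB i) ≤ C₀ := by
    intro l i
    refine (neg_le_abs _).trans ?_
    refine (Finset.single_le_sum (f := fun i => |c.toFun (el l) (dB i)|)
      (fun _ _ => abs_nonneg _) (Finset.mem_univ i)).trans ?_
    exact Finset.single_le_sum (f := fun l => ∑ i, |c.toFun (el l) (dB i)|)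
      (fun _ _ => Finset.sum_nonneg fun _ _ => abs_nonneg _) (Finset.mem_univ l)
  refine ⟨∑ _j : ι, C₀, fun P P' Q Q' μ ν ⟨hP, hQ, hd⟩ => ?_⟩
  obtain ⟨τ, hτ⟩ := hfull.exists_perm hP hQ
  rw [← Equiv.sum_comp τ ν, ← Finset.sum_sub_distrib]
  refine Finset.sum_le_sum fun j _ => ?_
  obtain ⟨l, hl⟩ := hτ j
  have h1 := hd l _ _ hl
  have h2 := hC₀ l (τ j)
  unfold entryDegree at h1
  omega

theorem exists_isStepData {el : Λ → F} {c : Cocycle F S} {dA dB : ι → S}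
    {M : Λ → Matrix ι ι k} :
    ∃ μ ν, IsStepData el c dA dB M 1 1 1 1 μ ν := by
  classical
  let C₀ : ℤ := ∑ l, ∑ i, |c.toFun (el l) (dB i)|
  have hC₀ : ∀ l i, c.toFun (el l) (dB i) ≤ C₀ := by
    intro l i
    refine (le_abs_self _).trans ?_
    refine (Finset.single_le_sum (f := fun i => |c.toFun (el l) (dB i)|)
      (fun _ _ => abs_nonneg _) (Finset.mem_univ i)).trans ?_
    exact Finset.single_le_sum (f := fun l => ∑ i, |c.toFun (el l) (dB i)|)
      (fun _ _ => Finset.sum_nonneg fun _ _ => abs_nonneg _) (Finset.mem_univ l)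
  refine ⟨fun _ => C₀, fun _ => 0, IsGauge.one dA, IsGauge.one dB, fun l i j _ => ?_⟩
  have := hC₀ l i
  change 0 ≤ C₀ - 0 - _
  omega

omit [Fintype Λ] in
theorem leadPart_conj {el : Λ → F} {c : Cocycle F S} {dA dB : ι → S}
    {M : Λ → Matrix ι ι k} {μ ν : ι → ℤ} {R R' T T' : Matrix ι ι k}
    (hR : IsGauge (S := Skew c) (fun j => ⟨dA j, μ j⟩) R R')
    (hT : IsGauge (S := Skew c) (fun i => ⟨dB i, ν i⟩) T T') (l : Λ) (i j : ι) :
    (T * leadPart M (entryDegree el c dB μ ν) l * R) i j =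
      leadPart (fun l => T * M l * R) (entryDegree el c dB μ ν) l i j := by
  have key : ∀ a b, T i a * leadPart M (entryDegree el c dB μ ν) l a b * R b j =
      if entryDegree el c dB μ ν l i j = 0 then T i a * M l a b * R b j else 0 := by
    intro a b
    by_cases hTa : T i a = 0
    · simp [hTa]
    by_cases hRb : R b j = 0
    · simp [hRb]
    have h1 := hT.hom _ _ hTa
    have h2 := hR.hom _ _ hRb
    simp only [Skew.mk.injEq] at h1 h2
    have h3 : entryDegree el c dB μ ν l a b = entryDegree el c dB μ ν l i j := by
      unfold entryDegree
      rw [h1.1, h1.2, h2.2]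
    simp only [leadPart, h3]
    split_ifs <;> simp
  simp only [Matrix.mul_apply, Finset.sum_mul, key]
  simp only [leadPart, Matrix.mul_apply, Finset.sum_mul]
  split_ifs <;> simp

theorem exists_full_stepData {el : Λ → F} (c : Cocycle F S) {dA dB : ι → S}
    {M : Λ → Matrix ι ι k} (hfull : IsFullPencil dA dB M) :
    ∃ P P' Q Q' μ ν, IsStepData el c dA dB M P P' Q Q' μ ν ∧
      IsFullPencil (S := Skew c) (fun j => ⟨dA j, μ j⟩) (fun i => ⟨dB i, ν i⟩)
        (leadPart (fun l => Q * M l * P) (entryDegree el c dB μ ν)) := by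
  classical
  obtain ⟨C, hC⟩ := sum_le_of_isStepData (el := el) (c := c) hfull
  obtain ⟨z, ⟨P, P', Q, Q', μ, ν, hdata, hz⟩, hmax⟩ := Int.exists_greatest_of_bdd
    (P := fun z => ∃ P P' Q Q' μ ν, IsStepData el c dA dB M P P' Q Q' μ ν ∧
      z = ∑ i, ν i - ∑ j, μ j)
    ⟨C, fun z ⟨P, P', Q, Q', μ, ν, h, e⟩ => e ▸ hC P P' Q Q' μ ν h⟩
    (by
      obtain ⟨μ, ν, h⟩ := exists_isStepData (el := el) (c := c) (dA := dA) (dB := dB) (M := M)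
      exact ⟨_, _, _, _, _, μ, ν, h, rfl⟩)
  refine ⟨P, P', Q, Q', μ, ν, hdata, fun R R' T T' hR hT A B hAB => ?_⟩
  obtain ⟨hP, hQ, hd⟩ := hdata
  have hR' : IsGauge dA R R' := ⟨hR.mul_eq_one,
    fun i j h => congrArg Skew.base (hR.hom i j h), fun i j h => congrArg Skew.base (hR.hom' i j h)⟩
  have hT' : IsGauge dB T T' := ⟨hT.mul_eq_one,
    fun i j h => congrArg Skew.base (hT.hom i j h), fun i j h => congrArg Skew.base (hT.hom' i j h)⟩
  let μ' : ι → ℤ := fun j => μ j - if j ∈ A then 1 else 0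
  let ν' : ι → ℤ := fun i => ν i - if i ∈ B then 1 else 0
  have hnew : IsStepData el c dA dB M (P * R) (R' * P') (T * Q) (Q' * T') μ' ν' := by
    refine ⟨hP.mul hR', hT'.mul hQ, fun l i j hne => ?_⟩
    have e : T * Q * M l * (P * R) = T * (Q * M l * P) * R := by
      simp only [Matrix.mul_assoc]
    rw [e] at hne
    have hge : 0 ≤ entryDegree el c dB μ ν l i j := by
      obtain ⟨b, h1, h2⟩ := exists_ne_zero_of_mul hne
      obtain ⟨a, h3, h4⟩ := exists_ne_zero_of_mul h1
      have h5 := hd l a b h4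
      have h6 := hT.hom _ _ h3
      have h7 := hR.hom _ _ h2
      simp only [Skew.mk.injEq] at h6 h7
      unfold entryDegree at h5 ⊢
      rw [h6.1, h6.2, ← h7.2]
      exact h5
    have hpos : j ∈ A → i ∉ B → 0 < entryDegree el c dB μ ν l i j := by
      intro hj hi
      refine lt_of_le_of_ne hge fun h0 => ?_
      have h1 := hAB l j hj i hi
      rw [leadPart_conj hR hT] at h1
      simp only [leadPart, ← h0, if_true] at h1
      exact hne h1
    unfold entryDegree at hge hpos ⊢
    simp only [μ', ν']
    split_ifs with h1 h2 h2
    · omega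
    · have := hpos h1 h2
      omega
    · omega
    · omega
  have h1 := hmax _ ⟨_, _, _, _, μ', ν', hnew, rfl⟩
  have h2 : ∑ j, μ' j = ∑ j, μ j - A.card := by
    simp [μ', Finset.sum_sub_distrib]
  have h3 : ∑ j, ν' j = ∑ j, ν j - B.card := by
    simp [ν', Finset.sum_sub_distrib]
  rw [h2, h3, hz] at h1
  omega

end Step

section Descent

variable {k F Λ ι S : Type*} [Field k] [Group F] [Fintype Λ] [Fintype ι] [DecidableEq ι]
  [MulAction F S] {K : Type*}

omit [DecidableEq ι] in
theorem constOp_apply (P : Matrix ι ι k) {Ω : Type*} (v : Ω × ι →₀ k) (w : Ω) (i : ι) :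
    constOp P Ω v (w, i) = ∑ j, P i j * v (w, j) := by
  classical
  induction v using Finsupp.induction_linear with
  | zero => simp
  | add f g hf hg => simp only [map_add, Finsupp.add_apply, hf, hg, mul_add, Finset.sum_add_distrib]
  | single x r =>
    obtain ⟨w', j⟩ := x
    rw [constOp_single, Finsupp.finsetSum_apply, Finset.sum_eq_single i, Finset.sum_eq_single j]
    · by_cases h : w' = w
      · subst h; simp [mul_comm]
      · rw [Finsupp.single_eq_of_ne (by simp [Ne.symm h]),
          Finsupp.single_eq_of_ne (by simp [Ne.symm h]), mul_zero]
    · intro j' _ hj'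
      rw [Finsupp.single_eq_of_ne (by simp [hj']), mul_zero]
    · simp
    · intro i' _ hi'
      rw [Finsupp.single_eq_of_ne (by simp [Ne.symm hi'])]
    · simp

theorem exists_le_of_finsupp {α : Type*} (y : α →₀ k) (b : α → ℤ) :
    ∃ e : ℤ, ∀ x, y x ≠ 0 → e ≤ b x := by
  obtain ⟨e, he⟩ := (y.support.image b).bddBelow
  exact ⟨e, fun x hx => he (Finset.mem_coe.2 (Finset.mem_image_of_mem _ (by simpa using hx)))⟩

/-- The pencil is injective on all members of a family of `F`-sets, and a linear system with
this pencil is solvable over `F` as soon as it is solvable over all members of the family. -/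
def IsSolvable (el : Λ → F) (M : Λ → Matrix ι ι k) (Ω : K → Type*) [∀ κ, MulAction F (Ω κ)]
    (π : ∀ κ, F → Ω κ) : Prop :=
  (∀ κ v, pencilOp el M (Ω κ) v = 0 → v = 0) ∧
    ∀ y : F × ι →₀ k, (∀ κ, ∃ v, pencilOp el M (Ω κ) v = pushOp (π κ) y) →
      ∃ v, pencilOp el M F v = y

variable {el : Λ → F} {M : Λ → Matrix ι ι k} {Ω : K → Type*} [∀ κ, MulAction F (Ω κ)]
  {π : ∀ κ, F → Ω κ}

theorem isSolvable_congr_conj {P P' Q Q' : Matrix ι ι k} (hP : P * P' = 1) (hQ : Q * Q' = 1)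
    (h : IsSolvable el (fun l => Q * M l * P) Ω π) : IsSolvable el M Ω π := by
  have hP' : P' * P = 1 := mul_eq_one_comm.1 hP
  have hQ' : Q' * Q = 1 := mul_eq_one_comm.1 hQ
  have hcancel : ∀ {X Y : Matrix ι ι k} (Ω' : Type _) (v : Ω' × ι →₀ k), X * Y = 1 →
      constOp X Ω' (constOp Y Ω' v) = v := by
    intro X Y Ω' v hXY
    rw [← constOp_mul, hXY, constOp_one]; rfl
  refine ⟨fun κ v hv => ?_, fun y hy => ?_⟩
  · have := h.1 κ (constOp P' _ v) (by
      rw [pencilOp_conj, hcancel _ _ hP, hv, map_zero])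
    rw [← hcancel _ v hP, this, map_zero]
  · obtain ⟨v, hv⟩ := h.2 (constOp Q _ y) fun κ => by
      obtain ⟨v, hv⟩ := hy κ
      exact ⟨constOp P' _ v, by rw [pencilOp_conj, hcancel _ _ hP, hv, pushOp_constOp]⟩
    refine ⟨constOp P _ v, ?_⟩
    rw [pencilOp_conj] at hv
    have e : ∀ (z : F × ι →₀ k), constOp Q' F (constOp Q F z) = z := by
      intro z
      rw [← constOp_mul, hQ', constOp_one]; rfl
    rw [← e (pencilOp el M F _), hv, e]

/-- A potential for the cocycle `c` on all members of the family, normalised at base points. -/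
structure IsPotential (c : Cocycle F S) (π : ∀ κ, F → Ω κ) (ψ : ∀ κ, Ω κ → S → ℤ) : Prop where
  map_smul : ∀ κ (h : F) w s, ψ κ (h • w) (h • s) = ψ κ w s + c.toFun h s
  map_base : ∀ κ s, ψ κ (π κ 1) s = 0

theorem IsPotential.neg {c : Cocycle F S} {ψ : ∀ κ, Ω κ → S → ℤ} (h : IsPotential c π ψ) :
    IsPotential c.neg π (fun κ w s => -ψ κ w s) where
  map_smul κ g w s := by
    rw [h.map_smul]
    change -(_ + _) = -_ + -c.toFun g s
    ring
  map_base κ s := by rw [h.map_base, neg_zero]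

theorem IsPotential.map_mk {c : Cocycle F S} {ψ : ∀ κ, Ω κ → S → ℤ} (h : IsPotential c π ψ)
    (hπ : ∀ κ (g h : F), π κ (g * h) = g • π κ h) (κ : K) (g : F) (s : S) :
    ψ κ (π κ g) s = c.toFun g (g⁻¹ • s) := by
  have := h.map_smul κ g (π κ 1) (g⁻¹ • s)
  rwa [← hπ, mul_one, smul_inv_smul, h.map_base, zero_add] at this

omit [Fintype Λ] [Fintype ι] [DecidableEq ι] in
theorem entryDegree_spec {c : Cocycle F S} {Ω' : Type*} [MulAction F Ω'] {ψ : Ω' → S → ℤ}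
    (hψ : ∀ (h : F) w s, ψ (h • w) (h • s) = ψ w s + c.toFun h s) {dA dB : ι → S}
    (hM : IsHomogeneousPencil el dA dB M) (μ ν : ι → ℤ) (l : Λ) (i j : ι) (w : Ω')
    (h : M l i j ≠ 0) : ψ ((el l)⁻¹ • w) (dB i) - ν i =
      ψ w (dA j) - μ j + entryDegree el c dB μ ν l i j := by
  have h1 := hψ (el l) ((el l)⁻¹ • w) (dB i)
  rw [smul_inv_smul, ← hM l i j h] at h1
  unfold entryDegree
  omega

omit [Group F] [Fintype ι] in
theorem pushOp_apply_ne_zero {Ω' : Type*} {f : F → Ω'} {y : F × ι →₀ k} {x : Ω' × ι}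
    (h : pushOp f y x ≠ 0) : ∃ g, f g = x.1 ∧ y (g, x.2) ≠ 0 := by
  classical
  have h1 := Finsupp.mapDomain_support (Finsupp.mem_support_iff.2 h)
  obtain ⟨⟨g, i⟩, h2, rfl⟩ := Finset.mem_image.1 h1
  exact ⟨g, rfl, by simpa using h2⟩

theorem exists_degree_bound {c : Cocycle F S} {ψ : ∀ κ, Ω κ → S → ℤ} (hψ : IsPotential c π ψ)
    (hπ : ∀ κ (g h : F), π κ (g * h) = g • π κ h) {dA dB : ι → S}
    (hM : IsHomogeneousPencil el dA dB M) {P P' Q Q' : Matrix ι ι k} {μ ν : ι → ℤ}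
    (hd : IsStepData el c dA dB M P P' Q Q' μ ν)
    (hs : IsSolvable el (leadPart (fun l => Q * M l * P) (entryDegree el c dB μ ν)) Ω π)
    (y : F × ι →₀ k) : ∃ C : ℤ, ∀ κ v, pencilOp el M (Ω κ) v = pushOp (π κ) y →
      ∀ w j, v (w, j) ≠ 0 → C ≤ ψ κ w (dA j) := by
  obtain ⟨hP, hQ, hδ⟩ := hd
  have hcancel : ∀ (Ω' : Type _) (v : Ω' × ι →₀ k), constOp P Ω' (constOp P' Ω' v) = v := by
    intro Ω' v
    rw [← constOp_mul, hP.mul_eq_one, constOp_one]; rfl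
  obtain ⟨e, he⟩ := exists_le_of_finsupp (constOp Q F y)
    (fun x => c.toFun x.1 (x.1⁻¹ • dB x.2) - ν x.2)
  refine ⟨e - ∑ j, |μ j|, fun κ v hv w j hj => ?_⟩
  have h1 := le_degree_of_pencilOp el (fun l => Q * M l * P) (entryDegree el c dB μ ν)
    (Ω := Ω κ) (fun x => ψ κ x.1 (dA x.2) - μ x.2) (fun x => ψ κ x.1 (dB x.2) - ν x.2) hδ
    (fun l i j w h => entryDegree_spec (hψ.map_smul κ) (hM.conj hP hQ) μ ν l i j w h) (hs.1 κ) e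
    (constOp P' _ v) (by
      intro x hx
      rw [pencilOp_conj, hcancel, hv, ← pushOp_constOp] at hx
      obtain ⟨g, hg, hy⟩ := pushOp_apply_ne_zero hx
      have := he _ hy
      simp only at this
      rwa [← hg, hψ.map_mk hπ])
  rw [← hcancel _ v, constOp_apply] at hj
  obtain ⟨j', -, hj'⟩ := Finset.exists_ne_zero_of_sum_ne_zero hj
  have h2 := h1 (w, j') (right_ne_zero_of_mul hj')
  rw [hP.hom _ _ (left_ne_zero_of_mul hj')]
  have h3 := Finset.single_le_sum (f := fun j => |μ j|) (fun _ _ => abs_nonneg _)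
    (Finset.mem_univ j')
  have h4 := neg_abs_le (μ j')
  simp only at h2 h3
  omega

omit [Fintype ι] [DecidableEq ι] in
theorem pushOp_filter {c : Cocycle F S} {ψ : ∀ κ, Ω κ → S → ℤ} (hψ : IsPotential c π ψ)
    (hπ : ∀ κ (g h : F), π κ (g * h) = g • π κ h) (dB : ι → S) (ν : ι → ℤ) (lo : ℤ)
    (y : F × ι →₀ k) (κ : K) : (pushOp (π κ) y).filter
      (fun x : Ω κ × ι => ψ κ x.1 (dB x.2) - ν x.2 = lo) =
    pushOp (π κ) (y.filter fun x => c.toFun x.1 (x.1⁻¹ • dB x.2) - ν x.2 = lo) := by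
  classical
  induction y using Finsupp.induction_linear with
  | zero => simp only [map_zero, Finsupp.filter_zero]
  | add f g hf hg => simp only [map_add, Finsupp.filter_add, hf, hg]
  | single x r =>
    obtain ⟨g, i⟩ := x
    rw [pushOp_single]
    by_cases hx : c.toFun g (g⁻¹ • dB i) - ν i = lo
    · rw [Finsupp.filter_single_of_pos
          (fun x : F × ι => c.toFun x.1 (x.1⁻¹ • dB x.2) - ν x.2 = lo) hx,
        Finsupp.filter_single_of_pos
          (fun x : Ω κ × ι => ψ κ x.1 (dB x.2) - ν x.2 = lo), pushOp_single]
      simpa only [hψ.map_mk hπ] using hx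
    · rw [Finsupp.filter_single_of_neg
          (fun x : F × ι => c.toFun x.1 (x.1⁻¹ • dB x.2) - ν x.2 = lo) hx,
        Finsupp.filter_single_of_neg
          (fun x : Ω κ × ι => ψ κ x.1 (dB x.2) - ν x.2 = lo), map_zero]
      simpa only [hψ.map_mk hπ] using hx

omit [DecidableEq ι] in
theorem exists_solution_of_degree_bounds {c : Cocycle F S} {ψ : ∀ κ, Ω κ → S → ℤ}
    (hψ : IsPotential c π ψ)
    (hπ : ∀ κ (g h : F), π κ (g * h) = g • π κ h)
    (hsep : ∀ y : F × ι →₀ k, (∀ κ, pushOp (π κ) y = 0) → y = 0) {dA dB : ι → S}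
    (hM : IsHomogeneousPencil el dA dB M) {μ ν : ι → ℤ}
    (hδ : ∀ l i j, M l i j ≠ 0 → 0 ≤ entryDegree el c dB μ ν l i j)
    (hs : IsSolvable el (leadPart M (entryDegree el c dB μ ν)) Ω π) (n : ℕ) :
    ∀ (lo : ℤ) (y : F × ι →₀ k), (∀ κ, ∃ v, pencilOp el M (Ω κ) v = pushOp (π κ) y ∧
      ∀ w j, v (w, j) ≠ 0 → lo ≤ ψ κ w (dA j) - μ j ∧ ψ κ w (dA j) - μ j < lo + n) →
      ∃ v, pencilOp el M F v = y := by
  classical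
  induction n with
  | zero =>
    intro lo y h
    refine ⟨0, ?_⟩
    rw [map_zero]
    refine (hsep y fun κ => ?_).symm
    obtain ⟨v, hv, hb⟩ := h κ
    have : v = 0 := by
      ext ⟨w, j⟩
      by_contra hne
      have := hb w j hne
      push_cast at this
      omega
    rw [← hv, this, map_zero]
  | succ n ih =>
    intro lo y h
    choose v hv hb using h
    have hlead : ∀ κ, pencilOp el (leadPart M (entryDegree el c dB μ ν)) (Ω κ)
        ((v κ).filter fun x => ψ κ x.1 (dA x.2) - μ x.2 = lo) =
        pushOp (π κ) (y.filter fun x => c.toFun x.1 (x.1⁻¹ • dB x.2) - ν x.2 = lo) := by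
      intro κ
      rw [← pushOp_filter hψ hπ, ← hv, filter_pencilOp el M (entryDegree el c dB μ ν)
        (fun x => ψ κ x.1 (dA x.2) - μ x.2) (fun x => ψ κ x.1 (dB x.2) - ν x.2) hδ
        (fun l i j w h => entryDegree_spec (hψ.map_smul κ) hM μ ν l i j w h)]
      have : (v κ).filter (fun x => ψ κ x.1 (dA x.2) - μ x.2 < lo) = 0 := by
        ext ⟨w, j⟩
        by_cases hx : ψ κ w (dA j) - μ j < lo
        · rw [Finsupp.filter_apply_pos (fun x : Ω κ × ι => ψ κ x.1 (dA x.2) - μ x.2 < lo) _ hx]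
          by_contra hne
          have := (hb κ w j hne).1
          omega
        · rw [Finsupp.filter_apply_neg (fun x : Ω κ × ι => ψ κ x.1 (dA x.2) - μ x.2 < lo) _ hx]
          rfl
      rw [this, map_zero, Finsupp.filter_zero, add_zero]
    obtain ⟨V, hV⟩ := hs.2 _ fun κ => ⟨_, hlead κ⟩
    have hVv : ∀ κ, pushOp (π κ) V =
        (v κ).filter fun x => ψ κ x.1 (dA x.2) - μ x.2 = lo := by
      intro κ
      rw [← sub_eq_zero]
      refine hs.1 κ _ ?_
      rw [map_sub, hlead, ← pushOp_pencilOp _ _ (π κ) (fun g w => hπ κ g w), hV, sub_self]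
    obtain ⟨V', hV'⟩ := ih (lo + 1) (y - pencilOp el M F V) fun κ => by
      refine ⟨v κ - pushOp (π κ) V, ?_, ?_⟩
      · rw [map_sub, map_sub, hv, pushOp_pencilOp _ _ (π κ) (fun g w => hπ κ g w)]
      · intro w j hne
        rw [hVv, Finsupp.sub_apply] at hne
        by_cases hx : ψ κ w (dA j) - μ j = lo
        · rw [Finsupp.filter_apply_pos (fun x : Ω κ × ι => ψ κ x.1 (dA x.2) - μ x.2 = lo) _ hx,
            sub_self] at hne
          exact absurd rfl hne
        · rw [Finsupp.filter_apply_neg (fun x : Ω κ × ι => ψ κ x.1 (dA x.2) - μ x.2 = lo) _ hx,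
            sub_zero] at hne
          have := hb κ w j hne
          push_cast at this
          omega
    exact ⟨V' + V, by rw [map_add, hV', sub_add_cancel]⟩

/-- All full homogeneous pencils with degrees in `S` are solvable. -/
def AllSolvable (k ι S : Type*) [Field k] [Fintype ι] [DecidableEq ι] [MulAction F S]
    (el : Λ → F) (π : ∀ κ, F → Ω κ) : Prop :=
  ∀ (dA dB : ι → S) (M : Λ → Matrix ι ι k), IsHomogeneousPencil el dA dB M →
    IsFullPencil dA dB M → IsSolvable el M Ω π

theorem allSolvable_of_skew {c : Cocycle F S} {ψ : ∀ κ, Ω κ → S → ℤ}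
    (hψ : IsPotential c π ψ)
    (hπ : ∀ κ (g h : F), π κ (g * h) = g • π κ h)
    (hsep : ∀ y : F × ι →₀ k, (∀ κ, pushOp (π κ) y = 0) → y = 0)
    (hpos : AllSolvable k ι (Skew c) el π) (hneg : AllSolvable k ι (Skew c.neg) el π) :
    AllSolvable k ι S el π := by
  intro dA dB M hM hfull
  obtain ⟨P, P', Q, Q', μ, ν, hd, hf⟩ := exists_full_stepData (el := el) c hfull
  obtain ⟨R, R', T, T', μ₂, ν₂, hd₂, hf₂⟩ := exists_full_stepData (el := el) c.neg hfull
  obtain ⟨hP, hQ, hδ⟩ := id hd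
  have hs := hpos _ _ _ (isHomogeneousPencil_leadPart (hM.conj hP hQ)) hf
  have hs₂ := hneg _ _ _ (isHomogeneousPencil_leadPart (hM.conj hd₂.1 hd₂.2.1)) hf₂
  refine isSolvable_congr_conj hP.mul_eq_one hQ.mul_eq_one ⟨fun κ => ?_, fun y hy => ?_⟩
  · exact pencilOp_injective_of_leadPart el (fun l => Q * M l * P) (entryDegree el c dB μ ν)
      (Ω := Ω κ) (fun x => ψ κ x.1 (dA x.2) - μ x.2) (fun x => ψ κ x.1 (dB x.2) - ν x.2) hδ
      (fun l i j w h => entryDegree_spec (hψ.map_smul κ) (hM.conj hP hQ) μ ν l i j w h) (hs.1 κ)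
  · have hcancel : ∀ {X Y : Matrix ι ι k} (Ω' : Type _) (v : Ω' × ι →₀ k), X * Y = 1 →
        constOp X Ω' (constOp Y Ω' v) = v := by
      intro X Y Ω' v hXY
      rw [← constOp_mul, hXY, constOp_one]; rfl
    have hQy : constOp Q F (constOp Q' F y) = y := by
      rw [← constOp_mul, hQ.mul_eq_one, constOp_one]; rfl
    obtain ⟨C, hC⟩ := exists_degree_bound hψ hπ hM hd hs (constOp Q' F y)
    obtain ⟨C₂, hC₂⟩ := exists_degree_bound hψ.neg hπ hM hd₂ hs₂ (constOp Q' F y)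
    let m : ℤ := ∑ j, |μ j|
    have hm : ∀ j, |μ j| ≤ m := fun j =>
      Finset.single_le_sum (f := fun j => |μ j|) (fun _ _ => abs_nonneg _) (Finset.mem_univ j)
    refine exists_solution_of_degree_bounds hψ hπ hsep (hM.conj hP hQ) hδ hs
      (-C₂ + m + 1 - (C - m)).toNat (C - m) y fun κ => ?_
    obtain ⟨v, hv⟩ := hy κ
    refine ⟨v, hv, fun w j hne => ?_⟩
    have hv' : pencilOp el M (Ω κ) (constOp P _ v) = pushOp (π κ) (constOp Q' F y) := by
      rw [pencilOp_conj] at hv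
      rw [pushOp_constOp, ← hv, hcancel _ _ hQ.mul_eq_one']
    have hvP : v = constOp P' _ (constOp P _ v) := (hcancel _ _ hP.mul_eq_one').symm
    rw [hvP, constOp_apply] at hne
    obtain ⟨j', -, hj'⟩ := Finset.exists_ne_zero_of_sum_ne_zero hne
    have h1 := hC κ _ hv' w j' (right_ne_zero_of_mul hj')
    have h2 := hC₂ κ _ hv' w j' (right_ne_zero_of_mul hj')
    rw [← hP.hom' _ _ (left_ne_zero_of_mul hj')] at h1 h2
    have h3 := hm j
    have h4 := neg_abs_le (μ j)
    have h5 := le_abs_self (μ j)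
    have h6 := Int.self_le_toNat (-C₂ + m + 1 - (C - m))
    constructor <;> omega

end Descent

section Adapted

variable {k ι T : Type*} [Field k] [Fintype ι] [DecidableEq ι] [DecidableEq T]

/-- The component of degree `t` of a vector whose coordinates are graded by `d`. -/
def component (d : ι → T) (t : T) : (ι → k) →ₗ[k] (ι → k) where
  toFun v j := if d j = t then v j else 0
  map_add' v w := by ext j; by_cases h : d j = t <;> simp [h]
  map_smul' r v := by ext j; by_cases h : d j = t <;> simp [h]

omit [Fintype ι] [DecidableEq ι] in
theorem component_apply (d : ι → T) (t : T) (v : ι → k) (j : ι) :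
    component d t v j = if d j = t then v j else 0 := rfl

theorem exists_basis_complement (U : Submodule k (ι → k)) :
    ∃ A : Finset ι, A.card = Module.finrank k U ∧
      (∀ v : ι → k, (∀ j ∈ A, v j = 0) → v ∈ U → v = 0) ∧
      ∀ j ∈ A, ∃ v ∈ U, v j = 1 ∧ ∀ j' ∈ A, j' ≠ j → v j' = 0 := by
  classical
  let φ : ι → Module.Dual k U := fun j => (LinearMap.proj j).comp U.subtype
  obtain ⟨κ, a, ha, hspan, hli⟩ := exists_linearIndependent' k φ
  have : Finite κ := Finite.of_injective a ha
  have := Fintype.ofFinite κ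
  let f : U →ₗ[k] (κ → k) := LinearMap.pi fun x => φ (a x)
  have hinj : Function.Injective f := by
    rw [← LinearMap.ker_eq_bot, LinearMap.ker_eq_bot']
    intro v hv
    have hj : ∀ j, φ j v = 0 := by
      intro j
      have hmem : φ j ∈ Submodule.span k (Set.range (φ ∘ a)) := by
        rw [hspan]; exact Submodule.subset_span ⟨j, rfl⟩
      have hle : Submodule.span k (Set.range (φ ∘ a)) ≤
          LinearMap.ker (Module.Dual.eval k U v) := by
        rw [Submodule.span_le]
        rintro _ ⟨x, rfl⟩
        exact congrFun hv x
      exact hle hmem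
    ext j
    exact hj j
  have h1 : Module.finrank k U ≤ Fintype.card κ := by
    simpa using LinearMap.finrank_le_finrank_of_injective hinj
  have h2 : Fintype.card κ ≤ Module.finrank k U := by
    rw [← Subspace.dual_finrank_eq]
    exact hli.fintype_card_le_finrank
  have hcard := le_antisymm h2 h1
  have hsurj : Function.Surjective f := by
    refine (LinearMap.injective_iff_surjective_of_finrank_eq_finrank ?_).1 hinj
    simp [hcard]
  refine ⟨Finset.univ.image a, ?_, ?_, ?_⟩
  · rw [Finset.card_image_of_injective _ ha, Finset.card_univ, hcard]
  · intro v hv hvU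
    have : (⟨v, hvU⟩ : U) = 0 := hinj (by
      ext x
      exact hv _ (Finset.mem_image_of_mem _ (Finset.mem_univ x)))
    exact congrArg Subtype.val this
  · intro j hj
    obtain ⟨x, -, rfl⟩ := Finset.mem_image.1 hj
    obtain ⟨v, hv⟩ := hsurj (Pi.single x 1)
    refine ⟨v, v.2, ?_, ?_⟩
    · simpa [f, φ] using congrFun hv x
    · intro j' hj' hne
      obtain ⟨x', -, rfl⟩ := Finset.mem_image.1 hj'
      have : x' ≠ x := fun h => hne (by rw [h])
      simpa [f, φ, this] using congrFun hv x'

theorem exists_gauge_of_isGraded (d : ι → T) (U : Submodule k (ι → k))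
    (hU : ∀ t, ∀ v ∈ U, component d t v ∈ U) :
    ∃ (P P' : Matrix ι ι k) (A : Finset ι), IsGauge d P P' ∧ A.card = Module.finrank k U ∧
      ∀ v, v ∈ U ↔ ∀ j ∉ A, (P'.mulVec v) j = 0 := by
  classical
  obtain ⟨A, hA, h0, h1⟩ := exists_basis_complement U
  choose! b hbU hb1 hb0 using h1
  let c : ι → ι → k := fun j => component d (d j) (b j)
  have hcU : ∀ j ∈ A, c j ∈ U := fun j hj => hU _ _ (hbU j hj)
  have hc1 : ∀ j ∈ A, c j j = 1 := fun j hj => by simp [c, component_apply, hb1 j hj]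
  have hc0 : ∀ j ∈ A, ∀ j' ∈ A, j' ≠ j → c j j' = 0 := fun j hj j' hj' hne => by
    simp [c, component_apply, hb0 j hj j' hj' hne]
  have hcd : ∀ i j, c j i ≠ 0 → d i = d j := fun i j h => by
    by_contra hne
    simp [c, component_apply, hne] at h
  let E : Matrix ι ι k := Matrix.of fun i j => if j ∈ A ∧ i ∉ A then c j i else 0
  have hE : E * E = 0 := by
    ext i j
    rw [Matrix.mul_apply]
    refine Finset.sum_eq_zero fun l _ => ?_
    by_cases hl : l ∈ A <;> simp [E, hl]
  have hEd : ∀ i j, E i j ≠ 0 → d i = d j := fun i j h => by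
    by_cases hij : j ∈ A ∧ i ∉ A
    · exact hcd i j (by simpa [E, hij] using h)
    · simp [E, hij] at h
  refine ⟨1 + E, 1 - E, A, ⟨?_, ?_, ?_⟩, hA, fun v => ?_⟩
  · rw [mul_sub, mul_one, add_mul, one_mul, hE]; abel
  · intro i j h
    by_cases hij : i = j
    · rw [hij]
    · exact hEd i j (by simpa [Matrix.one_apply_ne hij] using h)
  · intro i j h
    by_cases hij : i = j
    · rw [hij]
    · exact hEd i j (by simpa [Matrix.one_apply_ne hij] using h)
  · have key : ∀ i, v i - ∑ j ∈ A, v j * c j i = if i ∈ A then 0 else ((1 - E).mulVec v) i := by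
      intro i
      by_cases hi : i ∈ A
      · rw [if_pos hi, Finset.sum_eq_single i, hc1 i hi, mul_one, sub_self]
        · intro j hj hne
          rw [hc0 j hj i hi hne.symm, mul_zero]
        · exact fun h => absurd hi h
      · rw [if_neg hi, Matrix.sub_mulVec, Matrix.one_mulVec, Pi.sub_apply]
        congr 1
        rw [Matrix.mulVec, dotProduct, ← Finset.sum_subset (Finset.subset_univ A)]
        · exact Finset.sum_congr rfl fun j hj => by simp [E, hj, hi, mul_comm]
        · intro j _ hj
          simp [E, hj]
    have hs : (∑ j ∈ A, v j • c j) ∈ U := Submodule.sum_mem _ fun j hj =>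
      U.smul_mem _ (hcU j hj)
    have key' : ∀ i, (v - ∑ j ∈ A, v j • c j) i =
        if i ∈ A then 0 else ((1 - E).mulVec v) i := by
      intro i
      rw [← key]
      simp
    constructor
    · intro hv j hj
      have := h0 _ (fun j hj => by rw [key', if_pos hj]) (U.sub_mem hv hs)
      have := congrFun this j
      rwa [key', if_neg hj] at this
    · intro h
      have : v - ∑ j ∈ A, v j • c j = 0 := by
        ext i
        rw [key']
        split_ifs with hi
        · rfl
        · exact h i hi
      rw [sub_eq_zero.1 this]
      exact hs

end Adapted

section Free

variable {k F X Λ ι : Type*} [Field k] [Group F] [Fintype Λ] [Fintype ι] [DecidableEq ι]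

omit [Fintype Λ] in
theorem IsFullPencil.finrank_le {T : Type*} [DecidableEq T] {dA dB : ι → T}
    {M : Λ → Matrix ι ι k} (h : IsFullPencil dA dB M) (U W : Submodule k (ι → k))
    (hU : ∀ t, ∀ v ∈ U, component dA t v ∈ U) (hW : ∀ t, ∀ v ∈ W, component dB t v ∈ W)
    (hUW : ∀ l, ∀ v ∈ U, (M l).mulVec v ∈ W) : Module.finrank k U ≤ Module.finrank k W := by
  obtain ⟨P, P', A, hP, hA, hPU⟩ := exists_gauge_of_isGraded dA U hU
  obtain ⟨Q, Q', B, hQ, hB, hQW⟩ := exists_gauge_of_isGraded dB W hW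
  rw [← hA, ← hB]
  refine h P P' Q' Q hP ⟨hQ.mul_eq_one', hQ.hom', hQ.hom⟩ A B fun l j hj i hi => ?_
  have h1 : P.mulVec (Pi.single j 1) ∈ U := by
    rw [hPU, Matrix.mulVec_mulVec, hP.mul_eq_one', Matrix.one_mulVec]
    intro j' hj'
    rw [Pi.single_eq_of_ne]
    rintro rfl
    exact hj' hj
  have h2 := (hQW _).1 (hUW l _ h1) i hi
  rw [Matrix.mulVec_mulVec, Matrix.mulVec_mulVec] at h2
  simpa using h2

theorem sum_mulVec_injective_of_free {el : Λ → F} {C : Type*} (cl : F → C)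
    (hcl : ∀ l u, u ≠ 1 → cl (el l * u) = cl u) (hcl' : Function.Injective fun l => cl (el l))
    {dA dB : ι → F × X} {M : Λ → Matrix ι ι k}
    (hM : ∀ l i j, M l i j ≠ 0 → dA j = (el l * (dB i).1, (dB i).2))
    (hfull : IsFullPencil dA dB M) (v : ι → k) (hv : (∑ l, M l).mulVec v = 0) : v = 0 := by
  classical
  let f : (ι → k) →ₗ[k] (ι → k) := Matrix.toLin' (∑ l, M l)
  have hf : ∀ v i, f v i = ∑ l, ∑ j, M l i j * v j := by
    intro v i
    simp only [f, Matrix.toLin'_apply, Matrix.mulVec, dotProduct, Matrix.sum_apply, Finset.sum_mul]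
    rw [Finset.sum_comm]
  let U : Submodule k (ι → k) :=
    Submodule.span k {w | ∃ t, ∃ v, f v = 0 ∧ component dA t v = w}
  have hUc : ∀ t v, f v = 0 → component dA t v ∈ U := fun t v hv =>
    Submodule.subset_span ⟨t, v, hv, rfl⟩
  have hU : ∀ t, ∀ v ∈ U, component dA t v ∈ U := by
    intro t v hv
    induction hv using Submodule.span_induction with
    | mem x h =>
      obtain ⟨t', v, hv, rfl⟩ := h
      by_cases htt : t = t'
      · subst htt
        convert hUc t v hv using 1
        ext j
        by_cases h : dA j = t <;> simp [component_apply, h]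
      · convert U.zero_mem using 1
        ext j
        by_cases h : dA j = t
        · simp [component_apply, h, htt]
        · simp [component_apply, h]
    | zero => rw [map_zero]; exact U.zero_mem
    | add x y _ _ hx hy => rw [map_add]; exact U.add_mem hx hy
    | smul a x _ hx => rw [map_smul]; exact U.smul_mem _ hx
  have hUsum : ∀ (p : F × X → Prop) v, f v = 0 → (fun j => if p (dA j) then v j else 0) ∈ U := by
    intro p v hv
    have : (fun j => if p (dA j) then v j else 0) =
        ∑ t ∈ (Finset.univ.image dA).filter p, component dA t v := by
      ext j
      rw [Finset.sum_apply]
      by_cases hp : p (dA j)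
      · rw [if_pos hp, Finset.sum_eq_single (dA j)]
        · simp [component_apply]
        · intro t _ ht
          simp [component_apply, ht.symm]
        · intro h
          exact absurd (Finset.mem_filter.2 ⟨Finset.mem_image_of_mem _ (Finset.mem_univ j), hp⟩) h
      · rw [if_neg hp]
        refine (Finset.sum_eq_zero fun t ht => ?_).symm
        have := (Finset.mem_filter.1 ht).2
        rw [component_apply, if_neg]
        rintro rfl
        exact hp this
    rw [this]
    exact Submodule.sum_mem _ fun t _ => hUc t v hv
  have hUW : ∀ l, ∀ v ∈ U, (M l).mulVec v ∈ U.map f := by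
    intro l v hv
    induction hv using Submodule.span_induction with
    | mem x h =>
      obtain ⟨t, v, hv, rfl⟩ := h
      refine ⟨_, hUsum (fun t' => t'.2 = t.2 ∧ cl (t'.1 * ((el l)⁻¹ * t.1)⁻¹) = cl (el l)) v hv, ?_⟩
      ext i
      rw [hf]
      have hvi := congrFun hv i
      rw [hf] at hvi
      by_cases hs : (dB i).2 = t.2
      · by_cases hh : (dB i).1 = (el l)⁻¹ * t.1
        · rw [Finset.sum_eq_single l]
          · refine Finset.sum_congr rfl fun j _ => ?_
            by_cases h0 : M l i j = 0
            · simp [h0]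
            · have h1 := hM _ _ _ h0
              rw [component_apply, if_pos, if_pos]
              · rw [h1, hh, mul_inv_cancel_left]
                exact Prod.ext rfl hs
              · rw [h1, hh]
                exact ⟨hs, by simp⟩
          · intro l' _ hl'
            refine Finset.sum_eq_zero fun j _ => ?_
            by_cases h0 : M l' i j = 0
            · simp [h0]
            · have h1 := hM _ _ _ h0
              rw [if_neg, mul_zero]
              rw [h1, hh]
              rintro ⟨-, h2⟩
              refine hl' (hcl' ?_)
              simpa [mul_assoc] using h2
          · simp
        · have hne : (dB i).1 * ((el l)⁻¹ * t.1)⁻¹ ≠ 1 := by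
            rwa [Ne, mul_inv_eq_one]
          have hR : (M l).mulVec (component dA t v) i = 0 := by
            refine Finset.sum_eq_zero fun j _ => ?_
            by_cases h0 : M l i j = 0
            · simp [h0]
            · rw [component_apply, if_neg, mul_zero]
              intro h2
              apply hh
              rw [← h2, hM _ _ _ h0]
              simp
          rw [hR]
          by_cases hc : cl ((dB i).1 * ((el l)⁻¹ * t.1)⁻¹) = cl (el l)
          · refine Eq.trans
              (Finset.sum_congr rfl fun l' _ => Finset.sum_congr rfl fun j _ => ?_) hvi
            by_cases h0 : M l' i j = 0
            · simp [h0]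
            · rw [if_pos]
              rw [hM _ _ _ h0]
              refine ⟨hs, ?_⟩
              simp only
              rw [mul_assoc, hcl _ _ hne, hc]
          · refine Finset.sum_eq_zero fun l' _ => Finset.sum_eq_zero fun j _ => ?_
            by_cases h0 : M l' i j = 0
            · simp [h0]
            · rw [if_neg, mul_zero]
              rw [hM _ _ _ h0]
              rintro ⟨-, h2⟩
              simp only at h2
              rw [mul_assoc, hcl _ _ hne] at h2
              exact hc h2
      · have hR : (M l).mulVec (component dA t v) i = 0 := by
          refine Finset.sum_eq_zero fun j _ => ?_
          by_cases h0 : M l i j = 0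
          · simp [h0]
          · rw [component_apply, if_neg, mul_zero]
            intro h2
            apply hs
            rw [← h2, hM _ _ _ h0]
        rw [hR]
        refine Finset.sum_eq_zero fun l' _ => Finset.sum_eq_zero fun j _ => ?_
        by_cases h0 : M l' i j = 0
        · simp [h0]
        · rw [if_neg, mul_zero]
          rw [hM _ _ _ h0]
          exact fun h2 => hs h2.1
    | zero => rw [Matrix.mulVec_zero]; exact Submodule.zero_mem _
    | add x y _ _ hx hy => rw [Matrix.mulVec_add]; exact Submodule.add_mem _ hx hy
    | smul a x _ hx => rw [Matrix.mulVec_smul]; exact Submodule.smul_mem _ _ hx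
  have hW : ∀ t, ∀ w ∈ U.map f, component dB t w ∈ U.map f := by
    rintro t _ ⟨v, hv, rfl⟩
    have : component dB t (f v) =
        ∑ l, (M l).mulVec (component dA (el l * t.1, t.2) v) := by
      ext i
      rw [component_apply, Finset.sum_apply, hf]
      split_ifs with h
      · refine Finset.sum_congr rfl fun l _ => Finset.sum_congr rfl fun j _ => ?_
        by_cases h0 : M l i j = 0
        · simp [h0]
        · rw [component_apply, if_pos]
          rw [hM _ _ _ h0, h]
      · refine (Finset.sum_eq_zero fun l _ => Finset.sum_eq_zero fun j _ => ?_).symm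
        by_cases h0 : M l i j = 0
        · simp [h0]
        · rw [component_apply, if_neg, mul_zero]
          rw [hM _ _ _ h0]
          intro h2
          rw [Prod.ext_iff] at h2
          exact h (Prod.ext (mul_left_cancel h2.1) h2.2)
    rw [this]
    exact Submodule.sum_mem _ fun l _ => hUW _ _ (hU _ _ hv)
  have hle := hfull.finrank_le U (U.map f) hU hW hUW
  have hrn := LinearMap.finrank_range_add_finrank_ker (f.domRestrict U)
  have hr : LinearMap.range (f.domRestrict U) = U.map f := by
    rw [LinearMap.domRestrict, LinearMap.range_comp, Submodule.range_subtype]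
  rw [hr] at hrn
  have hker : Module.finrank k (LinearMap.ker (f.domRestrict U)) = 0 := by omega
  have hbot := Submodule.finrank_eq_zero.1 hker
  have hvU : v ∈ U := by simpa using hUsum (fun _ => True) v hv
  have : (⟨v, hvU⟩ : U) ∈ LinearMap.ker (f.domRestrict U) := hv
  rw [hbot, Submodule.mem_bot] at this
  exact congrArg Subtype.val this

end Free

section Terminal

variable {I : Type*} [DecidableEq I]

/-- The identity and the free generators. -/
def letterOrOne : Option I → FreeGroup I
  | none => 1
  | some l => FreeGroup.of l

omit [DecidableEq I] in
theorem letterOrOne_none : letterOrOne (none : Option I) = 1 := rfl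

omit [DecidableEq I] in
theorem letterOrOne_some (l : I) : letterOrOne (some l) = FreeGroup.of l := rfl

/-- The generator by which a reduced word ends, if any. -/
def lastLetter (w : FreeGroup I) : Option I :=
  match w.toWord.getLast? with
  | some (l, true) => some l
  | _ => none

theorem lastLetter_letterOrOne (l : Option I) : lastLetter (letterOrOne l) = l := by
  cases l <;> simp [lastLetter, letterOrOne]

theorem lastLetter_letterOrOne_mul (l : Option I) (u : FreeGroup I) (hu : u ≠ 1) :
    lastLetter (letterOrOne l * u) = lastLetter u := by
  cases l with
  | none => rw [letterOrOne_none, one_mul]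
  | some l =>
    have hne : u.toWord ≠ [] := fun h => hu (FreeGroup.toWord_eq_nil_iff.1 h)
    obtain ⟨hd, tl, h⟩ := List.exists_cons_of_ne_nil hne
    have hw : (FreeGroup.of l * u).toWord = if l = hd.1 ∧ true = !hd.2 then tl
        else (l, true) :: hd :: tl := by
      have : FreeGroup.of l * u = FreeGroup.mk ((l, true) :: u.toWord) := by
        conv_lhs => rw [← FreeGroup.mk_toWord (x := u)]
        rfl
      rw [this, FreeGroup.toWord_mk, FreeGroup.reduce.cons, FreeGroup.reduce_toWord, h]
    unfold lastLetter
    rw [letterOrOne_some, hw, h]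
    split_ifs with hc
    · cases tl with
      | nil =>
        obtain ⟨a, b⟩ := hd
        obtain ⟨-, hb⟩ := hc
        cases b with
        | true => simp at hb
        | false => rfl
      | cons x xs => simp
    · simp

theorem norm_letterOrOne_le (l : Option I) : (letterOrOne l).norm ≤ 1 := by
  cases l
  · simp [letterOrOne]
  · simp [letterOrOne]

/-- Acting on the `j`-th coordinate by `g j`. -/
noncomputable def shiftOp {k F ι : Type*} [Field k] [Group F] (g : ι → F) (Ω : Type*)
    [MulAction F Ω] : (Ω × ι →₀ k) ≃ₗ[k] (Ω × ι →₀ k) :=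
  Finsupp.domLCongr
    { toFun := fun x => (g x.2 • x.1, x.2)
      invFun := fun x => ((g x.2)⁻¹ • x.1, x.2)
      left_inv := fun x => by simp
      right_inv := fun x => by simp }

theorem shiftOp_single {k F ι : Type*} [Field k] [Group F] (g : ι → F) {Ω : Type*}
    [MulAction F Ω] (w : Ω) (j : ι) (r : k) :
    shiftOp g Ω (Finsupp.single (w, j) r) = Finsupp.single (g j • w, j) r := by
  simp [shiftOp]

variable {k ι S : Type*} [Field k] [Fintype ι] [DecidableEq ι]

theorem IsFullPencil.of_comp {Λ T : Type*} {dA dB : ι → S} {M : Λ → Matrix ι ι k}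
    (h : IsFullPencil dA dB M) (f : T → S) {dA' dB' : ι → T} (hA : ∀ j, f (dA' j) = dA j)
    (hB : ∀ i, f (dB' i) = dB i) : IsFullPencil dA' dB' M := by
  intro P P' Q Q' hP hQ
  refine h P P' Q Q' ⟨hP.mul_eq_one, fun i j h => ?_, fun i j h => ?_⟩
    ⟨hQ.mul_eq_one, fun i j h => ?_, fun i j h => ?_⟩
  · rw [← hA, ← hA, hP.hom i j h]
  · rw [← hA, ← hA, hP.hom' i j h]
  · rw [← hB, ← hB, hQ.hom i j h]
  · rw [← hB, ← hB, hQ.hom' i j h]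

omit [DecidableEq ι] in
theorem pencilOp_shiftOp {Λ F : Type*} [Group F] [Fintype Λ] {el : Λ → F}
    {M : Λ → Matrix ι ι k} {gA gB : ι → F} (h : ∀ l i j, M l i j ≠ 0 → gA j = el l * gB i)
    (Ω : Type*) [MulAction F Ω] (v : Ω × ι →₀ k) :
    pencilOp el M Ω (shiftOp gA Ω v) = shiftOp gB Ω (constOp (∑ l, M l) Ω v) := by
  induction v using Finsupp.induction_linear with
  | zero => simp
  | add f g hf hg => simp only [map_add, hf, hg]
  | single x r =>
    obtain ⟨w, j⟩ := x
    simp only [shiftOp_single, pencilOp_single, constOp_single, map_sum, Matrix.sum_apply,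
      Finset.mul_sum, Finsupp.single_finsetSum]
    rw [Finset.sum_comm]
    refine Finset.sum_congr rfl fun i _ => Finset.sum_congr rfl fun l _ => ?_
    by_cases h0 : M l i j = 0
    · simp [h0]
    · rw [h l i j h0, smul_smul, inv_mul_cancel_left]

variable [MulAction (FreeGroup I) S]

theorem exists_smul_eq_of_walk {V : Type*} {G : SimpleGraph V} {deg : V → S}
    (hG : ∀ u v, G.Adj u v → ∃ g : FreeGroup I, g.norm ≤ 1 ∧ deg v = g • deg u) {u v : V}
    (w : G.Walk u v) : ∃ g : FreeGroup I, g.norm ≤ w.length ∧ deg v = g • deg u := by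
  induction w with
  | nil => exact ⟨1, by simp⟩
  | cons h w ih =>
    obtain ⟨g, hg, e⟩ := ih
    obtain ⟨g', hg', e'⟩ := hG _ _ h
    refine ⟨g * g', ?_, ?_⟩
    · have := FreeGroup.norm_mul_le g g'
      rw [SimpleGraph.Walk.length_cons]
      omega
    · rw [e, e', smul_smul]

omit [DecidableEq ι] in
theorem exists_free_degrees [Fintype I]
    (hS : ∀ (g : FreeGroup I) (s : S), g • s = s → g.norm ≤ 4 * Fintype.card ι + 1 → g = 1)
    {dA dB : ι → S} {M : Option I → Matrix ι ι k}
    (hM : IsHomogeneousPencil letterOrOne dA dB M) :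
    ∃ (gA gB : ι → FreeGroup I) (rA rB : ι → S), (∀ j, dA j = gA j • rA j) ∧
      (∀ i, dB i = gB i • rB i) ∧
      ∀ l i j, M l i j ≠ 0 → gA j = letterOrOne l * gB i ∧ rA j = rB i := by
  classical
  let r : ι ⊕ ι → ι ⊕ ι → Prop := fun a b => ∃ l i j, M l i j ≠ 0 ∧ a = .inl i ∧ b = .inr j
  let G := SimpleGraph.fromRel r
  let deg : ι ⊕ ι → S := Sum.elim dB dA
  have hG : ∀ u v, G.Adj u v → ∃ g : FreeGroup I, g.norm ≤ 1 ∧ deg v = g • deg u := by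
    intro u v h
    rw [SimpleGraph.fromRel_adj] at h
    obtain ⟨-, ⟨l, i, j, h0, rfl, rfl⟩ | ⟨l, i, j, h0, rfl, rfl⟩⟩ := h
    · exact ⟨letterOrOne l, norm_letterOrOne_le l, hM l i j h0⟩
    · refine ⟨(letterOrOne l)⁻¹, by rw [FreeGroup.norm_inv_eq]; exact norm_letterOrOne_le l, ?_⟩
      rw [eq_inv_smul_iff]
      exact (hM l i j h0).symm
  let root : ι ⊕ ι → ι ⊕ ι := fun v => (G.connectedComponentMk v).out
  have hroot : ∀ v, G.Reachable (root v) v := fun v =>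
    SimpleGraph.ConnectedComponent.exact (Quot.out_eq _)
  have hg : ∀ v, ∃ g : FreeGroup I, g.norm ≤ 2 * Fintype.card ι ∧ deg v = g • deg (root v) := by
    intro v
    obtain ⟨p, hp⟩ := (hroot v).exists_isPath
    obtain ⟨g, h1, h2⟩ := exists_smul_eq_of_walk hG p
    refine ⟨g, ?_, h2⟩
    have := hp.length_lt
    rw [Fintype.card_sum] at this
    omega
  choose g hg1 hg2 using hg
  refine ⟨fun j => g (.inr j), fun i => g (.inl i), fun j => deg (root (.inr j)),
    fun i => deg (root (.inl i)), fun j => hg2 (.inr j), fun i => hg2 (.inl i), fun l i j h0 => ?_⟩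
  have hadj : G.Adj (.inl i) (.inr j) := by
    rw [SimpleGraph.fromRel_adj]
    exact ⟨by simp, Or.inl ⟨l, i, j, h0, rfl, rfl⟩⟩
  have hr : root (.inr j) = root (.inl i) := by
    simp only [root]
    rw [SimpleGraph.ConnectedComponent.sound hadj.reachable]
  refine ⟨?_, congrArg deg hr⟩
  have h1 := hg2 (.inr j)
  have h2 := hM l i j h0
  have h3 := hg2 (.inl i)
  change dA j = _ at h1
  change dB i = _ at h3
  rw [hr] at h1
  rw [h1, h3, smul_smul] at h2
  have h4 := hS ((g (.inr j))⁻¹ * (letterOrOne l * g (.inl i))) (deg (root (.inl i))) (by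
    rw [mul_smul, ← h2, inv_smul_smul]) (by
    refine (FreeGroup.norm_mul_le _ _).trans ?_
    rw [FreeGroup.norm_inv_eq]
    have := FreeGroup.norm_mul_le (letterOrOne l) (g (.inl i))
    have := norm_letterOrOne_le l
    have := hg1 (.inl i)
    have := hg1 (.inr j)
    omega)
  exact inv_mul_eq_one.1 h4

theorem allSolvable_of_norm_lt [Fintype I] {K : Type*} {Ω : K → Type*}
    [∀ κ, MulAction (FreeGroup I) (Ω κ)] (π : ∀ κ, FreeGroup I → Ω κ)
    (hS : ∀ (g : FreeGroup I) (s : S), g • s = s → g.norm ≤ 4 * Fintype.card ι + 1 → g = 1) :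
    AllSolvable k ι S letterOrOne π := by
  intro dA dB M hM hfull
  obtain ⟨gA, gB, rA, rB, hA, hB, hg⟩ := exists_free_degrees hS hM
  have hinj := sum_mulVec_injective_of_free (X := S) lastLetter lastLetter_letterOrOne_mul
    (fun l l' h => by simpa [lastLetter_letterOrOne] using h)
    (dA := fun j => (gA j, rA j)) (dB := fun i => (gB i, rB i)) (M := M)
    (fun l i j h0 => Prod.ext (hg l i j h0).1 (hg l i j h0).2)
    (hfull.of_comp (fun x => x.1 • x.2) (fun j => (hA j).symm) fun i => (hB i).symm)
  have hu : IsUnit (∑ l, M l) := by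
    rw [← Matrix.mulVec_injective_iff_isUnit]
    intro v w hvw
    rw [← sub_eq_zero]
    refine hinj _ ?_
    rw [Matrix.mulVec_sub, sub_eq_zero]
    exact hvw
  obtain ⟨N, hN⟩ := hu.exists_right_inv
  have hN' := mul_eq_one_comm.1 hN
  refine ⟨fun κ v hv => ?_, fun y _ => ?_⟩
  · obtain ⟨v, rfl⟩ := (shiftOp gA (Ω κ)).surjective v
    rw [pencilOp_shiftOp (fun l i j h0 => (hg l i j h0).1),
      LinearEquiv.map_eq_zero_iff] at hv
    have : v = constOp N _ (constOp (∑ l, M l) _ v) := by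
      rw [← constOp_mul, hN', constOp_one]; rfl
    rw [this, hv, map_zero, map_zero]
  · refine ⟨shiftOp gA _ (constOp N _ ((shiftOp gB _).symm y)), ?_⟩
    rw [pencilOp_shiftOp (fun l i j h0 => (hg l i j h0).1), ← constOp_mul, hN, constOp_one]
    simp

end Terminal

section Flow

variable {I X : Type} [MulAction (FreeGroup I) X]

open Classical in
/-- The permutation of `(X × I → ℤ) × X` which moves along the edge labelled by a generator and
counts the traversed edge. -/
noncomputable def flowPerm (l : I) : Equiv.Perm ((X × I → ℤ) × X) where
  toFun x := (x.1 + Pi.single (x.2, l) 1, FreeGroup.of l • x.2)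
  invFun x := (x.1 - Pi.single ((FreeGroup.of l)⁻¹ • x.2, l) 1, (FreeGroup.of l)⁻¹ • x.2)
  left_inv x := by simp
  right_inv x := by simp

/-- The signed number of times that the path described by `g` and starting at `s` traverses the
edges of the Schreier graph. -/
noncomputable def flow (g : FreeGroup I) (s : X) : X × I → ℤ :=
  (FreeGroup.lift flowPerm g (0, s)).1

theorem lift_flowPerm (g : FreeGroup I) (m : X × I → ℤ) (s : X) :
    FreeGroup.lift flowPerm g (m, s) = (m + flow g s, g • s) := by
  have h2 : ∀ x : (X × I → ℤ) × X, (FreeGroup.lift flowPerm g x).2 = g • x.2 := by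
    induction g using FreeGroup.induction_on with
    | C1 => simp
    | of l => simp [flowPerm]
    | inv_of l _ => intro x; rw [map_inv, FreeGroup.lift_apply_of]; rfl
    | mul a b ha hb => intro x; rw [map_mul, Equiv.Perm.mul_apply, ha, hb, mul_smul]
  have h1 : ∀ (m : X × I → ℤ) (x : (X × I → ℤ) × X), FreeGroup.lift flowPerm g (m + x.1, x.2) =
      (m + (FreeGroup.lift flowPerm g x).1, (FreeGroup.lift flowPerm g x).2) := by
    clear h2
    induction g using FreeGroup.induction_on with
    | C1 => simp
    | of l => intro m x; simp [flowPerm, add_assoc]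
    | inv_of l _ =>
      intro m x
      rw [map_inv, FreeGroup.lift_apply_of]
      exact Prod.ext (add_sub_assoc _ _ _) rfl
    | mul a b ha hb =>
      intro m x
      rw [map_mul, Equiv.Perm.mul_apply, hb, ha, Equiv.Perm.mul_apply]
  have := h1 m (0, s)
  rw [h2] at this
  simpa [flow] using this

theorem flow_mul (g h : FreeGroup I) (s : X) : flow (g * h) s = flow g (h • s) + flow h s := by
  have h1 := lift_flowPerm (g * h) 0 s
  rw [map_mul, Equiv.Perm.mul_apply, lift_flowPerm h, lift_flowPerm g] at h1
  have h2 := congrArg Prod.fst h1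
  simp only [zero_add] at h2
  rw [← h2, add_comm]

theorem flow_one (s : X) : flow (1 : FreeGroup I) s = 0 := by simp [flow]

open Classical in
theorem flow_of (l : I) (s : X) : flow (FreeGroup.of l) s = Pi.single (s, l) 1 := by
  simp [flow, flowPerm]

theorem flow_inv (g : FreeGroup I) (s : X) : flow g⁻¹ s = -flow g (g⁻¹ • s) := by
  have := flow_mul g g⁻¹ s
  rw [mul_inv_cancel, flow_one] at this
  rw [eq_neg_iff_add_eq_zero, add_comm, this]

/-- The letter `z`, read at the vertex `t`, traverses the edge `e`. -/
def Traverses (z : I × Bool) (t : X) (e : X × I) : Prop :=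
  z.1 = e.2 ∧ if z.2 then t = e.1 else t = FreeGroup.of e.2 • e.1

theorem flow_letter (z : I × Bool) (t : X) (e : X × I) :
    (Traverses z t e → flow (FreeGroup.mk [z]) t e = if z.2 then 1 else -1) ∧
      (¬ Traverses z t e → flow (FreeGroup.mk [z]) t e = 0) := by
  classical
  obtain ⟨l, b⟩ := z
  obtain ⟨s, l'⟩ := e
  cases b
  · have hz : FreeGroup.mk [(l, false)] = (FreeGroup.of l)⁻¹ := rfl
    rw [hz, flow_inv, flow_of, Pi.neg_apply]
    constructor
    · rintro ⟨h1, h2⟩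
      simp only at h1
      subst h1
      simp only [Bool.false_eq_true, if_false] at h2
      simp [h2]
    · intro h
      rw [Pi.single_eq_of_ne, neg_zero]
      intro h'
      rw [Prod.mk.injEq] at h'
      apply h
      refine ⟨h'.2.symm, ?_⟩
      simp [h'.1, h'.2]
  · have hz : FreeGroup.mk [(l, true)] = FreeGroup.of l := rfl
    rw [hz, flow_of]
    constructor
    · rintro ⟨h1, h2⟩
      simp only at h1
      subst h1
      simp only [if_true] at h2
      simp [h2]
    · intro h
      rw [Pi.single_eq_of_ne]
      intro h'
      rw [Prod.mk.injEq] at h'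
      apply h
      refine ⟨h'.2.symm, ?_⟩
      simp [h'.1]

theorem exists_traverses (L : List (I × Bool)) (s : X) (e : X × I)
    (h : flow (FreeGroup.mk L) s e ≠ 0) :
    ∃ L₁ z L₂, L = L₁ ++ z :: L₂ ∧ Traverses z (FreeGroup.mk L₂ • s) e := by
  induction L with
  | nil => exact absurd (congrFun (flow_one s) e) h
  | cons z L ih =>
    have hz : FreeGroup.mk (z :: L) = FreeGroup.mk [z] * FreeGroup.mk L := rfl
    by_cases ht : Traverses z (FreeGroup.mk L • s) e
    · exact ⟨[], z, L, rfl, ht⟩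
    · rw [hz, flow_mul, Pi.add_apply, (flow_letter _ _ _).2 ht, zero_add] at h
      obtain ⟨L₁, z', L₂, rfl, h'⟩ := ih h
      exact ⟨z :: L₁, z', L₂, rfl, h'⟩

variable [DecidableEq I]

/-- Only the trivial element among those of length at most `n` has a fixed point. -/
def NoShortStabilizer (I X : Type) [DecidableEq I] [MulAction (FreeGroup I) X] (n : ℕ) : Prop :=
  ∀ (g : FreeGroup I) (s : X), g • s = s → g.norm ≤ n → g = 1

theorem NoShortStabilizer.flow_eq {n : ℕ} (h : NoShortStabilizer I X n) {g : FreeGroup I}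
    (hg : g.norm = n + 1) (s : X) : ∃ e, flow g s e = 1 ∨ flow g s e = -1 := by
  have hred : FreeGroup.IsReduced g.toWord := FreeGroup.isReduced_toWord
  have hgL : FreeGroup.mk g.toWord = g := FreeGroup.mk_toWord
  have hlen : g.toWord.length = n + 1 := hg
  obtain ⟨L, y, hL⟩ : ∃ L y, g.toWord = L ++ [y] := by
    rcases List.eq_nil_or_concat g.toWord with h | ⟨L, y, h⟩
    · rw [h] at hlen; simp at hlen
    · exact ⟨L, y, by simpa using h⟩
  rw [hL] at hred hgL hlen
  rw [List.length_append, List.length_singleton] at hlen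
  have hnorm : ∀ L' : List (I × Bool), FreeGroup.IsReduced L' →
      (FreeGroup.mk L').norm = L'.length :=
    fun L' h => by rw [FreeGroup.norm, FreeGroup.toWord_mk, h.reduce_eq]
  let e : X × I := (if y.2 then s else (FreeGroup.of y.1)⁻¹ • s, y.1)
  have hy : Traverses y s e := by
    refine ⟨rfl, ?_⟩
    cases hb : y.2 <;> simp [e, hb]
  have h0 : flow (FreeGroup.mk L) (FreeGroup.mk [y] • s) e = 0 := by
    by_contra hne
    obtain ⟨L₁, z, L₂, rfl, ht⟩ := exists_traverses _ _ _ hne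
    rw [smul_smul] at ht
    have hyz : z.1 = y.1 := ht.1
    by_cases hb : z.2 = y.2
    · have hfix : (FreeGroup.mk (L₂ ++ [y])) • s = s := by
        have h1 := ht.2
        have h2 := hy.2
        rw [← FreeGroup.mul_mk]
        rw [hb] at h1
        cases hby : y.2 <;> simp only [hby, Bool.false_eq_true, if_true, if_false] at h1 h2 <;>
          rw [h1, ← h2]
      have hr : FreeGroup.IsReduced (L₂ ++ [y]) := by
        refine List.IsChain.right_of_append (l₁ := L₁ ++ [z]) ?_
        simpa [FreeGroup.IsReduced] using hred
      have h1 := h _ _ hfix (by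
        rw [hnorm _ hr]
        simp only [List.length_append, List.length_cons, List.length_nil] at hlen ⊢
        omega)
      have h2 := hnorm _ hr
      rw [h1] at h2
      simp at h2
    · have hfix : FreeGroup.mk L₂ • (FreeGroup.mk [y] • s) = FreeGroup.mk [y] • s := by
        have h1 := ht.2
        have h2 := hy.2
        rw [smul_smul]
        obtain ⟨l, b⟩ := y
        obtain ⟨l', b'⟩ := z
        simp only at hyz hb h1 h2
        subst hyz
        cases b
        · have hz : FreeGroup.mk [(l', false)] = (FreeGroup.of l')⁻¹ := rfl
          obtain rfl : b' = true := by simpa using hb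
          simp only [Bool.false_eq_true, if_true, if_false] at h1 h2
          rw [h1, h2, hz, inv_smul_smul]
        · have hz : FreeGroup.mk [(l', true)] = FreeGroup.of l' := rfl
          obtain rfl : b' = false := by simpa using hb
          simp only [Bool.false_eq_true, if_true, if_false] at h1 h2
          rw [h1, h2, hz]
      have hr : FreeGroup.IsReduced L₂ := by
        refine List.IsChain.left_of_append (l₂ := [y])
          (List.IsChain.right_of_append (l₁ := L₁ ++ [z]) ?_)
        simpa [FreeGroup.IsReduced] using hred
      have h1 := h _ _ hfix (by
        rw [hnorm _ hr]
        simp only [List.length_append, List.length_cons] at hlen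
        omega)
      have h2 := hnorm _ hr
      rw [h1, FreeGroup.norm_one] at h2
      obtain rfl := List.eq_nil_of_length_eq_zero h2.symm
      have hr' : FreeGroup.IsReduced [z, y] := by
        refine List.IsChain.right_of_append (l₁ := L₁) ?_
        simpa [FreeGroup.IsReduced] using hred
      rw [FreeGroup.isReduced_cons_cons] at hr'
      exact hb (hr'.1 hyz)
  refine ⟨e, ?_⟩
  rw [← hgL, ← FreeGroup.mul_mk, flow_mul, Pi.add_apply, h0, zero_add, (flow_letter _ _ _).1 hy]
  split_ifs <;> simp

end Flow

section Tower


variable {I X : Type} [MulAction (FreeGroup I) X]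

/-- The `F`-set of vertices of `X` decorated by edge counts modulo `q`. -/
@[ext] structure ModFlow (q : ℕ) (I X : Type) where
  count : X × I → ZMod q
  base : X

noncomputable instance (q : ℕ) : MulAction (FreeGroup I) (ModFlow q I X) where
  smul g x := ⟨fun e => x.count e + (flow g x.base e : ℤ), g • x.base⟩
  one_smul x := by
    refine ModFlow.ext (funext fun e => ?_) (one_smul _ _)
    change x.count e + ((flow (1 : FreeGroup I) x.base e : ℤ) : ZMod q) = _
    simp [flow_one]
  mul_smul g h x := by
    refine ModFlow.ext (funext fun e => ?_) (mul_smul _ _ _)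
    change x.count e + ((flow (g * h) x.base e : ℤ) : ZMod q) =
      x.count e + ((flow h x.base e : ℤ) : ZMod q) + ((flow g (h • x.base) e : ℤ) : ZMod q)
    rw [flow_mul, Pi.add_apply, Int.cast_add]
    ring

theorem ModFlow.smul_def {q : ℕ} (g : FreeGroup I) (x : ModFlow q I X) :
    g • x = ⟨fun e => x.count e + (flow g x.base e : ℤ), g • x.base⟩ := rfl

/-- The action of the free group on the finite set `X` factors through a `q`-group. -/
def IsPowAction (q : ℕ) (I X : Type) [MulAction (FreeGroup I) X] : Prop :=
  Finite X ∧ ∀ g : FreeGroup I, ∃ n : ℕ, ∀ s : X, g ^ q ^ n • s = s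

theorem IsPowAction.modFlow {q : ℕ} [NeZero q] [Finite I] (h : IsPowAction q I X) :
    IsPowAction q I (ModFlow q I X) := by
  have := h.1
  refine ⟨?_, fun g => ?_⟩
  · refine Finite.of_injective (fun x : ModFlow q I X => (x.count, x.base)) fun x y hxy => ?_
    rw [Prod.mk.injEq] at hxy
    exact ModFlow.ext hxy.1 hxy.2
  · obtain ⟨n, hn⟩ := h.2 g
    refine ⟨n + 1, fun s => ?_⟩
    have key : ∀ (j : ℕ) (x : ModFlow q I X), (g ^ q ^ n) ^ j • x =
        ⟨fun e => x.count e + j * (flow (g ^ q ^ n) x.base e : ℤ), x.base⟩ := by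
      intro j
      induction j with
      | zero => intro x; simp
      | succ j ih =>
        intro x
        rw [pow_succ, mul_smul, ih, ModFlow.smul_def]
        refine ModFlow.ext (funext fun e => ?_) (hn _)
        simp only [hn]
        push_cast
        ring
    rw [pow_succ, pow_mul, key]
    simp

theorem NoShortStabilizer.modFlow [DecidableEq I] {q n : ℕ} (hq : 1 < q)
    (h : NoShortStabilizer I X n) : NoShortStabilizer I (ModFlow q I X) (n + 1) := by
  intro g s hs hg
  have : Fact (1 < q) := ⟨hq⟩
  rw [ModFlow.smul_def, ModFlow.ext_iff] at hs
  rcases Nat.lt_or_ge n g.norm with h1 | h1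
  · obtain ⟨e, he⟩ := h.flow_eq (le_antisymm hg h1) s.base
    have h2 := congrFun hs.1 e
    rw [add_eq_left] at h2
    rcases he with he | he <;> simp [he] at h2
  · exact h g s.base hs.2 h1

/-- The finite quotient-by-kernel condition that describes abelian-by-(finite `q`-group) quotients
of the free group. -/
structure IsAbelianByPow (q : ℕ) (N : Subgroup (FreeGroup I)) : Prop where
  normal : N.Normal
  exists_le : ∃ K : Subgroup (FreeGroup I), K.Normal ∧ N ≤ K ∧
    (∀ a ∈ K, ∀ b ∈ K, ⁅a, b⁆ ∈ N) ∧ (∀ x, ∃ n : ℕ, x ^ q ^ n ∈ K) ∧ K.FiniteIndex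

theorem IsAbelianByPow.inf {q : ℕ} {N N' : Subgroup (FreeGroup I)} (h : IsAbelianByPow q N)
    (h' : IsAbelianByPow q N') : IsAbelianByPow q (N ⊓ N') := by
  obtain ⟨h1, K, hK1, hK2, hK3, hK4, hK5⟩ := h
  obtain ⟨h1', K', hK1', hK2', hK3', hK4', hK5'⟩ := h'
  refine ⟨inferInstance, K ⊓ K', inferInstance, inf_le_inf hK2 hK2', ?_, ?_, inferInstance⟩
  · exact fun a ha b hb => ⟨hK3 a ha.1 b hb.1, hK3' a ha.2 b hb.2⟩
  · intro x
    obtain ⟨n, hn⟩ := hK4 x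
    obtain ⟨n', hn'⟩ := hK4' x
    refine ⟨n + n', ?_, ?_⟩
    · rw [pow_add, pow_mul]
      exact K.pow_mem hn _
    · rw [add_comm, pow_add, pow_mul]
      exact K'.pow_mem hn' _

theorem isAbelianByPow_top (q : ℕ) : IsAbelianByPow q (⊤ : Subgroup (FreeGroup I)) :=
  ⟨inferInstance, ⊤, inferInstance, le_rfl, fun _ _ _ _ => trivial, fun _ => ⟨0, trivial⟩,
    inferInstance⟩

theorem IsPowAction.exists_ker {q : ℕ} (h : IsPowAction q I X) :
    ∃ K : Subgroup (FreeGroup I), K.Normal ∧ (∀ g, g ∈ K ↔ ∀ s : X, g • s = s) ∧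
      (∀ x, ∃ n : ℕ, x ^ q ^ n ∈ K) ∧ K.FiniteIndex := by
  have := h.1
  have hmem : ∀ g, g ∈ (MulAction.toPermHom (FreeGroup I) X).ker ↔ ∀ s : X, g • s = s := by
    intro g
    rw [MonoidHom.mem_ker, Equiv.ext_iff]
    rfl
  refine ⟨(MulAction.toPermHom (FreeGroup I) X).ker, inferInstance, hmem, fun x => ?_,
    inferInstance⟩
  obtain ⟨n, hn⟩ := h.2 x
  exact ⟨n, (hmem _).2 hn⟩

theorem IsPowAction.isAbelianByPow_ker {q : ℕ} (h : IsPowAction q I X) :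
    ∃ N : Subgroup (FreeGroup I), IsAbelianByPow q N ∧ ∀ g ∈ N, ∀ s : X, g • s = s := by
  obtain ⟨K, h1, h2, h3, h4⟩ := h.exists_ker
  exact ⟨K, ⟨h1, K, h1, le_rfl, fun a ha b hb => K.mul_mem (K.mul_mem (K.mul_mem ha hb)
    (K.inv_mem ha)) (K.inv_mem hb), h3, h4⟩, fun g hg => (h2 g).1 hg⟩

theorem IsPowAction.isAbelianByPow_flow {q : ℕ} (h : IsPowAction q I X) :
    ∃ N : Subgroup (FreeGroup I), IsAbelianByPow q N ∧ ∀ g ∈ N, ∀ s : X, flow g s = 0 := by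
  obtain ⟨K, h1, h2, h3, h4⟩ := h.exists_ker
  have hmem : ∀ g, g ∈ (FreeGroup.lift (flowPerm (I := I) (X := X))).ker ↔
      ∀ s : X, flow g s = 0 ∧ g • s = s := by
    intro g
    rw [MonoidHom.mem_ker, Equiv.ext_iff]
    constructor
    · intro h s
      have := h (0, s)
      rw [lift_flowPerm] at this
      simpa using this
    · rintro h ⟨m, s⟩
      rw [lift_flowPerm, (h s).1, (h s).2]
      simp
  refine ⟨_, ⟨inferInstanceAs (MonoidHom.ker _).Normal, K, h1, fun g hg => ?_, fun a ha b hb => ?_,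
    h3, h4⟩, fun g hg s => ((hmem g).1 hg s).1⟩
  · exact (h2 g).2 fun s => ((hmem g).1 hg s).2
  · rw [h2] at ha hb
    have ha' : ∀ s : X, a⁻¹ • s = s := fun s => by rw [inv_smul_eq_iff, ha]
    have hb' : ∀ s : X, b⁻¹ • s = s := fun s => by rw [inv_smul_eq_iff, hb]
    refine (hmem _).2 fun s => ⟨?_, ?_⟩
    · rw [commutatorElement_def, flow_mul, flow_mul, flow_mul, flow_inv, flow_inv]
      simp only [hb, ha', hb']
      abel
    · simp only [commutatorElement_def, mul_smul, ha, hb, ha', hb']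

theorem exists_notMem_isAbelianByPow [DecidableEq I] [Finite I] {q : ℕ} (hq : 1 < q)
    (g : FreeGroup I) (hg : g ≠ 1) : ∃ N, IsAbelianByPow q N ∧ g ∉ N := by
  have : NeZero q := ⟨by omega⟩
  have key : ∀ (n m : ℕ) (X : Type) [MulAction (FreeGroup I) X] [Nonempty X], IsPowAction q I X →
      NoShortStabilizer I X m → g.norm ≤ m + n → ∃ N, IsAbelianByPow q N ∧ g ∉ N := by
    intro n
    induction n with
    | zero =>
      intro m X _ _ hX hm hgn
      obtain ⟨N, hN, hN'⟩ := hX.isAbelianByPow_ker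
      exact ⟨N, hN, fun h => hg (hm g (Classical.arbitrary X) (hN' g h _) hgn)⟩
    | succ n ih =>
      intro m X _ _ hX hm hgn
      have : Nonempty (ModFlow q I X) := ⟨⟨0, Classical.arbitrary X⟩⟩
      exact ih (m + 1) (ModFlow q I X) hX.modFlow (hm.modFlow hq) (by omega)
  refine key g.norm 0 PUnit ⟨inferInstance, fun g => ⟨0, fun _ => rfl⟩⟩ ?_ (by omega)
  intro g _ _ h
  exact FreeGroup.norm_eq_zero.1 (Nat.le_zero.1 h)

end Tower

section TowerDescent

variable {I : Type} {k ι : Type} [Field k] [Fintype ι] [DecidableEq ι] {K : Type}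
  {N : K → Subgroup (FreeGroup I)}

/-- The cocycle counting the passages through the edge `e` along a map to `X`. -/
noncomputable def edgeCocycle {S X : Type} [MulAction (FreeGroup I) S] [MulAction (FreeGroup I) X]
    (f : S → X) (hf : ∀ (g : FreeGroup I) s, f (g • s) = g • f s) (e : X × I) :
    Cocycle (FreeGroup I) S where
  toFun g s := flow g (f s) e
  map_mul g h s := by rw [flow_mul, hf, Pi.add_apply]

theorem exists_isPotential {S : Type} [MulAction (FreeGroup I) S] (c : Cocycle (FreeGroup I) S)
    (hc : ∀ κ, ∀ g ∈ N κ, ∀ s, c.toFun g s = 0) :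
    ∃ ψ : ∀ κ, FreeGroup I ⧸ N κ → S → ℤ,
      IsPotential c (fun κ => (QuotientGroup.mk : FreeGroup I → FreeGroup I ⧸ N κ)) ψ := by
  refine ⟨fun κ w s => Quotient.liftOn' w (fun g => c.toFun g (g⁻¹ • s)) fun a b hab => ?_,
    ⟨fun κ h w s => ?_, fun κ s => ?_⟩⟩
  · have h1 := hc κ _ (QuotientGroup.leftRel_apply.1 hab) (b⁻¹ • s)
    have h2 := c.map_mul a (a⁻¹ * b) (b⁻¹ • s)
    rw [mul_inv_cancel_left, h1, add_zero, smul_smul, mul_assoc, mul_inv_cancel, mul_one] at h2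
    exact h2.symm
  · induction w using QuotientGroup.induction_on with
    | H g =>
      change c.toFun (h * g) ((h * g)⁻¹ • h • s) = c.toFun g (g⁻¹ • s) + c.toFun h s
      rw [smul_smul, mul_inv_rev, inv_mul_cancel_right, c.map_mul, smul_inv_smul, add_comm]
  · change c.toFun 1 (1⁻¹ • s) = 0
    exact c.map_one _

theorem allSolvable_of_counts {q : ℕ} {X : Type} [MulAction (FreeGroup I) X]
    (hsep : ∀ y : FreeGroup I × ι →₀ k,
      (∀ κ, pushOp (QuotientGroup.mk : FreeGroup I → FreeGroup I ⧸ N κ) y = 0) → y = 0)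
    (hN : ∀ κ, ∀ g ∈ N κ, ∀ s : X, flow g s = 0) [Fintype I]
    (hX : ∀ (S : Type) [MulAction (FreeGroup I) S] (f : S → ModFlow q I X),
      (∀ (g : FreeGroup I) s, f (g • s) = g • f s) → AllSolvable k ι S letterOrOne
        (fun κ => (QuotientGroup.mk : FreeGroup I → FreeGroup I ⧸ N κ))) (T : Finset (X × I)) :
    ∀ (S : Type) [MulAction (FreeGroup I) S] (f : S → X) (m : S → X × I → ZMod q),
      (∀ (g : FreeGroup I) s, f (g • s) = g • f s) →
      (∀ e ∉ T, ∀ (g : FreeGroup I) s, m (g • s) e = m s e + (flow g (f s) e : ℤ)) →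
      AllSolvable k ι S letterOrOne
        (fun κ => (QuotientGroup.mk : FreeGroup I → FreeGroup I ⧸ N κ)) := by
  classical
  induction T using Finset.induction_on with
  | empty =>
    intro S _ f m hf hm
    refine hX S (fun s => ⟨m s, f s⟩) fun g s => ?_
    rw [ModFlow.smul_def, ModFlow.mk.injEq]
    exact ⟨funext fun e => hm e (by simp) g s, hf g s⟩
  | insert e T _ ih =>
    intro S _ f m hf hm
    obtain ⟨ψ, hψ⟩ := exists_isPotential (N := N) (edgeCocycle f hf e)
      fun κ g hg s => congrFun (hN κ g hg (f s)) e
    refine allSolvable_of_skew hψ (fun _ _ _ => rfl) hsep ?_ ?_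
    · refine ih _ (fun x => f x.base) (fun x => Function.update (m x.base) e x.height)
        (fun g x => hf g x.base) fun e' he' g x => ?_
      by_cases h : e' = e
      · subst h
        rw [Function.update_self, Function.update_self, Skew.smul_height, Int.cast_add]
        rfl
      · rw [Function.update_of_ne h, Function.update_of_ne h]
        exact hm e' (by simp [h, he']) g x.base
    · refine ih _ (fun x => f x.base) (fun x => Function.update (m x.base) e (-x.height))
        (fun g x => hf g x.base) fun e' he' g x => ?_
      by_cases h : e' = e
      · subst h
        rw [Function.update_self, Function.update_self, Skew.smul_height, Int.cast_add, neg_add]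
        congr 1
        rw [← Int.cast_neg]
        congr 1
        exact neg_neg _
      · rw [Function.update_of_ne h, Function.update_of_ne h]
        exact hm e' (by simp [h, he']) g x.base

theorem exists_allSolvable [Fintype I] [DecidableEq I] (k ι : Type) [Field k] [Fintype ι]
    [DecidableEq ι] {q : ℕ} (hq : 1 < q) :
    ∃ N₀ : Subgroup (FreeGroup I), IsAbelianByPow q N₀ ∧
      ∀ (K : Type) (N : K → Subgroup (FreeGroup I)), (∀ κ, N κ ≤ N₀) →
        (∀ y : FreeGroup I × ι →₀ k,
          (∀ κ, pushOp (QuotientGroup.mk : FreeGroup I → FreeGroup I ⧸ N κ) y = 0) → y = 0) →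
        AllSolvable k ι Unit letterOrOne
          (fun κ => (QuotientGroup.mk : FreeGroup I → FreeGroup I ⧸ N κ)) := by
  have : NeZero q := ⟨by omega⟩
  have key : ∀ (n m : ℕ) (X : Type) [MulAction (FreeGroup I) X], IsPowAction q I X →
      NoShortStabilizer I X m → 4 * Fintype.card ι + 1 ≤ m + n →
      ∃ N₀ : Subgroup (FreeGroup I), IsAbelianByPow q N₀ ∧
      ∀ (K : Type) (N : K → Subgroup (FreeGroup I)), (∀ κ, N κ ≤ N₀) →
        (∀ y : FreeGroup I × ι →₀ k,
          (∀ κ, pushOp (QuotientGroup.mk : FreeGroup I → FreeGroup I ⧸ N κ) y = 0) → y = 0) →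
        ∀ (S : Type) [MulAction (FreeGroup I) S] (f : S → X),
          (∀ (g : FreeGroup I) s, f (g • s) = g • f s) → AllSolvable k ι S letterOrOne
          (fun κ => (QuotientGroup.mk : FreeGroup I → FreeGroup I ⧸ N κ)) := by
    intro n
    induction n with
    | zero =>
      intro m X _ _ hm hn
      refine ⟨⊤, isAbelianByPow_top q, fun K N _ _ S _ f hf =>
        allSolvable_of_norm_lt _ fun g s hs hg => hm g (f s) (by rw [← hf, hs]) (by omega)⟩
    | succ n ih =>
      intro m X _ hX hm hn
      obtain ⟨N₁, h1, h1'⟩ := ih (m + 1) (ModFlow q I X) hX.modFlow (hm.modFlow hq) (by omega)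
      obtain ⟨N₂, h2, h2'⟩ := hX.isAbelianByPow_flow
      refine ⟨N₁ ⊓ N₂, h1.inf h2, fun K N hN hsep S _ f hf => ?_⟩
      have := hX.1
      have := Fintype.ofFinite X
      exact allSolvable_of_counts hsep (fun κ g hg => h2' g (hN κ hg).2)
        (fun S _ => h1' K N (fun κ => (hN κ).trans inf_le_left) hsep S) Finset.univ S f
        (fun _ _ => 0) hf (by simp)
  obtain ⟨N₀, h0, h0'⟩ := key (4 * Fintype.card ι + 1) 0 PUnit
    ⟨inferInstance, fun g => ⟨0, fun _ => rfl⟩⟩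
    (fun g _ _ h => FreeGroup.norm_eq_zero.1 (Nat.le_zero.1 h)) (by omega)
  exact ⟨N₀, h0, fun K N hN hsep => h0' K N hN hsep Unit id fun _ _ => rfl⟩

end TowerDescent

section FiniteQuotient

open scoped IsMulCommutative

theorem exists_finite_simple_quotient (k R C : Type*) [Field k] [Finite k] [CommRing R]
    [Algebra k R] [Algebra.FiniteType k R] [AddCommGroup C] [Module R C] [Module.Finite R C]
    [Nontrivial C] : ∃ W : Submodule R C, W ≠ ⊤ ∧ Finite (C ⧸ W) := by
  obtain ⟨W, hW, -⟩ := (eq_top_or_exists_le_coatom (⊥ : Submodule R C)).resolve_left bot_ne_top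
  have hs : IsSimpleModule R (C ⧸ W) := isSimpleModule_iff_isCoatom.2 hW
  obtain ⟨m, hm, ⟨e⟩⟩ := isSimpleModule_iff_quot_maximal.1 hs
  refine ⟨W, hW.1, ?_⟩
  let _ : Field (R ⧸ m) := Ideal.Quotient.field m
  have hf : Module.Finite k (R ⧸ m) := finite_of_finite_type_of_isJacobsonRing k (R ⧸ m)
  have : Finite (R ⧸ m) := Module.finite_of_finite k
  exact Finite.of_equiv _ e.symm.toEquiv

theorem exists_finite_quotient {k C G : Type*} [Field k] [Finite k] [AddCommGroup C] [Module k C]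
    [Group G] [Group.FG G] (r : G →* Module.End k C) (K : Subgroup G) [K.Normal] [K.FiniteIndex]
    (hK : ∀ a ∈ K, ∀ b ∈ K, r a * r b = r b * r a) {s : Set C} (hs : s.Finite)
    (hspan : Submodule.span k {x | ∃ g, ∃ c ∈ s, x = r g c} = ⊤) [Nontrivial C] :
    ∃ W : Submodule k C, W ≠ ⊤ ∧ (∀ g, W ≤ W.comap (r g)) ∧ Finite (C ⧸ W) := by
  classical
  obtain ⟨T, hT⟩ := (Group.fg_iff_monoid_fg.1 (inferInstance : Group.FG K)).1
  set E : Finset (Module.End k C) := T.image (fun a : K => r (a : G)) with hE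
  have hcomm : ∀ a ∈ (E : Set (Module.End k C)), ∀ b ∈ (E : Set (Module.End k C)),
      a * b = b * a := by
    intro a ha b hb
    obtain ⟨a, -, rfl⟩ := Finset.mem_image.1 ha
    obtain ⟨b, -, rfl⟩ := Finset.mem_image.1 hb
    exact hK _ a.2 _ b.2
  let S := Algebra.adjoin k (E : Set (Module.End k C))
  have hKS : ∀ a ∈ K, r a ∈ S := by
    intro a ha
    have h1 : (⟨a, ha⟩ : K) ∈ Submonoid.closure (T : Set K) := hT ▸ Submonoid.mem_top _
    have h2 : Submonoid.closure (T : Set K) ≤ S.toSubmonoid.comap (r.comp K.subtype) := by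
      rw [Submonoid.closure_le]
      intro t ht
      exact Algebra.subset_adjoin (by simpa [hE] using ⟨t.1, ⟨t.2, ht⟩, rfl⟩)
    exact h2 h1
  have := Algebra.isMulCommutative_adjoin k hcomm
  have hft : Algebra.FiniteType k S := (Subalgebra.fg_iff_finiteType S).1 ⟨E, rfl⟩
  have hsm : ∀ (a : S) (c : C), a • c = (a : Module.End k C) c := fun _ _ => rfl
  have hfin : Module.Finite S C := by
    refine ⟨⟨(Set.Finite.image2 (fun (t : G ⧸ K) c => r t.out c) (Set.finite_univ) hs).toFinset,
      ?_⟩⟩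
    rw [Set.Finite.coe_toFinset]
    set D := Submodule.span S (Set.image2 (fun (t : G ⧸ K) c => r t.out c) Set.univ s) with hD
    have h1 : Submodule.span k {x | ∃ g, ∃ c ∈ s, x = r g c} ≤ D.restrictScalars k := by
      rw [Submodule.span_le]
      rintro x ⟨g, c, hc, rfl⟩
      set t : G ⧸ K := QuotientGroup.mk g
      have h2 : g * t.out⁻¹ ∈ K := by
        have := QuotientGroup.eq.1 (QuotientGroup.out_eq' t : (t.out : G ⧸ K) = (g : G ⧸ K))
        have h3 := Subgroup.Normal.conj_mem ‹K.Normal› _ this t.out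
        simpa [mul_assoc] using h3
      have h4 : r g c = (⟨_, hKS _ h2⟩ : S) • r t.out c := by
        rw [hsm]
        change _ = (r (g * t.out⁻¹) * r t.out) c
        rw [← map_mul, inv_mul_cancel_right]
      rw [h4]
      exact D.smul_mem _ (Submodule.subset_span ⟨t, trivial, c, hc, rfl⟩)
    rw [hspan] at h1
    rw [eq_top_iff]
    exact fun x _ => h1 (Submodule.mem_top (x := x))
  obtain ⟨W₀, hW₀, hfinW⟩ := exists_finite_simple_quotient k S C
  let φ : C →ₗ[k] (G ⧸ K → C ⧸ W₀) :=
    LinearMap.pi fun t => (W₀.mkQ.restrictScalars k).comp (r t.out)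
  have hφ : ∀ c, c ∈ LinearMap.ker φ ↔ ∀ g, r g c ∈ W₀ := by
    intro c
    rw [LinearMap.mem_ker, funext_iff]
    constructor
    · intro h g
      set t : G ⧸ K := QuotientGroup.mk g
      have h2 : g * t.out⁻¹ ∈ K := by
        have := QuotientGroup.eq.1 (QuotientGroup.out_eq' t : (t.out : G ⧸ K) = (g : G ⧸ K))
        have h3 := Subgroup.Normal.conj_mem ‹K.Normal› _ this t.out
        simpa [mul_assoc] using h3
      have h4 : r g c = (⟨_, hKS _ h2⟩ : S) • r t.out c := by
        rw [hsm]
        change _ = (r (g * t.out⁻¹) * r t.out) c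
        rw [← map_mul, inv_mul_cancel_right]
      rw [h4]
      exact W₀.smul_mem _ ((Submodule.Quotient.mk_eq_zero W₀).1 (h t))
    · intro h t
      exact (Submodule.Quotient.mk_eq_zero W₀).2 (h t.out)
  refine ⟨LinearMap.ker φ, fun h => hW₀ ?_, fun g c hc => ?_, ?_⟩
  · rw [eq_top_iff]
    intro x _
    have h1 : x ∈ LinearMap.ker φ := by rw [h]; trivial
    simpa using (hφ x).1 h1 1
  · refine (hφ _).2 fun g' => ?_
    have := (hφ c).1 hc (g' * g)
    rwa [map_mul] at this
  · exact Finite.of_injective _ φ.quotKerEquivRange.injective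

end FiniteQuotient

section Nullstellensatz


variable {I k ι : Type} [Field k]

section

variable [Fintype I] [Fintype ι] [DecidableEq ι]

/-- The linear system `∑ l, ∑ i, M l i j • l (c i) = 0` has only the trivial solution in finite
representations of the free group that are commutative on a normal subgroup of `q`-power
exponent quotient. -/
def HasNoFiniteSolution (q : ℕ) (M : Option I → Matrix ι ι k) : Prop :=
  ∀ (Ω : Type) [AddCommGroup Ω] [Module k Ω] [Finite Ω] (ρ : FreeGroup I →* Module.End k Ω)
    (K : Subgroup (FreeGroup I)), K.Normal → K.FiniteIndex → (∀ x, ∃ n : ℕ, x ^ q ^ n ∈ K) →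
    (∀ a ∈ K, ∀ b ∈ K, ρ a * ρ b = ρ b * ρ a) → ∀ c : ι → Ω,
    (∀ j, ∑ l, ∑ i, M l i j • ρ (letterOrOne l) (c i) = 0) → c = 0

theorem card_le_of_isUnit {N : Matrix ι ι k} (hN : IsUnit N) {A B : Finset ι}
    (h : ∀ j ∈ A, ∀ i ∉ B, N i j = 0) : A.card ≤ B.card := by
  let e : (A → k) →ₗ[k] (ι → k) := LinearMap.funLeft k k id |>.comp
    (LinearMap.pi fun j => if hj : j ∈ A then LinearMap.proj ⟨j, hj⟩ else 0)
  have he : ∀ v j, e v j = if hj : j ∈ A then v ⟨j, hj⟩ else 0 := by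
    intro v j
    change (if hj : j ∈ A then LinearMap.proj (R := k) (φ := fun _ : A => k) ⟨j, hj⟩ else 0) v = _
    split_ifs <;> rfl
  let φ : (A → k) →ₗ[k] (B → k) := (LinearMap.funLeft k k Subtype.val).comp (N.mulVecLin.comp e)
  have hφ : Function.Injective φ := by
    rw [← LinearMap.ker_eq_bot, LinearMap.ker_eq_bot']
    intro v hv
    have h1 : N.mulVec (e v) = 0 := by
      funext i
      by_cases hi : i ∈ B
      · exact congrFun hv ⟨i, hi⟩
      · refine Finset.sum_eq_zero fun j _ => ?_
        rw [he]
        split_ifs with hj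
        · exact mul_eq_zero_of_left (h j hj i hi) _
        · rw [mul_zero]
    have h2 : e v = 0 := Matrix.mulVec_injective_iff_isUnit.2 hN (by simpa using h1)
    funext j
    have h3 := congrFun h2 j.1
    rw [he, dif_pos j.2] at h3
    exact h3
  have := LinearMap.finrank_le_finrank_of_injective hφ
  simpa using this

theorem HasNoFiniteSolution.isFullPencil [Finite k] {q : ℕ} {M : Option I → Matrix ι ι k}
    (hM : HasNoFiniteSolution q M) (dA dB : ι → Unit) : IsFullPencil dA dB M := by
  have h1 : IsUnit (∑ l, M l) := by
    rw [← Matrix.vecMul_injective_iff_isUnit]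
    have h2 : LinearMap.ker (Matrix.vecMulLinear (∑ l, M l)) = ⊥ := by
      rw [LinearMap.ker_eq_bot']
      intro c hc
      refine hM k 1 ⊤ inferInstance inferInstance (fun _ => ⟨0, trivial⟩) (fun _ _ _ _ => rfl) c
        fun j => ?_
      have h3 := congrFun hc j
      simp only [Matrix.vecMulLinear_apply, Matrix.vecMul, dotProduct, Matrix.sum_apply,
        Finset.mul_sum, Pi.zero_apply] at h3
      rw [Finset.sum_comm] at h3
      rw [← h3]
      refine Finset.sum_congr rfl fun l _ => Finset.sum_congr rfl fun i _ => ?_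
      simp [mul_comm]
    exact LinearMap.ker_eq_bot.1 h2
  intro P P' Q Q' hP hQ A B h
  have hPu : IsUnit P := IsUnit.of_mul_eq_one _ hP.mul_eq_one
  have hQu : IsUnit Q := IsUnit.of_mul_eq_one _ hQ.mul_eq_one
  refine card_le_of_isUnit ((hQu.mul h1).mul hPu) fun j hj i hi => ?_
  rw [Finset.mul_sum, Finset.sum_mul, Matrix.sum_apply]
  exact Finset.sum_eq_zero fun l _ => h l j hj i hi

end

theorem exists_isAbelianByPow_forall_notMem [Finite I] [DecidableEq I] {q : ℕ} (hq : 1 < q)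
    (s : Finset (FreeGroup I))
    (hs : (1 : FreeGroup I) ∉ s) :
    ∃ N : Subgroup (FreeGroup I), IsAbelianByPow q N ∧ ∀ g ∈ s, g ∉ N := by
  induction s using Finset.induction_on with
  | empty => exact ⟨⊤, isAbelianByPow_top q, by simp⟩
  | insert g s _ ih =>
    rw [Finset.mem_insert, not_or] at hs
    obtain ⟨N, h1, h2⟩ := ih hs.2
    obtain ⟨N', h1', h2'⟩ := exists_notMem_isAbelianByPow hq g (Ne.symm hs.1)
    refine ⟨N ⊓ N', h1.inf h1', fun x hx hxN => ?_⟩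
    rcases Finset.mem_insert.1 hx with rfl | hx
    · exact h2' hxN.2
    · exact h2 x hx hxN.1

theorem eq_zero_of_forall_pushOp_eq_zero [Finite I] [DecidableEq I] {q : ℕ} (hq : 1 < q)
    {N₀ : Subgroup (FreeGroup I)}
    (h0 : IsAbelianByPow q N₀) (y : FreeGroup I × ι →₀ k)
    (hy : ∀ N : Subgroup (FreeGroup I), IsAbelianByPow q N → N ≤ N₀ →
      pushOp (QuotientGroup.mk : FreeGroup I → FreeGroup I ⧸ N) y = 0) : y = 0 := by
  classical
  let S := y.support.image Prod.fst
  let D := ((S ×ˢ S).image fun x => x.1⁻¹ * x.2).erase 1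
  obtain ⟨N, h1, h2⟩ := exists_isAbelianByPow_forall_notMem hq D (Finset.notMem_erase _ _)
  have h3 := hy (N ⊓ N₀) (h1.inf h0) inf_le_right
  ext x
  by_cases hx : x ∈ y.support
  · have h4 := Finsupp.mapDomain_apply' (y.support : Set (FreeGroup I × ι))
      (f := Prod.map (QuotientGroup.mk : FreeGroup I → FreeGroup I ⧸ (N ⊓ N₀)) id) y subset_rfl
      (fun a ha b hb hab => by
        have h5 := QuotientGroup.eq.1 (congrArg Prod.fst hab)
        have h6 : a.2 = b.2 := (Prod.ext_iff.1 hab).2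
        refine Prod.ext ?_ h6
        by_contra hne
        refine h2 (a.1⁻¹ * b.1) (Finset.mem_erase.2 ⟨fun h => hne (inv_mul_eq_one.1 h),
          Finset.mem_image.2 ⟨(a.1, b.1), Finset.mem_product.2
            ⟨Finset.mem_image_of_mem _ ha, Finset.mem_image_of_mem _ hb⟩, rfl⟩⟩) h5.1) hx
    rw [← h4]
    change pushOp _ y _ = 0
    rw [h3]
    rfl
  · simpa using hx

/-- Right translation on finitely supported functions on a quotient group. -/
noncomputable def rightTranslation (k ι : Type) [Field k] (N : Subgroup (FreeGroup I)) [N.Normal] :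
    FreeGroup I →* Module.End k ((FreeGroup I ⧸ N) × ι →₀ k) where
  toFun g := Finsupp.lmapDomain k k fun x => (x.1 * (g : FreeGroup I ⧸ N)⁻¹, x.2)
  map_one' := by
    refine Finsupp.lhom_ext fun x r => ?_
    simp [Finsupp.mapDomain_single]
  map_mul' g h := by
    refine Finsupp.lhom_ext fun x r => ?_
    simp [Finsupp.mapDomain_single, mul_assoc]

theorem rightTranslation_single {N : Subgroup (FreeGroup I)} [N.Normal] (g : FreeGroup I)
    (w : FreeGroup I ⧸ N) (i : ι) (r : k) :
    rightTranslation k ι N g (Finsupp.single (w, i) r) =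
      Finsupp.single (w * (g : FreeGroup I ⧸ N)⁻¹, i) r :=
  Finsupp.mapDomain_single

theorem smul_quotient_eq {N : Subgroup (FreeGroup I)} [N.Normal] (g : FreeGroup I)
    (w : FreeGroup I ⧸ N) : g • w = (g : FreeGroup I ⧸ N) * w := by
  induction w using QuotientGroup.induction_on with
  | H h => rfl

theorem rightTranslation_pencilOp [Fintype I] [Fintype ι] {N : Subgroup (FreeGroup I)} [N.Normal]
    (M : Option I → Matrix ι ι k) (g : FreeGroup I) (v : (FreeGroup I ⧸ N) × ι →₀ k) :
    rightTranslation k ι N g (pencilOp letterOrOne M (FreeGroup I ⧸ N) v) =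
      pencilOp letterOrOne M (FreeGroup I ⧸ N) (rightTranslation k ι N g v) := by
  induction v using Finsupp.induction_linear with
  | zero => simp
  | add f g hf hg => simp only [map_add, hf, hg]
  | single x r =>
    obtain ⟨w, j⟩ := x
    simp only [pencilOp_single, map_sum, rightTranslation_single, smul_quotient_eq, mul_assoc]

variable [Fintype I] [Fintype ι] [DecidableEq ι]

omit [DecidableEq ι] in
theorem HasNoFiniteSolution.surjective [Finite k] {q : ℕ} {M : Option I → Matrix ι ι k}
    (hM : HasNoFiniteSolution q M) {N : Subgroup (FreeGroup I)} (hN : IsAbelianByPow q N) :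
    LinearMap.range (pencilOp letterOrOne M (FreeGroup I ⧸ N)) = ⊤ := by
  obtain ⟨hn, K, hK1, hK2, hK3, hK4, hK5⟩ := hN
  set R := LinearMap.range (pencilOp letterOrOne M (FreeGroup I ⧸ N)) with hR
  by_contra hne
  have hinv : ∀ g, R ≤ R.comap (rightTranslation k ι N g) := by
    rintro g _ ⟨v, rfl⟩
    exact ⟨_, (rightTranslation_pencilOp M g v).symm⟩
  let r : FreeGroup I →* Module.End k (((FreeGroup I ⧸ N) × ι →₀ k) ⧸ R) :=
    { toFun := fun g => R.mapQ R (rightTranslation k ι N g) (hinv g)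
      map_one' := by
        refine Submodule.linearMap_qext _ (LinearMap.ext fun v => ?_)
        simp
      map_mul' := fun g h => by
        refine Submodule.linearMap_qext _ (LinearMap.ext fun v => ?_)
        simp }
  have hr : ∀ g v, r g (R.mkQ v) = R.mkQ (rightTranslation k ι N g v) := fun _ _ => rfl
  have hntr : Nontrivial (((FreeGroup I ⧸ N) × ι →₀ k) ⧸ R) :=
    Submodule.Quotient.nontrivial_iff.2 hne
  let b : ι → ((FreeGroup I ⧸ N) × ι →₀ k) ⧸ R := fun i => R.mkQ (Finsupp.single (1, i) 1)
  have hspan : Submodule.span k {x | ∃ g, ∃ c ∈ Set.range b, x = r g c} = ⊤ := by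
    rw [eq_top_iff]
    intro x _
    obtain ⟨v, rfl⟩ := R.mkQ_surjective x
    induction v using Finsupp.induction_linear with
    | zero => simp
    | add f g hf hg => rw [map_add]; exact Submodule.add_mem _ (hf trivial) (hg trivial)
    | single x t =>
      obtain ⟨w, i⟩ := x
      induction w using QuotientGroup.induction_on with
      | H g =>
        have h1 : (Finsupp.single ((g : FreeGroup I ⧸ N), i) t) =
            t • rightTranslation k ι N g⁻¹ (Finsupp.single (1, i) 1) := by
          rw [rightTranslation_single]
          simp
        rw [h1, map_smul]
        exact Submodule.smul_mem _ _ (Submodule.subset_span ⟨g⁻¹, b i, ⟨i, rfl⟩, rfl⟩)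
  have hcomm : ∀ a ∈ K, ∀ b ∈ K, r a * r b = r b * r a := by
    intro a ha b hb
    have h1 : rightTranslation k ι N ⁅a, b⁆ = 1 := by
      refine Finsupp.lhom_ext fun x t => ?_
      obtain ⟨w, i⟩ := x
      rw [rightTranslation_single, (QuotientGroup.eq_one_iff _).2 (hK3 a ha b hb)]
      simp
    have h2 : r ⁅a, b⁆ = 1 := by
      refine Submodule.linearMap_qext _ (LinearMap.ext fun v => ?_)
      change R.mkQ (rightTranslation k ι N ⁅a, b⁆ v) = _
      rw [h1]
      rfl
    have h3 : a * b = ⁅a, b⁆ * (b * a) := by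
      rw [commutatorElement_def]
      group
    rw [← map_mul, h3, map_mul, h2, one_mul, map_mul]
  obtain ⟨W, hW, hWinv, hWfin⟩ := exists_finite_quotient r K hcomm (Set.finite_range b) hspan
  let ρ : FreeGroup I →* Module.End k ((((FreeGroup I ⧸ N) × ι →₀ k) ⧸ R) ⧸ W) :=
    { toFun := fun g => W.mapQ W (r g) (hWinv g)
      map_one' := by
        refine Submodule.linearMap_qext _ (LinearMap.ext fun v => ?_)
        simp
      map_mul' := fun g h => by
        refine Submodule.linearMap_qext _ (LinearMap.ext fun v => ?_)
        simp }
  have hρ : ∀ g v, ρ g (W.mkQ v) = W.mkQ (r g v) := fun _ _ => rfl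
  have h0 := hM _ ρ K hK1 hK5 hK4 (fun a ha b hb => by
    refine Submodule.linearMap_qext _ (LinearMap.ext fun v => ?_)
    change W.mkQ ((r a * r b) v) = W.mkQ ((r b * r a) v)
    rw [hcomm a ha b hb]) (fun i => W.mkQ (b i)) fun j => by
      have h1 : R.mkQ (pencilOp letterOrOne M (FreeGroup I ⧸ N) (Finsupp.single (1, j) 1)) = 0 :=
        (Submodule.Quotient.mk_eq_zero R).2 ⟨_, rfl⟩
      have h2 : ∑ l, ∑ i, M l i j • r (letterOrOne l) (b i) = 0 := by
        rw [← h1, pencilOp_single, map_sum]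
        refine Finset.sum_congr rfl fun l _ => ?_
        rw [map_sum]
        refine Finset.sum_congr rfl fun i _ => ?_
        rw [hr, rightTranslation_single, ← map_smul, Finsupp.smul_single, smul_quotient_eq]
        simp
      rw [← map_zero W.mkQ, ← h2]
      simp only [hρ, map_smul, map_sum]
  refine hW (eq_top_iff.2 (hspan ▸ Submodule.span_le.2 ?_))
  rintro _ ⟨g, _, ⟨i, rfl⟩, rfl⟩
  exact hWinv g ((Submodule.Quotient.mk_eq_zero W).1 (congrFun h0 i))

theorem HasNoFiniteSolution.eq_zero [DecidableEq I] [Finite k] {q : ℕ} (hq : 1 < q)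
    {M : Option I → Matrix ι ι k} (hM : HasNoFiniteSolution q M) {V : ι → FreeGroup I → k}
    (hV : ∀ j g, ∑ l, ∑ i, M l i j * V i ((letterOrOne l)⁻¹ * g) = 0) : V = 0 := by
  obtain ⟨N₀, h0, hsolv⟩ := exists_allSolvable (I := I) k ι hq
  have h1 := (hsolv {N : Subgroup (FreeGroup I) // IsAbelianByPow q N ∧ N ≤ N₀} Subtype.val
    (fun κ => κ.2.2) (fun y hy => eq_zero_of_forall_pushOp_eq_zero hq h0 y
      fun N h1 h2 => hy ⟨N, h1, h2⟩) (fun _ => ()) (fun _ => ()) M (fun _ _ _ _ => rfl)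
    (hM.isFullPencil _ _)).2
  let φ : (FreeGroup I × ι →₀ k) →ₗ[k] k := Finsupp.linearCombination k fun x => V x.2 x.1
  have hφ : ∀ g i t, φ (Finsupp.single (g, i) t) = t * V i g := fun g i t => by
    simp [φ, Finsupp.linearCombination_single]
  have h2 : ∀ v, φ (pencilOp letterOrOne M (FreeGroup I) v) = 0 := by
    intro v
    induction v using Finsupp.induction_linear with
    | zero => simp
    | add f g hf hg => simp only [map_add, hf, hg, add_zero]
    | single x t =>
      obtain ⟨g, j⟩ := x
      simp only [pencilOp_single, map_sum, hφ, mul_assoc, ← Finset.mul_sum]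
      exact mul_eq_zero_of_right _ (hV j g)
  funext i g
  obtain ⟨v, hv⟩ := h1 (Finsupp.single (g, i) 1) fun κ => by
    have := hM.surjective κ.2.1
    exact (this ▸ Submodule.mem_top : pushOp _ _ ∈ LinearMap.range _)
  have h3 := h2 v
  rwa [hv, hφ, one_mul] at h3

end Nullstellensatz

section AffineGroup

variable {k V P : Type} [Field k] [AddCommGroup V] [Module k V] [Group P]

/-- The semidirect product of a representation `V` and the group `P` acting on it. -/
@[ext]
structure AffGroup (σ : P →* Module.End k V) where
  /-- the translation part -/
  vec : V
  /-- the linear part -/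
  lin : P

variable {σ : P →* Module.End k V}

theorem rep_inv_apply_self (σ : P →* Module.End k V) (g : P) (v : V) : σ g⁻¹ (σ g v) = v := by
  rw [← Module.End.mul_apply, ← map_mul, inv_mul_cancel, map_one, Module.End.one_apply]

theorem rep_apply_inv_self (σ : P →* Module.End k V) (g : P) (v : V) : σ g (σ g⁻¹ v) = v := by
  rw [← Module.End.mul_apply, ← map_mul, mul_inv_cancel, map_one, Module.End.one_apply]

noncomputable instance : Group (AffGroup σ) where
  mul x y := ⟨x.vec + σ x.lin y.vec, x.lin * y.lin⟩
  one := ⟨0, 1⟩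
  inv x := ⟨-σ x.lin⁻¹ x.vec, x.lin⁻¹⟩
  mul_assoc x y z := AffGroup.ext (by
    change x.vec + σ x.lin y.vec + σ (x.lin * y.lin) z.vec =
      x.vec + σ x.lin (y.vec + σ y.lin z.vec)
    rw [map_mul, map_add, add_assoc, Module.End.mul_apply]) (mul_assoc _ _ _)
  one_mul x := AffGroup.ext (by
    change 0 + σ 1 x.vec = x.vec
    rw [map_one, zero_add, Module.End.one_apply]) (one_mul _)
  mul_one x := AffGroup.ext (by
    change x.vec + σ x.lin 0 = x.vec
    rw [map_zero, add_zero]) (mul_one _)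
  inv_mul_cancel x := AffGroup.ext (by
    change -σ x.lin⁻¹ x.vec + σ x.lin⁻¹ x.vec = 0
    rw [neg_add_cancel]) (inv_mul_cancel _)

namespace AffGroup

theorem vec_mul (x y : AffGroup σ) : (x * y).vec = x.vec + σ x.lin y.vec := rfl

theorem vec_inv (x : AffGroup σ) : x⁻¹.vec = -σ x.lin⁻¹ x.vec := rfl

theorem vec_one : (1 : AffGroup σ).vec = 0 := rfl

/-- The linear part of an affine transformation. -/
def linHom (σ : P →* Module.End k V) : AffGroup σ →* P where
  toFun := lin
  map_one' := rfl
  map_mul' _ _ := rfl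

instance [Finite V] [Finite P] : Finite (AffGroup σ) :=
  Finite.of_injective (fun x => (x.vec, x.lin)) fun _ _ h =>
    AffGroup.ext (Prod.ext_iff.1 h).1 (Prod.ext_iff.1 h).2

theorem pow_of_lin_eq_one {x : AffGroup σ} (hx : x.lin = 1) (n : ℕ) :
    x ^ n = ⟨n • x.vec, 1⟩ := by
  induction n with
  | zero => rw [pow_zero, zero_smul]; rfl
  | succ n ih =>
    rw [pow_succ', ih]
    refine AffGroup.ext ?_ ?_
    · rw [vec_mul, hx, map_one, Module.End.one_apply, succ_nsmul']
    · change x.lin * 1 = 1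
      rw [hx, mul_one]

theorem memNpAfNq {p q : ℕ} [CharP k p] (h : MemNpAfNq p q P) : MemNpAfNq p q (AffGroup σ) := by
  obtain ⟨N, M, hN, hM, hNM, hp, hc, hq⟩ := h
  refine ⟨N.comap (linHom σ), M.comap (linHom σ), inferInstance, inferInstance,
    Subgroup.comap_mono hNM, ?_, fun a ha b hb => ?_, fun x => ?_⟩
  · rintro ⟨x, hx⟩
    obtain ⟨n, hn⟩ := hp ⟨x.lin, hx⟩
    refine ⟨n + 1, Subtype.ext ?_⟩
    change x ^ p ^ (n + 1) = 1
    rw [pow_succ, pow_mul, pow_of_lin_eq_one (x := x ^ p ^ n)]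
    · rw [← Nat.cast_smul_eq_nsmul k, CharP.cast_eq_zero, zero_smul]
      rfl
    · exact (map_pow (linHom σ) x _).trans (congrArg Subtype.val hn)
  · change linHom σ _ ∈ N
    rw [map_commutatorElement]
    exact hc _ ha _ hb
  · obtain ⟨n, hn⟩ := hq x.lin
    exact ⟨n, by change linHom σ _ ∈ M; rw [map_pow]; exact hn⟩

theorem lin_lift {I : Type} (v : I → V) (ρ : I → P) (u : FreeGroup I) :
    (FreeGroup.lift (fun i => (⟨v i, ρ i⟩ : AffGroup σ)) u).lin = FreeGroup.lift ρ u := by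
  have : (linHom σ).comp (FreeGroup.lift fun i => (⟨v i, ρ i⟩ : AffGroup σ)) =
      FreeGroup.lift ρ := by
    ext i
    simp [linHom]
  exact DFunLike.congr_fun this u

/-- The translation part of the value of a word at an affine tuple, as a function of the
translation parts of the tuple. -/
noncomputable def foxDeriv {I : Type} (σ : P →* Module.End k V) (ρ : I → P) (u : FreeGroup I) :
    (I → V) →ₗ[k] V where
  toFun v := (FreeGroup.lift (fun i => (⟨v i, ρ i⟩ : AffGroup σ)) u).vec
  map_add' v v' := by
    induction u using FreeGroup.induction_on with
    | C1 => simp [vec_one]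
    | of x => simp
    | inv_of x h => simp [vec_inv]; abel
    | mul x y hx hy =>
      simp only [map_mul, vec_mul, hx, hy, lin_lift, map_add]
      abel
  map_smul' c v := by
    induction u using FreeGroup.induction_on with
    | C1 => simp [vec_one]
    | of x => simp
    | inv_of x h => simp [vec_inv]
    | mul x y hx hy =>
      simp only [map_mul, vec_mul, hx, hy, lin_lift, RingHom.id_apply, smul_add, map_smul]

theorem foxDeriv_mul {I : Type} (ρ : I → P) (x y : FreeGroup I) (v : I → V) :
    foxDeriv σ ρ (x * y) v = foxDeriv σ ρ x v + σ (FreeGroup.lift ρ x) (foxDeriv σ ρ y v) := by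
  change (FreeGroup.lift (fun i => (⟨v i, ρ i⟩ : AffGroup σ)) (x * y)).vec = _
  rw [map_mul, vec_mul, lin_lift]
  rfl

theorem foxDeriv_one {I : Type} (ρ : I → P) (v : I → V) : foxDeriv σ ρ 1 v = 0 := by
  change (FreeGroup.lift (fun i => (⟨v i, ρ i⟩ : AffGroup σ)) 1).vec = _
  rw [map_one, vec_one]

theorem foxDeriv_of {I : Type} (ρ : I → P) (i : I) (v : I → V) :
    foxDeriv σ ρ (FreeGroup.of i) v = v i := by
  change (FreeGroup.lift (fun i => (⟨v i, ρ i⟩ : AffGroup σ)) (FreeGroup.of i)).vec = _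
  rw [FreeGroup.lift_apply_of]

theorem foxDeriv_inv {I : Type} (ρ : I → P) (x : FreeGroup I) (v : I → V) :
    foxDeriv σ ρ x⁻¹ v = - σ (FreeGroup.lift ρ x)⁻¹ (foxDeriv σ ρ x v) := by
  change (FreeGroup.lift (fun i => (⟨v i, ρ i⟩ : AffGroup σ)) x⁻¹).vec = _
  rw [map_inv, vec_inv, lin_lift]
  rfl

theorem sum_card_ker_foxDeriv {I : Type} [Fintype I] [DecidableEq I] [Finite V] [Fintype P]
    {w u : FreeGroup I} (h : MeasureEquivIn w u (AffGroup σ)) :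
    ∑ ρ : I → P, Nat.card (LinearMap.ker (foxDeriv σ ρ w)) =
      ∑ ρ : I → P, Nat.card (LinearMap.ker (foxDeriv σ ρ u)) := by
  have key : ∀ x : FreeGroup I, ∑ ρ : I → P, Nat.card (LinearMap.ker (foxDeriv σ ρ x)) =
      ∑ g : P, Nat.card {f : I → AffGroup σ // FreeGroup.lift f x = ⟨0, g⟩} := by
    intro x
    rw [← Nat.card_sigma, ← Nat.card_sigma]
    refine Nat.card_congr ⟨fun y => ⟨FreeGroup.lift y.1 x, fun i => ⟨y.2.1 i, y.1 i⟩, ?_⟩,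
      fun y => ⟨fun i => (y.2.1 i).lin, fun i => (y.2.1 i).vec, ?_⟩, ?_, ?_⟩
    · exact AffGroup.ext y.2.2 (lin_lift _ _ _)
    · exact congrArg vec y.2.2
    · rintro ⟨ρ, v, hv⟩
      rfl
    · rintro ⟨g, f, hf⟩
      have h1 : g = FreeGroup.lift (fun i => (f i).lin) x := by
        rw [← lin_lift (σ := σ) (fun i => (f i).vec)]
        exact (congrArg lin hf).symm
      subst h1
      rfl
  rw [key, key]
  exact Finset.sum_congr rfl fun g _ => h ⟨0, g⟩

end AffGroup

/-- The contragredient representation. -/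
noncomputable def dualRep (σ : P →* Module.End k V) : P →* Module.End k (Module.Dual k V) where
  toFun g := (σ g⁻¹).dualMap
  map_one' := by
    rw [inv_one, map_one]
    rfl
  map_mul' g h := by
    rw [mul_inv_rev, map_mul]
    rfl

theorem dualRep_apply (g : P) (v : Module.Dual k V) (ξ : V) : dualRep σ g v ξ = v (σ g⁻¹ ξ) := rfl

end AffineGroup

section FixedPoints

variable {k Ω P I : Type} [Field k] [AddCommGroup Ω] [Module k Ω] [Group P]

open AffGroup

theorem fixed_of_foxDeriv_eq_zero [Finite k] [Finite Ω] [Finite P] [Fintype I] [DecidableEq I]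
    {σ : P →* Module.End k Ω} {w u : FreeGroup I} (h : MeasureEquivIn w u (AffGroup (dualRep σ)))
    (hw : ∀ (ρ : I → P) ξ, (∀ v, foxDeriv (dualRep σ) ρ w v ξ = 0) → ∀ i, σ (ρ i) ξ = ξ)
    (hu : ∀ (ρ : I → P) ξ, (∀ i, σ (ρ i) ξ = ξ) → ∀ v, foxDeriv (dualRep σ) ρ u v ξ = 0)
    (ρ : I → P) (ξ : Ω) (hξ : ∀ v, foxDeriv (dualRep σ) ρ u v ξ = 0) (i : I) : σ (ρ i) ξ = ξ := by
  have := Fintype.ofFinite P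
  have : Finite (Module.Dual k Ω) := Module.finite_of_finite k
  have hpow : ∀ W : Submodule k (I → Module.Dual k Ω),
      Nat.card W = Nat.card k ^ Module.finrank k W :=
    fun W => Module.natCard_eq_pow_finrank (K := k) (V := W)
  have hle : ∀ ρ : I → P, LinearMap.range (foxDeriv (dualRep σ) ρ u) ≤
      LinearMap.range (foxDeriv (dualRep σ) ρ w) := by
    intro ρ
    rw [← Subspace.dualCoannihilator_dualAnnihilator_eq
      (W := LinearMap.range (foxDeriv (dualRep σ) ρ w))]
    rintro _ ⟨v, rfl⟩
    rw [Submodule.mem_dualAnnihilator]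
    intro ξ hξ
    rw [Submodule.mem_dualCoannihilator] at hξ
    exact hu ρ ξ (hw ρ ξ fun v => hξ _ ⟨v, rfl⟩) v
  have hcard : ∀ ρ : I → P, Nat.card (LinearMap.ker (foxDeriv (dualRep σ) ρ w)) ≤
      Nat.card (LinearMap.ker (foxDeriv (dualRep σ) ρ u)) := by
    intro ρ
    rw [hpow, hpow]
    refine Nat.pow_le_pow_right Nat.card_pos ?_
    have h1 := LinearMap.finrank_range_add_finrank_ker (foxDeriv (dualRep σ) ρ u)
    have h2 := LinearMap.finrank_range_add_finrank_ker (foxDeriv (dualRep σ) ρ w)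
    have h3 := Submodule.finrank_mono (hle ρ)
    omega
  have heq := (Finset.sum_eq_sum_iff_of_le fun ρ _ => hcard ρ).1 (sum_card_ker_foxDeriv h) ρ
    (Finset.mem_univ _)
  rw [hpow, hpow] at heq
  have h0 := Nat.pow_right_injective (Finite.one_lt_card (α := k)) heq
  have h1 := LinearMap.finrank_range_add_finrank_ker (foxDeriv (dualRep σ) ρ u)
  have h2 := LinearMap.finrank_range_add_finrank_ker (foxDeriv (dualRep σ) ρ w)
  have h3 := Submodule.eq_of_le_of_finrank_eq (hle ρ) (by omega)
  refine hw ρ ξ (fun v => ?_) i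
  obtain ⟨v', hv'⟩ := h3.symm ▸ LinearMap.mem_range_self (foxDeriv (dualRep σ) ρ w) v
  rw [← hv']
  exact hξ v'

theorem lift_apply_of_fixed {σ : P →* Module.End k Ω} {ρ : I → P} {ξ : Ω}
    (hξ : ∀ i, σ (ρ i) ξ = ξ) (g : FreeGroup I) : σ (FreeGroup.lift ρ g) ξ = ξ := by
  induction g using FreeGroup.induction_on with
  | C1 => simp
  | of x => simp [hξ]
  | inv_of x h =>
    rw [map_inv]
    nth_rw 1 [← h]
    rw [rep_inv_apply_self]
  | mul x y hx hy => rw [map_mul, map_mul, Module.End.mul_apply, hy, hx]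

theorem foxDeriv_apply_of_fixed {σ : P →* Module.End k Ω} {ρ : I → P} {ξ : Ω}
    (hξ : ∀ i, σ (ρ i) ξ = ξ) (v : I → Module.Dual k Ω) (g : FreeGroup I) :
    foxDeriv (dualRep σ) ρ g v ξ =
      (FreeGroup.lift (fun i => Multiplicative.ofAdd (v i ξ)) g).toAdd := by
  have h1 : ∀ g, σ (FreeGroup.lift ρ g)⁻¹ ξ = ξ := fun g => by
    rw [← map_inv]
    exact lift_apply_of_fixed hξ _
  induction g using FreeGroup.induction_on with
  | C1 => simp [foxDeriv_one]
  | of x => simp [foxDeriv_of]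
  | inv_of x h =>
    rw [foxDeriv_inv, map_inv (FreeGroup.lift fun i => Multiplicative.ofAdd (v i ξ)), toAdd_inv,
      ← h, LinearMap.neg_apply, dualRep_apply, inv_inv,
      lift_apply_of_fixed hξ]
  | mul x y hx hy =>
    rw [foxDeriv_mul, map_mul (FreeGroup.lift fun i => Multiplicative.ofAdd (v i ξ)), toAdd_mul,
      ← hx, ← hy, LinearMap.add_apply, dualRep_apply, h1]

theorem lift_eq_one_of_measureEquivIn {Q : Type} [Group Q] [Finite Q] [Finite I] {w u : FreeGroup I}
    (h : MeasureEquivIn w u Q) (hw : ∀ f : I → Q, FreeGroup.lift f w = 1) (f : I → Q) :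
    FreeGroup.lift f u = 1 := by
  by_contra hne
  have h1 := h (FreeGroup.lift f u)
  have h2 : IsEmpty {f' : I → Q // FreeGroup.lift f' w = FreeGroup.lift f u} :=
    ⟨fun x => hne (by rw [← x.2, hw])⟩
  rw [Nat.card_of_isEmpty] at h1
  have h3 := (Finite.card_eq_zero_iff).1 h1.symm
  exact h3.false ⟨f, rfl⟩

theorem foxDeriv_commutator {σ : P →* Module.End k Ω} (ρ : I → P) (a b : I)
    (v : I → Module.Dual k Ω) (ξ : Ω) :
    foxDeriv (dualRep σ) ρ ⁅FreeGroup.of a, FreeGroup.of b⁆ v ξ =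
      v a (ξ - σ (ρ a) (σ (ρ b)⁻¹ (σ (ρ a)⁻¹ ξ))) +
        v b (σ (ρ a)⁻¹ ξ - σ (ρ b) (σ (ρ a) (σ (ρ b)⁻¹ (σ (ρ a)⁻¹ ξ)))) := by
  simp only [commutatorElement_def, foxDeriv_mul, foxDeriv_inv, foxDeriv_of,
    FreeGroup.lift_apply_of, map_mul, map_inv, LinearMap.add_apply, LinearMap.neg_apply,
    dualRep_apply, map_neg, map_sub,
    Module.End.mul_apply, inv_inv]
  abel

theorem foxDeriv_prod_eq_zero {d : ℕ} {σ : P →* Module.End k Ω} (ρ : Fin d × Bool → P)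
    (v : Fin d × Bool → Module.Dual k Ω) (l : List (Fin d)) (h : ∀ i ∈ l, ∀ b, v (i, b) = 0) :
    foxDeriv (dualRep σ) ρ
      (l.map fun i => ⁅FreeGroup.of (i, false), FreeGroup.of (i, true)⁆).prod v = 0 := by
  induction l with
  | nil => exact foxDeriv_one _ _
  | cons a l ih =>
    rw [List.map_cons, List.prod_cons, foxDeriv_mul, ih fun i hi => h i (List.mem_cons_of_mem _ hi)]
    ext ξ
    rw [map_zero, add_zero, foxDeriv_commutator]
    simp [h a List.mem_cons_self]

theorem fixed_of_foxDeriv_prod_eq_zero {d : ℕ} {σ : P →* Module.End k Ω} (ρ : Fin d × Bool → P)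
    (ξ : Ω) (l : List (Fin d)) (hl : l.Nodup)
    (h : ∀ v, foxDeriv (dualRep σ) ρ
      (l.map fun i => ⁅FreeGroup.of (i, false), FreeGroup.of (i, true)⁆).prod v ξ = 0) :
    ∀ i ∈ l, ∀ b, σ (ρ (i, b)) ξ = ξ := by
  induction l with
  | nil => simp
  | cons a l ih =>
    rw [List.nodup_cons] at hl
    simp only [List.map_cons, List.prod_cons, foxDeriv_mul, LinearMap.add_apply, dualRep_apply] at h
    have key : ∀ (b : Bool) (φ : Module.Dual k Ω),
        foxDeriv (dualRep σ) ρ ⁅FreeGroup.of (a, false), FreeGroup.of (a, true)⁆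
          (Pi.single (a, b) φ) ξ = 0 := by
      intro b φ
      have h1 := h (Pi.single (a, b) φ)
      rwa [foxDeriv_prod_eq_zero ρ _ l, LinearMap.zero_apply, add_zero] at h1
      intro i hi b'
      refine Pi.single_eq_of_ne (fun h2 => hl.1 ?_) _
      have h3 : i = a := (Prod.ext_iff.1 h2).1
      exact h3 ▸ hi
    have h1 : ξ = σ (ρ (a, false)) (σ (ρ (a, true))⁻¹ (σ (ρ (a, false))⁻¹ ξ)) := by
      refine sub_eq_zero.1 ((Module.forall_dual_apply_eq_zero_iff k _).1 fun φ => ?_)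
      have := key false φ
      rw [foxDeriv_commutator] at this
      simpa using this
    have h2 : σ (ρ (a, false))⁻¹ ξ =
        σ (ρ (a, true)) (σ (ρ (a, false)) (σ (ρ (a, true))⁻¹ (σ (ρ (a, false))⁻¹ ξ))) := by
      refine sub_eq_zero.1 ((Module.forall_dual_apply_eq_zero_iff k _).1 fun φ => ?_)
      have := key true φ
      rw [foxDeriv_commutator] at this
      simpa using this
    rw [← h1] at h2
    have h3 : σ (ρ (a, false))⁻¹ ξ = σ (ρ (a, true))⁻¹ (σ (ρ (a, false))⁻¹ ξ) := by
      have := congrArg (σ (ρ (a, false))⁻¹) h1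
      rwa [rep_inv_apply_self] at this
    have hb : σ (ρ (a, true)) ξ = ξ := by
      rw [h2, rep_inv_apply_self] at h3
      rw [← h2, h2]
      exact h3.symm ▸ rfl
    have ha : σ (ρ (a, false)) ξ = ξ := by
      rw [hb] at h2
      rw [← h2, rep_apply_inv_self, h2]
    have hfix : ∀ b, σ (ρ (a, b)) ξ = ξ := by
      rintro (_ | _)
      · exact ha
      · exact hb
    intro i hi b
    rcases List.mem_cons.1 hi with rfl | hi
    · exact hfix b
    · refine ih hl.2 (fun v => ?_) i hi b
      have h4 := h v
      have hb' : σ (ρ (a, true))⁻¹ ξ = ξ := by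
        nth_rw 1 [← hb]
        rw [rep_inv_apply_self]
      rw [foxDeriv_commutator, ← map_inv, commutatorElement_inv] at h4
      simpa [commutatorElement_def, h2, ha, hb, hb', h2.trans hb] using h4

end FixedPoints

section WordSum

variable {I A B : Type} [DecidableEq I] [AddCommGroup A] [AddCommGroup B]

/-- The sum over the occurrences of the letter `x` in the word `L` of the values of `s` before the
positive occurrences, minus the values of `s` after the negative occurrences. -/
def wordSum (L : List (I × Bool)) (x : I) (s : Fin (L.length + 1) → A) : A :=
  ∑ m : Fin L.length, if L[m] = (x, true) then s m.castSucc else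
    if L[m] = (x, false) then -s m.succ else 0

theorem wordSum_cons (a : I × Bool) (L : List (I × Bool)) (x : I)
    (s : Fin ((a :: L).length + 1) → A) : wordSum (a :: L) x s =
      (if a = (x, true) then s 0 else if a = (x, false) then -s 1 else 0) +
        wordSum L x (fun j => s j.succ) := by
  unfold wordSum
  exact Fin.sum_univ_succ _

theorem map_wordSum (φ : A →+ B) (L : List (I × Bool)) (x : I) (s : Fin (L.length + 1) → A) :
    φ (wordSum L x s) = wordSum L x fun j => φ (s j) := by
  unfold wordSum
  rw [map_sum]
  refine Finset.sum_congr rfl fun m _ => ?_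
  split_ifs <;> simp

theorem wordSum_sub (L : List (I × Bool)) (x : I) (s t : Fin (L.length + 1) → A) :
    wordSum L x (fun j => s j - t j) = wordSum L x s - wordSum L x t := by
  unfold wordSum
  rw [← Finset.sum_sub_distrib]
  refine Finset.sum_congr rfl fun m _ => ?_
  split_ifs
  · rfl
  · rw [neg_sub, sub_neg_eq_add, neg_add_eq_sub]
  · simp

variable {k Ω P : Type} [Field k] [AddCommGroup Ω] [Module k Ω] [Group P] [Fintype I]

theorem foxDeriv_mk (σ : P →* Module.End k Ω) (ρ : I → P) (v : I → Module.Dual k Ω)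
    (L : List (I × Bool)) (s : Fin (L.length + 1) → Ω)
    (hs : ∀ m : Fin L.length, if (L[m]).2 then σ (ρ (L[m]).1) (s m.succ) = s m.castSucc
      else s m.succ = σ (ρ (L[m]).1) (s m.castSucc)) :
    AffGroup.foxDeriv (dualRep σ) ρ (FreeGroup.mk L) v (s 0) = ∑ x, v x (wordSum L x s) := by
  induction L with
  | nil =>
    rw [← FreeGroup.one_eq_mk, AffGroup.foxDeriv_one]
    simp [wordSum]
  | cons a L ih =>
    have h0 := hs 0
    have ih' := ih (fun j => s j.succ) fun m => hs m.succ
    simp only [wordSum_cons, map_add, Finset.sum_add_distrib]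
    rw [← ih']
    have hmk : FreeGroup.mk (a :: L) = FreeGroup.mk [a] * FreeGroup.mk L := by
      rw [FreeGroup.mul_mk]
      rfl
    rw [hmk, AffGroup.foxDeriv_mul, LinearMap.add_apply, dualRep_apply]
    obtain ⟨y, b⟩ := a
    have h2 : (y, b) = (((y, b) :: L)[(0 : Fin (L.length + 1))]) := rfl
    rw [← h2] at h0
    cases b
    · have h1 : FreeGroup.mk [(y, false)] = (FreeGroup.of y)⁻¹ := by
        rw [FreeGroup.of, FreeGroup.inv_mk]
        rfl
      simp only [Bool.false_eq_true, if_false] at h0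
      rw [h1, AffGroup.foxDeriv_inv, AffGroup.foxDeriv_of, map_inv (FreeGroup.lift ρ),
        FreeGroup.lift_apply_of, LinearMap.neg_apply, dualRep_apply, inv_inv]
      have h3 : σ (ρ y) (s 0) = s 1 := h0.symm
      rw [h3]
      congr 1
      rw [Finset.sum_eq_single y]
      · simp
      · intro x _ hx
        simp [Ne.symm hx]
      · simp
    · have h1 : FreeGroup.mk [(y, true)] = FreeGroup.of y := rfl
      simp only [if_true] at h0
      have h3 : σ (ρ y)⁻¹ (s 0) = s 1 := by
        have : s 0 = σ (ρ y) (s 1) := h0.symm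
        rw [this, rep_inv_apply_self]
      rw [h1, AffGroup.foxDeriv_of, FreeGroup.lift_apply_of, h3]
      congr 1
      rw [Finset.sum_eq_single y]
      · simp
      · intro x _ hx
        simp [Ne.symm hx]
      · simp

end WordSum

section RelationPencil

variable {I k A : Type} [DecidableEq I] [Fintype I] [Field k] [AddCommGroup A] [Module k A]

/-- The coefficient function of a single unknown. -/
def unitCoeff {Λ ι : Type} [DecidableEq Λ] [DecidableEq ι] (k : Type) [Field k] (a : Λ) (b : ι)
    (l : Λ) (i : ι) : k :=
  if l = a ∧ i = b then 1 else 0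

theorem sum_unitCoeff {Λ ι : Type} [DecidableEq Λ] [DecidableEq ι] [Fintype Λ] [Fintype ι]
    (a : Λ) (b : ι) (E : Λ → ι → A) : ∑ l, ∑ i, unitCoeff k a b l i • E l i = E a b := by
  rw [Finset.sum_eq_single a, Finset.sum_eq_single b]
  · simp [unitCoeff]
  · intro i _ hi
    simp [unitCoeff, hi]
  · simp
  · intro l _ hl
    refine Finset.sum_eq_zero fun i _ => ?_
    simp [unitCoeff, hl]
  · simp

/-- The linear system whose unknowns are a cocycle and its values on the prefixes of the word `L`,
expressing that the Fox derivatives of `L` vanish. -/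
def relationPencil (k : Type) [Field k] (L : List (I × Bool)) :
    Option I → Matrix (I ⊕ Fin (L.length + 1)) (I ⊕ Fin (L.length + 1)) k := fun l i j =>
  Sum.elim
    (fun y => ∑ m : Fin L.length, if L[m] = (y, true) then unitCoeff k none (Sum.inr m.castSucc) l i
      else if L[m] = (y, false) then -unitCoeff k none (Sum.inr m.succ) l i else 0)
    (Fin.cases (unitCoeff k none (Sum.inr 0) l i) fun m =>
      if (L[m]).2 then unitCoeff k (some (L[m]).1) (Sum.inr m.succ) l i -
        unitCoeff k none (Sum.inr m.castSucc) l i + unitCoeff k none (Sum.inl (L[m]).1) l i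
      else unitCoeff k none (Sum.inr m.succ) l i -
        unitCoeff k (some (L[m]).1) (Sum.inr m.castSucc) l i -
          unitCoeff k none (Sum.inl (L[m]).1) l i) j

variable {L : List (I × Bool)} (E : Option I → I ⊕ Fin (L.length + 1) → A)

theorem relationPencil_inl (y : I) : ∑ l, ∑ i, relationPencil k L l i (Sum.inl y) • E l i =
    wordSum L y fun j => E none (Sum.inr j) := by
  simp only [relationPencil, Sum.elim_inl, Finset.sum_smul, wordSum]
  have h1 : ∀ l, ∑ i, ∑ m : Fin L.length, (if L[m] = (y, true) then
      unitCoeff k none (Sum.inr m.castSucc) l i else if L[m] = (y, false) then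
        -unitCoeff k none (Sum.inr m.succ) l i else 0) • E l i =
      ∑ m : Fin L.length, ∑ i, (if L[m] = (y, true) then
      unitCoeff k none (Sum.inr m.castSucc) l i else if L[m] = (y, false) then
        -unitCoeff k none (Sum.inr m.succ) l i else 0) • E l i := fun l => Finset.sum_comm
  simp only [h1]
  rw [Finset.sum_comm]
  refine Finset.sum_congr rfl fun m _ => ?_
  split_ifs
  · exact sum_unitCoeff _ _ _
  · simp only [neg_smul, Finset.sum_neg_distrib]
    rw [sum_unitCoeff]
  · simp

theorem relationPencil_inr_zero : ∑ l, ∑ i, relationPencil k L l i (Sum.inr 0) • E l i =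
    E none (Sum.inr 0) :=
  sum_unitCoeff _ _ _

theorem relationPencil_inr_succ (m : Fin L.length) :
    ∑ l, ∑ i, relationPencil k L l i (Sum.inr m.succ) • E l i =
      if (L[m]).2 then E (some (L[m]).1) (Sum.inr m.succ) - E none (Sum.inr m.castSucc) +
        E none (Sum.inl (L[m]).1)
      else E none (Sum.inr m.succ) - E (some (L[m]).1) (Sum.inr m.castSucc) -
        E none (Sum.inl (L[m]).1) := by
  simp only [relationPencil, Sum.elim_inr, Fin.cases_succ]
  split_ifs <;> simp only [sub_smul, add_smul, Finset.sum_sub_distrib, Finset.sum_add_distrib,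
    sum_unitCoeff]

end RelationPencil

section Twin

/-- `u` has the same distribution as the surface word on all finite groups in the
pseudovariety. -/
def IsTwin (p q : ℕ) {d : ℕ} (u : FreeGroup (Fin d × Bool)) : Prop :=
  ∀ (Q : Type) [Group Q] [Finite Q], MemNpAfNq p q Q → MeasureEquivIn (orientableRelator d) u Q

variable {p q d : ℕ} {u : FreeGroup (Fin d × Bool)}

theorem orientableRelator_eq : orientableRelator d = ((List.finRange d).map fun i : Fin d =>
    ⁅FreeGroup.of (i, false), FreeGroup.of (i, true)⁆).prod := by
  rw [orientableRelator, List.ofFn_eq_map]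

theorem lift_orientableRelator {Q : Type} [CommGroup Q] (f : Fin d × Bool → Q) :
    FreeGroup.lift f (orientableRelator d) = 1 := by
  rw [orientableRelator_eq, map_list_prod, List.map_map]
  refine List.prod_eq_one fun x hx => ?_
  obtain ⟨i, -, rfl⟩ := List.mem_map.1 hx
  simp [commutatorElement_eq_one_iff_mul_comm, mul_comm]

theorem IsTwin.lift_eq_one [Fact p.Prime] (hu : IsTwin p q u)
    (f : Fin d × Bool → Multiplicative (ZMod p)) : FreeGroup.lift f u = 1 := by
  refine lift_eq_one_of_measureEquivIn (hu _ ⟨⊤, ⊤, inferInstance, inferInstance, le_rfl, ?_,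
    fun _ _ _ _ => trivial, fun _ => ⟨0, trivial⟩⟩) lift_orientableRelator f
  rintro ⟨x, hx⟩
  refine ⟨1, Subtype.ext ?_⟩
  change x ^ p ^ 1 = 1
  rw [pow_one, ← toAdd_eq_zero, toAdd_pow, nsmul_eq_mul, CharP.cast_eq_zero, zero_mul]

variable [Fact p.Prime] {P Ω : Type} [Group P] [AddCommGroup Ω] [Module (ZMod p) Ω]

theorem IsTwin.foxDeriv_of_fixed (hu : IsTwin p q u) {σ : P →* Module.End (ZMod p) Ω}
    {ρ : Fin d × Bool → P} {ξ : Ω} (hξ : ∀ i, σ (ρ i) ξ = ξ)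
    (v : Fin d × Bool → Module.Dual (ZMod p) Ω) :
    AffGroup.foxDeriv (dualRep σ) ρ u v ξ = 0 := by
  rw [foxDeriv_apply_of_fixed hξ, hu.lift_eq_one]
  rfl

theorem IsTwin.fixed [Finite P] [Finite Ω] (hu : IsTwin p q u) (hP : MemNpAfNq p q P)
    {σ : P →* Module.End (ZMod p) Ω} {ρ : Fin d × Bool → P} {ξ : Ω}
    (hξ : ∀ v, AffGroup.foxDeriv (dualRep σ) ρ u v ξ = 0) (i : Fin d × Bool) :
    σ (ρ i) ξ = ξ := by
  have : Finite (Module.Dual (ZMod p) Ω) := Module.finite_of_finite (ZMod p)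
  refine fixed_of_foxDeriv_eq_zero (hu _ (AffGroup.memNpAfNq hP)) (fun ρ ξ h i => ?_)
    (fun ρ ξ h v => hu.foxDeriv_of_fixed h v) ρ ξ hξ i
  rw [orientableRelator_eq] at h
  exact fixed_of_foxDeriv_prod_eq_zero ρ ξ _ (List.nodup_finRange d) h i.1 (List.mem_finRange _) i.2

theorem IsTwin.wordSum_const (hu : IsTwin p q u) {L : List ((Fin d × Bool) × Bool)}
    (hL : FreeGroup.mk L = u) (x : Fin d × Bool) : wordSum L x (fun _ => (1 : ZMod p)) = 0 := by
  have h1 := foxDeriv_mk (k := ZMod p) (Ω := ZMod p) (P := Unit) 1 (fun _ => ())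
    (Pi.single x LinearMap.id) L (fun _ => 1) (fun m => by split_ifs <;> rfl)
  rw [hL, hu.foxDeriv_of_fixed (fun _ => rfl), Finset.sum_eq_single x] at h1
  · simpa using h1.symm
  · intro y _ hy
    rw [Pi.single_eq_of_ne hy, LinearMap.zero_apply]
  · simp

/-- The linear action of the affine group on the sum of the translation module and a line. -/
noncomputable def affRep {k : Type} [Field k] {V : Type} [AddCommGroup V] [Module k V]
    (σ : P →* Module.End k V) : AffGroup σ →* Module.End k (V × k) where
  toFun g := ((σ g.lin).comp (LinearMap.fst k V k) +
    (LinearMap.toSpanSingleton k V g.vec).comp (LinearMap.snd k V k)).prod (LinearMap.snd k V k)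
  map_one' := by
    refine LinearMap.ext fun x => Prod.ext ?_ rfl
    change σ 1 x.1 + x.2 • (0 : V) = x.1
    simp
  map_mul' g h := by
    refine LinearMap.ext fun x => Prod.ext ?_ rfl
    change σ (g.lin * h.lin) x.1 + x.2 • (g.vec + σ g.lin h.vec) =
      σ g.lin (σ h.lin x.1 + x.2 • h.vec) + x.2 • g.vec
    simp only [map_mul, Module.End.mul_apply, map_add, map_smul, smul_add]
    abel

theorem affRep_apply {k : Type} [Field k] {V : Type} [AddCommGroup V] [Module k V]
    (σ : P →* Module.End k V) (g : AffGroup σ) (x : V × k) :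
    affRep σ g x = (σ g.lin x.1 + x.2 • g.vec, x.2) := rfl

theorem IsTwin.hasNoFiniteSolution (hu : IsTwin p q u) {L : List ((Fin d × Bool) × Bool)}
    (hL : FreeGroup.mk L = u) : HasNoFiniteSolution q (relationPencil (ZMod p) L) := by
  intro Ω _ _ _ ρ₀ K hK1 hK2 hK3 hK4 c hc
  let τ := MonoidHom.toHomUnits ρ₀
  have hfE : Finite (Module.End (ZMod p) Ω) := DFunLike.finite _
  let σ₀ : τ.range →* Module.End (ZMod p) Ω := (Units.coeHom _).comp τ.range.subtype
  have hσ₀ : ∀ g, σ₀ (τ.rangeRestrict g) = ρ₀ g := fun _ => rfl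
  have hsurj : Function.Surjective τ.rangeRestrict := τ.rangeRestrict_surjective
  have hP₀ : MemNpAfNq p q τ.range := by
    refine ⟨⊥, K.map τ.rangeRestrict, inferInstance, hK1.map _ hsurj, bot_le,
      IsPGroup.of_bot, ?_, ?_⟩
    · rintro _ ⟨a, ha, rfl⟩ _ ⟨b, hb, rfl⟩
      rw [Subgroup.mem_bot, commutatorElement_eq_one_iff_mul_comm]
      exact Subtype.ext (Units.ext (hK4 a ha b hb))
    · intro x
      obtain ⟨g, rfl⟩ := hsurj x
      obtain ⟨n, hn⟩ := hK3 g
      exact ⟨n, g ^ q ^ n, hn, map_pow _ _ _⟩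
  let ρ : Fin d × Bool → AffGroup σ₀ := fun x => ⟨c (Sum.inl x), τ.rangeRestrict (FreeGroup.of x)⟩
  let s : Fin (L.length + 1) → Ω × ZMod p := fun j => (c (Sum.inr j), 1)
  have hstep : ∀ m : Fin L.length,
      if (L[m]).2 then affRep σ₀ (ρ (L[m]).1) (s m.succ) = s m.castSucc
        else s m.succ = affRep σ₀ (ρ (L[m]).1) (s m.castSucc) := by
    intro m
    have h1 := hc (Sum.inr m.succ)
    rw [relationPencil_inr_succ (E := fun l i => ρ₀ (letterOrOne l) (c i))] at h1
    simp only [letterOrOne_none, letterOrOne_some, map_one, Module.End.one_apply] at h1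
    split_ifs at h1 ⊢ with hb
    · rw [affRep_apply]
      refine Prod.ext ?_ rfl
      change ρ₀ (FreeGroup.of _) (c _) + (1 : ZMod p) • c (Sum.inl _) = c _
      rw [one_smul]
      rw [sub_add_eq_add_sub] at h1
      exact sub_eq_zero.1 h1
    · rw [affRep_apply]
      refine Prod.ext ?_ rfl
      change c _ = ρ₀ (FreeGroup.of _) (c _) + (1 : ZMod p) • c (Sum.inl _)
      rw [one_smul]
      rw [sub_sub] at h1
      exact sub_eq_zero.1 h1
  have h0 : c (Sum.inr 0) = 0 := by
    have h1 := hc (Sum.inr 0)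
    rw [relationPencil_inr_zero (E := fun l i => ρ₀ (letterOrOne l) (c i))] at h1
    simpa [letterOrOne_none] using h1
  have hfix := hu.fixed (AffGroup.memNpAfNq hP₀) (σ := affRep σ₀) (ρ := ρ) (ξ := s 0) fun v => by
    rw [← hL, foxDeriv_mk _ _ _ _ _ hstep]
    refine Finset.sum_eq_zero fun x _ => ?_
    have h2 : wordSum L x s = 0 := by
      refine Prod.ext ?_ ?_
      · have h1 := hc (Sum.inl x)
        rw [relationPencil_inl (E := fun l i => ρ₀ (letterOrOne l) (c i))] at h1
        simp only [letterOrOne_none, map_one, Module.End.one_apply] at h1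
        exact (map_wordSum (AddMonoidHom.fst Ω (ZMod p)) L x s).trans h1
      · exact (map_wordSum (AddMonoidHom.snd Ω (ZMod p)) L x s).trans (hu.wordSum_const hL x)
    rw [h2, map_zero]
  have hinl : ∀ x, c (Sum.inl x) = 0 := by
    intro x
    have h1 := congrArg Prod.fst (hfix x)
    rw [affRep_apply] at h1
    change ρ₀ (FreeGroup.of x) (c (Sum.inr 0)) + (1 : ZMod p) • c (Sum.inl x) = c (Sum.inr 0) at h1
    rwa [h0, map_zero, zero_add, one_smul] at h1
  have hinr : ∀ j, c (Sum.inr j) = 0 := by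
    intro j
    induction j using Fin.induction with
    | zero => exact h0
    | succ m ih =>
      have h1 := hstep m
      split_ifs at h1
      · have h2 := congrArg Prod.fst h1
        change ρ₀ (FreeGroup.of _) (c _) + (1 : ZMod p) • c (Sum.inl _) = c _ at h2
        rw [hinl, smul_zero, add_zero, ih] at h2
        have h3 := congrArg (ρ₀ (FreeGroup.of (L[m]).1)⁻¹) h2
        rwa [map_zero, rep_inv_apply_self] at h3
      · have h2 := congrArg Prod.fst h1
        change c _ = ρ₀ (FreeGroup.of _) (c _) + (1 : ZMod p) • c (Sum.inl _) at h2
        rwa [hinl, smul_zero, add_zero, ih, map_zero] at h2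
  funext i
  cases i with
  | inl x => exact hinl x
  | inr j => exact hinr j

theorem mk_take_succ {I : Type} (L : List (I × Bool)) (m : Fin L.length) :
    FreeGroup.mk (L.take (m + 1)) = FreeGroup.mk (L.take m) * FreeGroup.mk [L[m]] := by
  rw [FreeGroup.mul_mk, List.take_succ_eq_append_getElem m.2]
  rfl

/-- The coboundary of `ξ` on the generators and on the prefixes of the word `L`. -/
def cocyclePrefixes {I k : Type} [Field k] (L : List (I × Bool)) (ξ : FreeGroup I → k) :
    I ⊕ Fin (L.length + 1) → FreeGroup I → k
  | Sum.inl x, g => ξ ((FreeGroup.of x)⁻¹ * g) - ξ g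
  | Sum.inr j, g => ξ (FreeGroup.mk (L.take j) * g) - ξ g

theorem sum_relationPencil_cocyclePrefixes {I k : Type} [DecidableEq I] [Fintype I] [Field k]
    {L : List (I × Bool)} {ξ : FreeGroup I → k}
    (hξ : ∀ x g, wordSum L x (fun j => ξ (FreeGroup.mk (L.take j) * g)) = 0)
    (hL : ∀ x, wordSum L x (fun _ => (1 : k)) = 0) (j : I ⊕ Fin (L.length + 1))
    (g : FreeGroup I) : ∑ l, ∑ i, relationPencil k L l i j •
      cocyclePrefixes L ξ i ((letterOrOne l)⁻¹ * g) = 0 := by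
  rcases j with x | j
  · rw [relationPencil_inl (E := fun l i => cocyclePrefixes L ξ i ((letterOrOne l)⁻¹ * g))]
    simp only [letterOrOne_none, inv_one, one_mul, cocyclePrefixes]
    rw [wordSum_sub, hξ, zero_sub, neg_eq_zero]
    have h1 := map_wordSum (AddMonoidHom.mulLeft (ξ g)) L x (fun _ => 1)
    rw [hL, map_zero] at h1
    simpa using h1.symm
  · induction j using Fin.cases with
    | zero =>
      rw [relationPencil_inr_zero (E := fun l i => cocyclePrefixes L ξ i ((letterOrOne l)⁻¹ * g))]
      simp [cocyclePrefixes, letterOrOne_none, ← FreeGroup.one_eq_mk]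
    | succ m =>
      rw [relationPencil_inr_succ (E := fun l i => cocyclePrefixes L ξ i ((letterOrOne l)⁻¹ * g))]
      simp only [letterOrOne_none, letterOrOne_some, inv_one, one_mul, cocyclePrefixes,
        Fin.val_succ, Fin.val_castSucc, mk_take_succ]
      split_ifs with hb
      · have h1 : FreeGroup.mk [L[m]] = FreeGroup.of (L[m]).1 := by
          rw [FreeGroup.of, ← hb]
        rw [h1, mul_assoc, mul_inv_cancel_left]
        abel
      · have h1 : FreeGroup.mk [L[m]] = (FreeGroup.of (L[m]).1)⁻¹ := by
          rw [FreeGroup.of, FreeGroup.inv_mk]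
          simp only [FreeGroup.invRev, List.map_cons, List.map_nil, List.reverse_singleton,
            Bool.not_true]
          rw [← Bool.eq_false_iff.2 hb]
        rw [h1, mul_assoc]
        abel

theorem IsTwin.eq_of_wordSum_eq_zero (hu : IsTwin p q u) (hq : 1 < q)
    {L : List ((Fin d × Bool) × Bool)} (hL : FreeGroup.mk L = u)
    {ξ : FreeGroup (Fin d × Bool) → ZMod p}
    (hξ : ∀ x g, wordSum L x (fun j => ξ (FreeGroup.mk (L.take j) * g)) = 0)
    (g g' : FreeGroup (Fin d × Bool)) : ξ g = ξ g' := by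
  have key := (hu.hasNoFiniteSolution hL).eq_zero hq (V := cocyclePrefixes L ξ) fun j g => by
    have h0 := sum_relationPencil_cocyclePrefixes (k := ZMod p) hξ
      (fun x => hu.wordSum_const hL x) j g
    exact h0
  have hstep : ∀ x g, ξ ((FreeGroup.of x)⁻¹ * g) = ξ g := fun x g =>
    sub_eq_zero.1 (congrFun (congrFun key (Sum.inl x)) g)
  have hall : ∀ h g, ξ (h * g) = ξ g := by
    intro h
    induction h using FreeGroup.induction_on with
    | C1 => simp
    | of x =>
      intro g
      rw [← hstep x, inv_mul_cancel_left]
    | inv_of x _ => exact hstep x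
    | mul x y hx hy =>
      intro g
      rw [mul_assoc, hx, hy]
  have h1 := hall (g * g'⁻¹) g'
  rwa [inv_mul_cancel_right] at h1

end Twin

section Automorphisms

variable {I : Type}

/-- The subgroup of the free group generated by the generators indexed by `T`. -/
abbrev genBy (T : Set I) : Subgroup (FreeGroup I) :=
  Subgroup.closure (Set.image FreeGroup.of T)

theorem genBy_mono {S T : Set I} (h : S ⊆ T) : genBy S ≤ genBy T :=
  Subgroup.closure_mono (Set.image_mono h)

theorem of_mem_genBy {T : Set I} {i : I} (h : i ∈ T) : FreeGroup.of i ∈ genBy T :=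
  Subgroup.subset_closure ⟨i, h, rfl⟩

theorem mk_singleton (y : I × Bool) : FreeGroup.mk [y] =
    if y.2 then FreeGroup.of y.1 else (FreeGroup.of y.1)⁻¹ := by
  obtain ⟨i, _ | _⟩ := y
  · simp [FreeGroup.of, FreeGroup.inv_mk, FreeGroup.invRev]
  · rfl

theorem mk_singleton_not (i : I) (b : Bool) :
    FreeGroup.mk [(i, !b)] = (FreeGroup.mk [(i, b)])⁻¹ := by
  cases b <;> simp [mk_singleton]

theorem mk_mem_genBy {T : Set I} {L : List (I × Bool)} (h : ∀ y ∈ L, y.1 ∈ T) :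
    FreeGroup.mk L ∈ genBy T := by
  induction L with
  | nil => exact one_mem _
  | cons y L ih =>
    have h1 : FreeGroup.mk (y :: L) = FreeGroup.mk [y] * FreeGroup.mk L := by
      rw [FreeGroup.mul_mk]
      rfl
    rw [h1, mk_singleton]
    refine mul_mem ?_ (ih fun z hz => h z (List.mem_cons_of_mem _ hz))
    have h2 := of_mem_genBy (h y List.mem_cons_self)
    split_ifs
    · exact h2
    · exact inv_mem h2

theorem exists_mk_eq_of_mem_genBy {T : Set I} {g : FreeGroup I} (hg : g ∈ genBy T) :
    ∃ L : List (I × Bool), FreeGroup.mk L = g ∧ ∀ y ∈ L, y.1 ∈ T := by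
  induction hg using Subgroup.closure_induction with
  | mem x hx =>
    obtain ⟨i, hi, rfl⟩ := hx
    exact ⟨[(i, true)], rfl, by simpa using hi⟩
  | one => exact ⟨[], rfl, by simp⟩
  | mul x y _ _ hx hy =>
    obtain ⟨L, rfl, hL⟩ := hx
    obtain ⟨L', rfl, hL'⟩ := hy
    exact ⟨L ++ L', FreeGroup.mul_mk.symm, fun y hy =>
      (List.mem_append.1 hy).elim (hL y) (hL' y)⟩
  | inv x _ hx =>
    obtain ⟨L, rfl, hL⟩ := hx
    refine ⟨FreeGroup.invRev L, FreeGroup.inv_mk.symm, fun y hy => ?_⟩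
    simp only [FreeGroup.invRev, List.mem_reverse, List.mem_map] at hy
    obtain ⟨z, hz, rfl⟩ := hy
    exact hL z hz

theorem lift_eq_self_of_mem_genBy {T : Set I} {f : I → FreeGroup I}
    (hf : ∀ i ∈ T, f i = FreeGroup.of i) {g : FreeGroup I} (hg : g ∈ genBy T) :
    FreeGroup.lift f g = g := by
  induction hg using Subgroup.closure_induction with
  | mem x hx =>
    obtain ⟨i, hi, rfl⟩ := hx
    rw [FreeGroup.lift_apply_of, hf i hi]
  | one => exact map_one _
  | mul x y _ _ hx hy => rw [map_mul, hx, hy]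
  | inv x _ hx => rw [map_inv, hx]

theorem exists_shear [DecidableEq I] (T : Set I) [DecidablePred (· ∈ T)] (g h : I → FreeGroup I)
    (hg : ∀ i ∈ T, g i ∈ genBy Tᶜ) (hh : ∀ i ∈ T, h i ∈ genBy Tᶜ) :
    ∃ φ : FreeGroup I ≃* FreeGroup I, ∀ i,
      φ (FreeGroup.of i) = if i ∈ T then g i * FreeGroup.of i * h i else FreeGroup.of i := by
  let f : I → FreeGroup I := fun i =>
    if i ∈ T then g i * FreeGroup.of i * h i else FreeGroup.of i
  let f' : I → FreeGroup I := fun i =>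
    if i ∈ T then (g i)⁻¹ * FreeGroup.of i * (h i)⁻¹ else FreeGroup.of i
  have hf : ∀ i ∈ Tᶜ, f i = FreeGroup.of i := fun i hi => if_neg hi
  have hf' : ∀ i ∈ Tᶜ, f' i = FreeGroup.of i := fun i hi => if_neg hi
  have hfi : ∀ i, FreeGroup.lift f (FreeGroup.of i) = f i := fun i => FreeGroup.lift_apply_of
  have hfi' : ∀ i, FreeGroup.lift f' (FreeGroup.of i) = f' i := fun i => FreeGroup.lift_apply_of
  refine ⟨MonoidHom.toMulEquiv (FreeGroup.lift f) (FreeGroup.lift f') ?_ ?_, hfi⟩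
  · refine FreeGroup.ext_hom _ _ fun i => ?_
    rw [MonoidHom.comp_apply, hfi, MonoidHom.id_apply]
    by_cases hi : i ∈ T
    · have h1 : f i = g i * FreeGroup.of i * h i := if_pos hi
      have h2 : f' i = (g i)⁻¹ * FreeGroup.of i * (h i)⁻¹ := if_pos hi
      rw [h1, map_mul, map_mul, hfi', h2, lift_eq_self_of_mem_genBy hf' (hg i hi),
        lift_eq_self_of_mem_genBy hf' (hh i hi)]
      group
    · rw [hf i hi, hfi', hf' i hi]
  · refine FreeGroup.ext_hom _ _ fun i => ?_
    rw [MonoidHom.comp_apply, hfi', MonoidHom.id_apply]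
    by_cases hi : i ∈ T
    · have h1 : f i = g i * FreeGroup.of i * h i := if_pos hi
      have h2 : f' i = (g i)⁻¹ * FreeGroup.of i * (h i)⁻¹ := if_pos hi
      rw [h2, map_mul, map_mul, map_inv, map_inv, hfi, h1,
        lift_eq_self_of_mem_genBy hf (hg i hi), lift_eq_self_of_mem_genBy hf (hh i hi)]
      group
    · rw [hf' i hi, hfi, hf i hi]

theorem exists_mulEquiv_eq_on_genBy {T : Set I} {φ : FreeGroup I ≃* FreeGroup I}
    {ψ : FreeGroup I →* FreeGroup I} (h : ∀ i ∈ T, φ (FreeGroup.of i) = ψ (FreeGroup.of i))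
    {g : FreeGroup I} (hg : g ∈ genBy T) : φ g = ψ g := by
  induction hg using Subgroup.closure_induction with
  | mem x hx =>
    obtain ⟨i, hi, rfl⟩ := hx
    exact h i hi
  | one => rw [map_one, map_one]
  | mul x y _ _ hx hy => rw [map_mul, map_mul, hx, hy]
  | inv x _ hx => rw [map_inv, map_inv, hx]

theorem exists_transvection [DecidableEq I] (x : I × Bool) {g h : FreeGroup I}
    (hg : g ∈ genBy {x.1}ᶜ) (hh : h ∈ genBy {x.1}ᶜ) :
    ∃ φ : FreeGroup I ≃* FreeGroup I,
      φ (FreeGroup.mk [x]) = g * FreeGroup.mk [x] * h ∧ ∀ z ∈ genBy {x.1}ᶜ, φ z = z := by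
  obtain ⟨i, b⟩ := x
  cases b
  · obtain ⟨φ, hφ⟩ := exists_shear {i} (fun _ => h⁻¹) (fun _ => g⁻¹) (fun _ _ => inv_mem hh)
      fun _ _ => inv_mem hg
    refine ⟨φ, ?_, fun z hz => exists_mulEquiv_eq_on_genBy (ψ := MonoidHom.id _) ?_ hz⟩
    · rw [mk_singleton, if_neg (by simp), map_inv, hφ, if_pos (Set.mem_singleton _)]
      group
    · intro j hj
      rw [hφ, if_neg hj]
      rfl
  · obtain ⟨φ, hφ⟩ := exists_shear {i} (fun _ => g) (fun _ => h) (fun _ _ => hg) fun _ _ => hh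
    refine ⟨φ, ?_, fun z hz => exists_mulEquiv_eq_on_genBy (ψ := MonoidHom.id _) ?_ hz⟩
    · rw [mk_singleton, if_pos rfl, hφ, if_pos (Set.mem_singleton _)]
    · intro j hj
      rw [hφ, if_neg hj]
      rfl

theorem exists_partialConj [DecidableEq I] (T : Set I) [DecidablePred (· ∈ T)] {g : FreeGroup I}
    (hg : g ∈ genBy Tᶜ) : ∃ φ : FreeGroup I ≃* FreeGroup I,
      (∀ z ∈ genBy T, φ z = g * z * g⁻¹) ∧ ∀ z ∈ genBy Tᶜ, φ z = z := by
  obtain ⟨φ, hφ⟩ := exists_shear T (fun _ => g) (fun _ => g⁻¹) (fun _ _ => hg)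
    fun _ _ => inv_mem hg
  refine ⟨φ, fun z hz => exists_mulEquiv_eq_on_genBy (ψ := (MulAut.conj g).toMonoidHom) ?_ hz,
    fun z hz => exists_mulEquiv_eq_on_genBy (ψ := MonoidHom.id _) ?_ hz⟩
  · intro i hi
    rw [hφ, if_pos hi]
    rfl
  · intro i hi
    rw [hφ, if_neg hi]
    rfl

end Automorphisms

section Whitehead

variable {I : Type}

/-- The inverse of a signed letter. -/
def invLetter (y : I × Bool) : I × Bool :=
  (y.1, !y.2)

theorem invLetter_invLetter (y : I × Bool) : invLetter (invLetter y) = y := by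
  simp [invLetter]

theorem invLetter_ne (y : I × Bool) : invLetter y ≠ y := by
  obtain ⟨i, _ | _⟩ := y <;> simp [invLetter]

theorem mk_invLetter (y : I × Bool) :
    FreeGroup.mk [invLetter y] = (FreeGroup.mk [y])⁻¹ :=
  mk_singleton_not _ _

theorem eq_or_eq_invLetter_iff (y a : I × Bool) : y = a ∨ y = invLetter a ↔ y.1 = a.1 := by
  obtain ⟨i, _ | _⟩ := y <;> obtain ⟨j, _ | _⟩ := a <;> simp [invLetter]

variable [DecidableEq I]

theorem exists_whitehead (a : I × Bool) (Z : Set (I × Bool)) [DecidablePred (· ∈ Z)]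
    (ha : a ∈ Z) (ha' : invLetter a ∉ Z) : ∃ φ : FreeGroup I ≃* FreeGroup I,
      ∀ y : I × Bool, φ (FreeGroup.mk [y]) =
        (if invLetter y ∈ Z then FreeGroup.mk [a] else 1)⁻¹ *
          (if y.1 = a.1 then 1 else FreeGroup.mk [y]) *
            (if y ∈ Z then FreeGroup.mk [a] else 1) := by
  have hmem : ∀ i ∈ ({a.1}ᶜ : Set I), ∀ b, (if (i, b) ∈ Z then FreeGroup.mk [a] else 1) ∈
      genBy ({a.1}ᶜ : Set I)ᶜ := by
    intro i _ b
    split_ifs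
    · exact mk_mem_genBy (by simp)
    · exact one_mem _
  obtain ⟨φ, hφ⟩ := exists_shear {a.1}ᶜ
    (fun i => (if (i, false) ∈ Z then FreeGroup.mk [a] else 1)⁻¹)
    (fun i => if (i, true) ∈ Z then FreeGroup.mk [a] else 1)
    (fun i hi => inv_mem (hmem i hi false)) (fun i hi => hmem i hi true)
  refine ⟨φ, fun y => ?_⟩
  have hfix : φ (FreeGroup.mk [a]) = FreeGroup.mk [a] := by
    refine exists_mulEquiv_eq_on_genBy (ψ := MonoidHom.id _) (T := {a.1}) ?_
      (mk_mem_genBy (by simp))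
    intro i hi
    rw [hφ, if_neg (by simpa using hi)]
    rfl
  by_cases hy : y.1 = a.1
  · rw [if_pos hy]
    rcases (eq_or_eq_invLetter_iff y a).2 hy with rfl | rfl
    · rw [if_neg ha', if_pos ha, hfix]
      simp
    · rw [invLetter_invLetter, if_neg ha', if_pos ha, mk_invLetter, map_inv, hfix]
      simp
  · rw [if_neg hy]
    obtain ⟨i, b⟩ := y
    have h1 := hφ i
    rw [if_pos (by simpa using hy)] at h1
    cases b
    · have h2 : FreeGroup.mk [(i, false)] = (FreeGroup.of i)⁻¹ := mk_singleton_not i true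
      rw [h2, map_inv, h1]
      change _ = (if (i, true) ∈ Z then FreeGroup.mk [a] else 1)⁻¹ * (FreeGroup.of i)⁻¹ * _
      group
    · exact h1

end Whitehead

section CyclicWord

variable {I : Type} {ℓ : ℕ}

/-- The product of the first `n` letters of the cyclic word `a`. -/
def partialProd (a : ZMod ℓ → I × Bool) : ℕ → FreeGroup I
  | 0 => 1
  | n + 1 => partialProd a n * FreeGroup.mk [a n]

theorem sum_range_zmod {M : Type} [AddCommMonoid M] [NeZero ℓ] (f : ZMod ℓ → M) :
    ∑ i ∈ Finset.range ℓ, f i = ∑ j, f j := by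
  obtain ⟨m, rfl⟩ := Nat.exists_eq_succ_of_ne_zero (NeZero.ne ℓ)
  rw [← Fin.sum_univ_eq_sum_range (fun i => f (i : ℕ))]
  refine Finset.sum_congr rfl fun j _ => ?_
  exact congrArg f (ZMod.natCast_zmod_val (n := m + 1) j)

variable [DecidableEq I] {a : ZMod ℓ → I × Bool}

theorem norm_whitehead_le (b : I × Bool) (Z : Set (I × Bool)) [DecidablePred (· ∈ Z)]
    {φ : FreeGroup I ≃* FreeGroup I}
    (hφ : ∀ y : I × Bool, φ (FreeGroup.mk [y]) =
        (if invLetter y ∈ Z then FreeGroup.mk [b] else 1)⁻¹ *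
          (if y.1 = b.1 then 1 else FreeGroup.mk [y]) *
            (if y ∈ Z then FreeGroup.mk [b] else 1)) (n : ℕ) :
    ((if invLetter (a 0) ∈ Z then FreeGroup.mk [b] else 1) * φ (partialProd a n) *
      (if invLetter (a n) ∈ Z then FreeGroup.mk [b] else 1)⁻¹).norm ≤
    ∑ i ∈ Finset.range n, ((if (a i).1 = b.1 then 0 else 1) +
      if (a i ∈ Z ↔ invLetter (a (i + 1)) ∈ Z) then 0 else 1) := by
  have h1 : ∀ y : I × Bool, (FreeGroup.mk [y]).norm ≤ 1 := fun y => FreeGroup.norm_mk_le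
  induction n with
  | zero => simp [partialProd]
  | succ n ih =>
    rw [Finset.sum_range_succ, partialProd, map_mul, hφ]
    have h2 : (if (a n).1 = b.1 then 1 else FreeGroup.mk [a n]).norm ≤
        if (a n).1 = b.1 then 0 else 1 := by
      split_ifs
      · simp
      · exact h1 _
    have h3 : ((if a n ∈ Z then FreeGroup.mk [b] else 1) *
        (if invLetter (a (n + 1)) ∈ Z then FreeGroup.mk [b] else 1)⁻¹).norm ≤
        if (a n ∈ Z ↔ invLetter (a (n + 1)) ∈ Z) then 0 else 1 := by
      by_cases h4 : a n ∈ Z <;> by_cases h5 : invLetter (a (n + 1)) ∈ Z <;>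
        simp only [h4, h5, if_true, if_false, mul_inv_cancel, one_mul, mul_one, inv_one,
          FreeGroup.norm_one, FreeGroup.norm_inv_eq, le_refl, iff_true, iff_false, not_true,
          iff_self]
      · exact h1 b
      · exact h1 b
    rw [Nat.cast_add, Nat.cast_one]
    refine le_trans ?_ (add_le_add ih (add_le_add h2 h3))
    refine le_trans (le_of_eq (congrArg FreeGroup.norm ?_))
      ((FreeGroup.norm_mul_le _ _).trans (add_le_add_right (FreeGroup.norm_mul_le _ _) _))
    group

variable [NeZero ℓ] (hmin : ∀ φ : FreeGroup I ≃* FreeGroup I, ℓ ≤ (φ (partialProd a ℓ)).norm)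

include hmin

theorem le_sum_whitehead (b : I × Bool) (Z : Set (I × Bool)) [DecidablePred (· ∈ Z)]
    (hb : b ∈ Z) (hb' : invLetter b ∉ Z) :
    ℓ ≤ ∑ j, ((if (a j).1 = b.1 then 0 else 1) +
      if (a j ∈ Z ↔ invLetter (a (j + 1)) ∈ Z) then 0 else 1) := by
  obtain ⟨φ, hφ⟩ := exists_whitehead b Z hb hb'
  have h1 := norm_whitehead_le (a := a) b Z hφ ℓ
  rw [sum_range_zmod (fun j : ZMod ℓ => (if (a j).1 = b.1 then 0 else 1) +
      if (a j ∈ Z ↔ invLetter (a (j + 1)) ∈ Z) then 0 else 1)] at h1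
  refine le_trans (hmin (φ.trans (MulAut.conj
    (if invLetter (a 0) ∈ Z then FreeGroup.mk [b] else 1)))) (le_trans (le_of_eq ?_) h1)
  rw [ZMod.natCast_self]
  rfl

theorem whitehead_cut (b : I × Bool) (Z : Set (I × Bool)) (hb : b ∈ Z) (hb' : invLetter b ∉ Z)
    (h : ∀ j, ¬(a j ∈ Z ↔ invLetter (a (j + 1)) ∈ Z) → a j = b ∨ invLetter (a (j + 1)) = b)
    (j : ZMod ℓ) : (a j = b → invLetter (a (j + 1)) ∉ Z) ∧
      (invLetter (a (j + 1)) = b → a j ∉ Z) := by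
  classical
  have h1 := le_sum_whitehead hmin b Z hb hb'
  have h2 : ∀ j, (if (a j).1 = b.1 then 0 else 1) + ((if a j = b then 1 else 0) +
      if invLetter (a j) = b then 1 else 0) = 1 := by
    intro j
    have h3 := eq_or_eq_invLetter_iff (a j) b
    have h4 : invLetter (a j) = b ↔ a j = invLetter b := by
      constructor
      · rintro rfl
        rw [invLetter_invLetter]
      · intro h
        rw [h, invLetter_invLetter]
    have h5 := invLetter_ne b
    by_cases h6 : a j = b <;> by_cases h7 : a j = invLetter b
    · exact absurd (h7.symm.trans h6) h5
    all_goals simp_all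
  have h3 : ∑ j, (if invLetter (a (j + 1)) = b then 1 else 0) =
      ∑ j, (if invLetter (a j) = b then 1 else 0) :=
    Equiv.sum_comp (Equiv.addRight (1 : ZMod ℓ)) fun j => if invLetter (a j) = b then 1 else 0
  have h4 : ∑ j, ((if (a j).1 = b.1 then 0 else 1) + ((if a j = b then 1 else 0) +
      if invLetter (a j) = b then 1 else 0)) = ℓ := by
    simp [h2, ZMod.card]
  simp only [Finset.sum_add_distrib] at h1 h4
  have h5 : ∑ j, ((if a j = b then 1 else 0) + if invLetter (a (j + 1)) = b then 1 else 0) ≤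
      ∑ j, if (a j ∈ Z ↔ invLetter (a (j + 1)) ∈ Z) then 0 else 1 := by
    rw [Finset.sum_add_distrib, h3]
    omega
  have h6 : ∀ j, (if (a j ∈ Z ↔ invLetter (a (j + 1)) ∈ Z) then 0 else 1) ≤
      (if a j = b then 1 else 0) + if invLetter (a (j + 1)) = b then 1 else 0 := by
    intro j
    by_cases h7 : (a j ∈ Z ↔ invLetter (a (j + 1)) ∈ Z)
    · simp [h7]
    · rw [if_neg h7]
      rcases h j h7 with h8 | h8
      · rw [if_pos h8]
        exact Nat.le_add_right _ _
      · rw [if_pos h8]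
        exact Nat.le_add_left _ _
  have h7 := (Finset.sum_eq_sum_iff_of_le fun j _ => h6 j).1
    (le_antisymm (Finset.sum_le_sum fun j _ => h6 j) h5) j (Finset.mem_univ j)
  constructor
  · intro h8 h9
    rw [if_pos (iff_of_true (h8 ▸ hb) h9), if_pos h8] at h7
    omega
  · intro h8 h9
    rw [if_pos (iff_of_true h9 (h8 ▸ hb)), if_pos h8] at h7
    omega

theorem invLetter_succ_ne (j : ZMod ℓ) : invLetter (a (j + 1)) ≠ a j := fun h1 =>
  (whitehead_cut hmin (a j) {a j} rfl (invLetter_ne _) (fun i h2 => by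
    simp only [Set.mem_singleton_iff] at h2
    tauto) j).1 rfl h1

variable (happ : ∀ i, ∃ j, (a j).1 = i)

include happ

theorem false_of_disconnected {b c : I × Bool} {C : Set (I × Bool)} (hc : c ∈ C) (hb : b ∉ C)
    (hb' : invLetter b ∉ C) (hC : ∀ j, a j ≠ b → invLetter (a (j + 1)) ≠ b →
      (a j ∈ C ↔ invLetter (a (j + 1)) ∈ C)) : False := by
  have h1 := whitehead_cut hmin b (insert b C) (Set.mem_insert _ _)
    (by simp [invLetter_ne, hb']) (fun j h2 => by
      by_contra! h3
      simp only [Set.mem_insert_iff, h3.1, h3.2, false_or] at h2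
      exact h2 (hC j h3.1 h3.2))
  have h2 : ∀ j, (a j ∈ C ↔ invLetter (a (j + 1)) ∈ C) := by
    intro j
    by_cases h3 : a j = b
    · have h4 := (h1 j).1 h3
      rw [Set.mem_insert_iff, not_or] at h4
      exact iff_of_false (h3 ▸ hb) h4.2
    · by_cases h4 : invLetter (a (j + 1)) = b
      · have h5 := (h1 j).2 h4
        rw [Set.mem_insert_iff, not_or] at h5
        exact iff_of_false h5.2 (h4 ▸ hb)
      · exact hC j h3 h4
  have h3 : ∀ y ∈ C, invLetter y ∈ C := by
    intro y hy
    by_contra hy'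
    obtain ⟨j, hj⟩ := happ y.1
    have h4 := whitehead_cut hmin y C hy hy' fun j h5 => absurd (h2 j) h5
    rcases (eq_or_eq_invLetter_iff _ _).2 hj with h5 | h5
    · exact (h4 j).1 h5 ((h2 j).1 (h5 ▸ hy))
    · have h6 := h4 (j - 1)
      have h7 := h2 (j - 1)
      rw [sub_add_cancel, h5, invLetter_invLetter] at h6 h7
      exact h6.2 rfl (h7.2 hy)
  have h4 : ∀ y, invLetter y ∈ C ↔ y ∈ C := fun y =>
    ⟨fun h => invLetter_invLetter y ▸ h3 _ h, h3 y⟩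
  have h5 : ∀ y z : I × Bool, y.1 = z.1 → (y ∈ C ↔ z ∈ C) := by
    intro y z h
    rcases (eq_or_eq_invLetter_iff _ _).2 h with rfl | rfl
    · rfl
    · exact h4 z
  have h6 : ∀ j, a j ∈ C ↔ a 0 ∈ C := by
    have h7 : ∀ n : ℕ, a n ∈ C ↔ a 0 ∈ C := by
      intro n
      induction n with
      | zero => simp
      | succ n ih => rw [Nat.cast_add, Nat.cast_one, ← h4, ← h2, ih]
    intro j
    rw [← ZMod.natCast_zmod_val j]
    exact h7 _
  obtain ⟨j, hj⟩ := happ b.1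
  obtain ⟨i, hi⟩ := happ c.1
  rw [← h5 _ _ hj, h6 j, ← h6 i, h5 _ _ hi] at hb
  exact hb hc

theorem mem_of_connected {b c : I × Bool} {C : Set (I × Bool)} (hc : c ∈ C) (hb : b ∉ C)
    (hC : ∀ j, a j ≠ b → invLetter (a (j + 1)) ≠ b → (a j ∈ C ↔ invLetter (a (j + 1)) ∈ C))
    {v : I × Bool} (hv : v ≠ b) : v ∈ C := by
  by_contra hvC
  by_cases h1 : invLetter b ∈ C
  · refine false_of_disconnected hmin happ (C := {y | y ≠ b ∧ y ∉ C}) ⟨hv, hvC⟩ (b := b)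
      (fun h => h.1 rfl) (fun h => h.2 h1) fun j h2 h3 => ?_
    exact and_congr (iff_of_true h2 h3) (not_congr (hC j h2 h3))
  · exact false_of_disconnected hmin happ hc hb h1 hC

theorem mem_of_connected_inv {b c : I × Bool} {C : Set (I × Bool)} (hc : c ∈ C) (hb : b ∉ C)
    (hC : ∀ j, a (j + 1) ≠ b → invLetter (a j) ≠ b → (a (j + 1) ∈ C ↔ invLetter (a j) ∈ C))
    {v : I × Bool} (hv : v ≠ b) : v ∈ C := by
  have h0 : ∀ y z : I × Bool, invLetter y = invLetter z ↔ y = z := fun y z =>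
    ⟨fun h => by rw [← invLetter_invLetter y, h, invLetter_invLetter], fun h => h ▸ rfl⟩
  have h1 := mem_of_connected hmin happ (b := invLetter b) (c := invLetter c)
    (C := {y | invLetter y ∈ C}) (by simpa [invLetter_invLetter] using hc)
    (by simpa [invLetter_invLetter] using hb) (fun j h2 h3 => ?_) (v := invLetter v)
    (fun h => hv ((h0 _ _).1 h))
  · simpa [invLetter_invLetter] using h1
  · simp only [Set.mem_ofPred_eq, invLetter_invLetter]
    refine (hC j (fun h => h3 (h ▸ rfl)) fun h => h2 ?_).symm
    rw [← h, invLetter_invLetter]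

end CyclicWord

section Circulation

variable {I k : Type} {ℓ : ℕ} [DecidableEq I] [Fintype I] [Field k] [NeZero ℓ]

/-- The boundary map of the graph whose vertices are the signed letters and whose edges are the
positions of the cyclic word `a`: the position `j` leads from `(a (j - 1))⁻¹` to `a j`. -/
def cyclicBoundary (k : Type) [Field k] (a : ZMod ℓ → I × Bool) :
    (ZMod ℓ → k) →ₗ[k] (I × Bool → k) :=
  ∑ j, ((LinearMap.single k (fun _ => k) (a j)).comp (LinearMap.proj j) -
    (LinearMap.single k (fun _ => k) (invLetter (a j))).comp (LinearMap.proj (j + 1)))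

variable {a : ZMod ℓ → I × Bool}

omit [Fintype I] in
theorem cyclicBoundary_eq (s : ZMod ℓ → k) : cyclicBoundary k a s =
    ∑ j, (Pi.single (a j) (s j) - Pi.single (invLetter (a j)) (s (j + 1))) := by
  rw [cyclicBoundary, LinearMap.sum_apply]
  rfl

omit [Fintype I] in
theorem cyclicBoundary_apply (s : ZMod ℓ → k) (v : I × Bool) : cyclicBoundary k a s v =
    ∑ j, ((if a j = v then s j else 0) - if invLetter (a j) = v then s (j + 1) else 0) := by
  rw [cyclicBoundary_eq, Finset.sum_apply]
  refine Finset.sum_congr rfl fun j _ => ?_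
  simp only [Pi.sub_apply, Pi.single_apply, eq_comm]

theorem sum_cyclicBoundary (s : ZMod ℓ → k) : ∑ v, cyclicBoundary k a s v = 0 := by
  simp only [cyclicBoundary_apply]
  rw [Finset.sum_comm]
  simp only [Finset.sum_sub_distrib, Finset.sum_ite_eq, Finset.mem_univ, if_true]
  rw [sub_eq_zero]
  exact (Equiv.sum_comp (Equiv.addRight (1 : ZMod ℓ)) s).symm

theorem exists_circulation_ne_zero (h : Fintype.card (I × Bool) < ℓ) (v₀ : I × Bool) :
    ∃ s : ZMod ℓ → k, cyclicBoundary k a s = 0 ∧ s 0 = 0 ∧ s ≠ 0 := by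
  let T : (ZMod ℓ → k) →ₗ[k] (I × Bool → k) := LinearMap.pi fun v =>
    if v = v₀ then LinearMap.proj 0 else (LinearMap.proj v).comp (cyclicBoundary k a)
  have h1 : LinearMap.ker T ≠ ⊥ := by
    refine LinearMap.ker_ne_bot_of_finrank_lt ?_
    rw [Module.finrank_fintype_fun_eq_card, Module.finrank_fintype_fun_eq_card, ZMod.card]
    exact h
  obtain ⟨s, hs, hs0⟩ := Submodule.exists_mem_ne_zero_of_ne_bot h1
  have h2 : ∀ v, T s v = if v = v₀ then s 0 else cyclicBoundary k a s v := by
    intro v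
    by_cases hv : v = v₀ <;> simp [T, hv]
  have h3 : ∀ v ≠ v₀, cyclicBoundary k a s v = 0 := by
    intro v hv
    rw [← if_neg (c := v = v₀) (t := s 0) (e := cyclicBoundary k a s v) hv, ← h2, hs]
    rfl
  refine ⟨s, funext fun v => ?_, ?_, hs0⟩
  · by_cases hv : v = v₀
    · have h4 := sum_cyclicBoundary (a := a) s
      rw [Finset.sum_eq_single v₀ (fun v _ hv => h3 v hv) (by simp)] at h4
      rw [hv, h4, Pi.zero_apply]
    · exact h3 v hv
  · have h4 := h2 v₀
    rw [if_pos rfl, hs] at h4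
    exact h4.symm

variable (hmin : ∀ φ : FreeGroup I ≃* FreeGroup I, ℓ ≤ (φ (partialProd a ℓ)).norm)
  (happ : ∀ i, ∃ j, (a j).1 = i)

include hmin happ

theorem exists_circulation_extending (y : I × Bool) {t : ZMod ℓ → k}
    (ht : cyclicBoundary k a t y = 0) : ∃ s : ZMod ℓ → k, cyclicBoundary k a s = 0 ∧
      (∀ j, a j = y → s j = t j) ∧ ∀ j, invLetter (a j) = y → s (j + 1) = t (j + 1) := by
  let W : Submodule k (ZMod ℓ → k) :=
    { carrier := {w | (∀ j, a j = y → w j = 0) ∧ ∀ j, invLetter (a j) = y → w (j + 1) = 0}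
      zero_mem' := ⟨fun _ _ => rfl, fun _ _ => rfl⟩
      add_mem' := fun {v w} hv hw =>
        ⟨fun j hj => by rw [Pi.add_apply, hv.1 j hj, hw.1 j hj, add_zero],
          fun j hj => by rw [Pi.add_apply, hv.2 j hj, hw.2 j hj, add_zero]⟩
      smul_mem' := fun c w hw =>
        ⟨fun j hj => by rw [Pi.smul_apply, hw.1 j hj, smul_zero],
          fun j hj => by rw [Pi.smul_apply, hw.2 j hj, smul_zero]⟩ }
  have key : cyclicBoundary k a t ∈ W.map (cyclicBoundary k a) := by
    by_contra hn
    obtain ⟨f, hf, hfW⟩ := Submodule.exists_le_ker_of_notMem hn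
    refine hf ?_
    let c : I × Bool → k := fun v => f (Pi.single v 1)
    have hfc : ∀ z, f z = ∑ v, z v * c v := by
      intro z
      conv_lhs => rw [← Finset.univ_sum_single z]
      rw [map_sum]
      refine Finset.sum_congr rfl fun v _ => ?_
      rw [← smul_eq_mul, ← map_smul, ← Pi.single_smul, smul_eq_mul, mul_one]
    have hedge : ∀ j, a (j + 1) ≠ y → invLetter (a j) ≠ y →
        c (a (j + 1)) = c (invLetter (a j)) := by
      intro j h1 h2
      have h3 : (Pi.single (j + 1) 1 : ZMod ℓ → k) ∈ W := by
        refine ⟨fun i hi => ?_, fun i hi => ?_⟩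
        · refine Pi.single_eq_of_ne ?_ _
          rintro rfl
          exact h1 hi
        · refine Pi.single_eq_of_ne ?_ _
          intro h
          rw [add_right_cancel h] at hi
          exact h2 hi
      have h4 : f (cyclicBoundary k a (Pi.single (j + 1) 1)) = 0 := hfW ⟨_, h3, rfl⟩
      rw [cyclicBoundary_eq, Finset.sum_sub_distrib, map_sub, sub_eq_zero,
        Finset.sum_eq_single (j + 1), Finset.sum_eq_single j] at h4
      · simpa using h4
      · intro i _ hi
        rw [Pi.single_eq_of_ne (fun h => hi (add_right_cancel h)), Pi.single_zero]
      · simp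
      · intro i _ hi
        rw [Pi.single_eq_of_ne hi, Pi.single_zero]
      · simp
    have hconst : ∀ v ≠ y, c v = c (invLetter y) := by
      intro v hv
      refine (mem_of_connected_inv hmin happ (b := y) (c := invLetter y)
        (C := {v | v ≠ y ∧ c v = c (invLetter y)}) ⟨invLetter_ne y, rfl⟩ (fun h => h.1 rfl)
        (fun j h1 h2 => ?_) hv).2
      refine and_congr (iff_of_true h1 h2) ?_
      rw [hedge j h1 h2]
    rw [hfc]
    have h1 : ∀ v, cyclicBoundary k a t v * c v = cyclicBoundary k a t v * c (invLetter y) := by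
      intro v
      by_cases hv : v = y
      · rw [hv, ht, zero_mul, zero_mul]
      · rw [hconst v hv]
    simp only [h1]
    rw [← Finset.sum_mul, sum_cyclicBoundary, zero_mul]
  obtain ⟨w, hw, hwt⟩ := key
  refine ⟨t - w, by rw [map_sub, hwt, sub_self], fun j hj => ?_, fun j hj => ?_⟩
  · rw [Pi.sub_apply, hw.1 j hj, sub_zero]
  · rw [Pi.sub_apply, hw.2 j hj, sub_zero]

theorem exists_translate_circulation {s : ZMod ℓ → k} (hs : cyclicBoundary k a s = 0)
    (y : I × Bool) : ∃ s' : ZMod ℓ → k, cyclicBoundary k a s' = 0 ∧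
      (∀ j, a j = y → s' j = s (j + 1)) ∧ ∀ j, invLetter (a j) = y → s' (j + 1) = s j := by
  have hloop := invLetter_succ_ne hmin
  have hinv : ∀ y z : I × Bool, invLetter y = invLetter z ↔ y = z := fun y z =>
    ⟨fun h => by rw [← invLetter_invLetter y, h, invLetter_invLetter], fun h => h ▸ rfl⟩
  let t : ZMod ℓ → k := fun j => if a j = y then s (j + 1) else s (j - 1)
  have ht1 : ∀ j, a j = y → t j = s (j + 1) := fun j hj => if_pos hj
  have ht2 : ∀ j, invLetter (a j) = y → t (j + 1) = s j := by
    intro j hj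
    have h1 : a (j + 1) ≠ y := by
      rintro rfl
      refine hloop j ?_
      rw [← hj, invLetter_invLetter]
    change (if _ then _ else _) = _
    rw [if_neg h1, add_sub_cancel_right]
  have ht : cyclicBoundary k a t y = 0 := by
    have h1 := congrFun hs (invLetter y)
    rw [Pi.zero_apply, cyclicBoundary_apply] at h1
    rw [cyclicBoundary_apply]
    refine neg_eq_zero.1 (Eq.trans ?_ h1)
    rw [← Finset.sum_neg_distrib]
    refine Finset.sum_congr rfl fun j _ => ?_
    rw [neg_sub]
    congr 1
    · have h2 : a j = invLetter y ↔ invLetter (a j) = y := by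
        rw [← hinv, invLetter_invLetter]
      by_cases h3 : invLetter (a j) = y
      · rw [if_pos h3, if_pos (h2.2 h3), ht2 j h3]
      · rw [if_neg h3, if_neg (h3 ∘ h2.1)]
    · simp only [hinv]
      by_cases h3 : a j = y
      · rw [if_pos h3, if_pos h3, ht1 j h3]
      · rw [if_neg h3, if_neg h3]
  obtain ⟨s', h1, h2, h3⟩ := exists_circulation_extending hmin happ y ht
  exact ⟨s', h1, fun j hj => (h2 j hj).trans (ht1 j hj), fun j hj => (h3 j hj).trans (ht2 j hj)⟩

omit hmin happ [Fintype I] [NeZero ℓ] in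
theorem toWord_mk_singleton_mul (y : I × Bool) (h : FreeGroup I) :
    (FreeGroup.mk [y] * h).toWord = y :: h.toWord ∨
      h.toWord = invLetter y :: (FreeGroup.mk [y] * h).toWord := by
  have h1 : FreeGroup.mk [y] * h = FreeGroup.mk (y :: h.toWord) := by
    conv_lhs => rw [← FreeGroup.mk_toWord (x := h), FreeGroup.mul_mk]
    rfl
  rw [h1, FreeGroup.toWord_mk, FreeGroup.reduce.cons, FreeGroup.reduce_toWord]
  cases h.toWord with
  | nil => exact Or.inl rfl
  | cons z L =>
    by_cases h2 : y.1 = z.1 ∧ y.2 = !z.2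
    · right
      simp only [h2, and_self, if_true]
      congr 1
      obtain ⟨i, b⟩ := z
      simp [invLetter, h2.1, h2.2]
    · left
      simp only [h2, if_false]

theorem exists_state {s₀ : ZMod ℓ → k} (hs₀ : cyclicBoundary k a s₀ = 0) :
    ∃ S : FreeGroup I → ZMod ℓ → k, S 1 = s₀ ∧ (∀ h, cyclicBoundary k a (S h) = 0) ∧
      ∀ h (n : ℕ), S h n = S (partialProd a n * h) 0 := by
  choose E hE using fun (s : {s : ZMod ℓ → k // cyclicBoundary k a s = 0}) (y : I × Bool) =>
    exists_translate_circulation hmin happ s.2 y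
  let St : List (I × Bool) → {s : ZMod ℓ → k // cyclicBoundary k a s = 0} :=
    List.foldr (fun y s => ⟨E s y, (hE s y).1⟩) ⟨s₀, hs₀⟩
  have hSt : ∀ y L, (St (y :: L)).1 = E (St L) y := fun _ _ => rfl
  have hstep : ∀ j h, (St h.toWord).1 (j + 1) = (St (FreeGroup.mk [a j] * h).toWord).1 j := by
    intro j h
    rcases toWord_mk_singleton_mul (a j) h with h1 | h1
    · rw [h1, hSt]
      exact ((hE _ _).2.1 j rfl).symm
    · rw [h1, hSt]
      exact (hE _ _).2.2 j rfl
  refine ⟨fun h => (St h.toWord).1, ?_, fun h => (St h.toWord).2, fun h n => ?_⟩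
  · change (St (FreeGroup.toWord 1)).1 = s₀
    rw [FreeGroup.toWord_one]
    rfl
  · induction n generalizing h with
    | zero => simp [partialProd]
    | succ n ih => rw [partialProd, mul_assoc, ← ih, Nat.cast_add, Nat.cast_one]; exact hstep n h

end Circulation

section Length

variable {I k : Type} [DecidableEq I] [Fintype I] [Field k]

theorem length_le_card {L : List (I × Bool)} (hL : L ≠ [])
    (hmin : ∀ φ : FreeGroup I ≃* FreeGroup I, L.length ≤ (φ (FreeGroup.mk L)).norm)
    (happ : ∀ i, ∃ y ∈ L, y.1 = i)
    (hξ : ∀ ξ : FreeGroup I → k,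
      (∀ x g, wordSum L x (fun j => ξ (FreeGroup.mk (L.take j) * g)) = 0) → ∀ g g', ξ g = ξ g') :
    L.length ≤ Fintype.card (I × Bool) := by
  by_contra! hlt
  have hne : NeZero L.length := ⟨by simpa using hL⟩
  let a : ZMod L.length → I × Bool := fun j => L[j.val]'(ZMod.val_lt j)
  have ha : ∀ (n : ℕ) (hn : n < L.length), a n = L[n] := by
    intro n hn
    have h1 : (n : ZMod L.length).val = n := ZMod.val_cast_of_lt hn
    simp only [a, h1]
  have hpre : ∀ n ≤ L.length, partialProd a n = FreeGroup.mk (L.take n) := by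
    intro n hn
    induction n with
    | zero => rfl
    | succ n ih => rw [partialProd, ih (by omega), ha n hn, mk_take_succ L ⟨n, hn⟩]; rfl
  have hmin' : ∀ φ : FreeGroup I ≃* FreeGroup I, L.length ≤ (φ (partialProd a L.length)).norm := by
    intro φ
    rw [hpre _ le_rfl, List.take_length]
    exact hmin φ
  have happ' : ∀ i, ∃ j, (a j).1 = i := by
    intro i
    obtain ⟨y, hy, rfl⟩ := happ i
    obtain ⟨n, hn, rfl⟩ := List.getElem_of_mem hy
    exact ⟨n, by rw [ha n hn]⟩
  obtain ⟨s₀, h1, h2, h3⟩ := exists_circulation_ne_zero (k := k) (a := a) hlt (a 0)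
  obtain ⟨S, hS1, hS2, hS3⟩ := exists_state hmin' happ' h1
  have h4 := hξ (fun h => S h 0) fun x g => by
    have h5 := congrFun (hS2 g) (x, true)
    rw [cyclicBoundary_apply, Pi.zero_apply, ← sum_range_zmod (fun j : ZMod L.length =>
      (if a j = (x, true) then S g j else 0) -
        if invLetter (a j) = (x, true) then S g (j + 1) else 0),
      ← Fin.sum_univ_eq_sum_range (fun n : ℕ => (if a n = (x, true) then S g n else 0) -
        if invLetter (a n) = (x, true) then S g (n + 1) else 0)] at h5
    rw [← h5, wordSum]
    refine Finset.sum_congr rfl fun m _ => ?_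
    rw [ha m m.2]
    have h6 : S (FreeGroup.mk (L.take m) * g) 0 = S g (m : ℕ) := by
      rw [hS3, hpre m m.2.le]
    have h7 : S (FreeGroup.mk (L.take (m + 1)) * g) 0 = S g ((m : ℕ) + 1) := by
      rw [← Nat.cast_add_one, hS3, hpre (m + 1) m.2]
    simp only [Fin.val_castSucc, Fin.val_succ, h6, h7, Fin.getElem_fin]
    rcases hy : L[(m : ℕ)] with ⟨i, _ | _⟩ <;> by_cases hi : i = x <;> simp [invLetter, hi]
  refine h3 (funext fun j => ?_)
  rw [← ZMod.natCast_zmod_val j, ← hS1, hS3, Pi.zero_apply, ← h2, ← hS1]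
  exact h4 _ _

end Length

section Normalization

variable {I : Type}

/-- A product of commutators of signed letters. -/
def prodComm (C : List ((I × Bool) × (I × Bool))) : FreeGroup I :=
  (C.map fun z => ⁅FreeGroup.mk [z.1], FreeGroup.mk [z.2]⁆).prod

/-- The signed letters occurring in a product of commutators. -/
def commLetters (C : List ((I × Bool) × (I × Bool))) : List (I × Bool) :=
  C.flatMap fun z => [z.1, z.2, invLetter z.1, invLetter z.2]

theorem prodComm_mem_genBy {T : Set I} {C : List ((I × Bool) × (I × Bool))}
    (h : ∀ y ∈ commLetters C, y.1 ∈ T) : prodComm C ∈ genBy T := by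
  refine list_prod_mem fun g hg => ?_
  obtain ⟨z, hz, rfl⟩ := List.mem_map.1 hg
  have h1 : ∀ y ∈ [z.1, z.2, invLetter z.1, invLetter z.2], FreeGroup.mk [y] ∈ genBy T :=
    fun y hy => mk_mem_genBy fun y' hy' => h _ (List.mem_flatMap.2 ⟨z, hz, by
      rwa [List.mem_singleton.1 hy']⟩)
  rw [commutatorElement_def]
  exact mul_mem (mul_mem (mul_mem (h1 _ (by simp)) (h1 _ (by simp))) (inv_mem (h1 _ (by simp))))
    (inv_mem (h1 _ (by simp)))

theorem invLetter_mem_commLetters {C : List ((I × Bool) × (I × Bool))} {y : I × Bool}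
    (h : y ∈ commLetters C) : invLetter y ∈ commLetters C := by
  obtain ⟨z, hz, hy⟩ := List.mem_flatMap.1 h
  refine List.mem_flatMap.2 ⟨z, hz, ?_⟩
  simp only [List.mem_cons, List.not_mem_nil, or_false] at hy ⊢
  rcases hy with rfl | rfl | rfl | rfl
  · exact Or.inr (Or.inr (Or.inl rfl))
  · exact Or.inr (Or.inr (Or.inr rfl))
  · exact Or.inl (invLetter_invLetter _)
  · exact Or.inr (Or.inl (invLetter_invLetter _))

theorem mk_append (L L' : List (I × Bool)) :
    FreeGroup.mk (L ++ L') = FreeGroup.mk L * FreeGroup.mk L' :=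
  FreeGroup.mul_mk.symm

theorem mk_cons (y : I × Bool) (L : List (I × Bool)) :
    FreeGroup.mk (y :: L) = FreeGroup.mk [y] * FreeGroup.mk L :=
  mk_append [y] L

variable [DecidableEq I]

theorem exists_handle_step {x y : I × Bool} (hxy : x.1 ≠ y.1) {c P Q T S : FreeGroup I}
    (hP : P ∈ genBy {x.1, y.1}ᶜ) (hQ : Q ∈ genBy {x.1, y.1}ᶜ) (hT : T ∈ genBy {x.1, y.1}ᶜ)
    (hS : S ∈ genBy {x.1, y.1}ᶜ) (hc : c ∈ genBy {x.1, y.1}ᶜ) :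
    ∃ φ : FreeGroup I ≃* FreeGroup I,
      φ (c * (FreeGroup.mk [x] * P * FreeGroup.mk [y] * Q * (FreeGroup.mk [x])⁻¹ * T *
        (FreeGroup.mk [y])⁻¹ * S)) =
      c * ⁅FreeGroup.mk [x], FreeGroup.mk [y]⁆ * (T * Q * P * S) := by
  have hx : genBy ({x.1, y.1}ᶜ : Set I) ≤ genBy {x.1}ᶜ :=
    genBy_mono (Set.compl_subset_compl.2 (by simp))
  have hy : genBy ({x.1, y.1}ᶜ : Set I) ≤ genBy {y.1}ᶜ :=
    genBy_mono (Set.compl_subset_compl.2 (by simp))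
  have hM : T * Q * P ∈ genBy ({x.1, y.1}ᶜ : Set I) := mul_mem (mul_mem hT hQ) hP
  obtain ⟨φ, hφ, hφ'⟩ := exists_transvection x (one_mem _)
    (hx (mul_mem hM (inv_mem hP)))
  obtain ⟨ψ, hψ, hψ'⟩ := exists_transvection y (hy (inv_mem hM))
    (hy (mul_mem hM (inv_mem (mul_mem hQ hP))))
  have hYx : FreeGroup.mk [y] ∈ genBy ({x.1}ᶜ : Set I) := mk_mem_genBy (by simpa using hxy.symm)
  have hXy : FreeGroup.mk [x] ∈ genBy ({y.1}ᶜ : Set I) := mk_mem_genBy (by simpa using hxy)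
  refine ⟨φ.trans ψ, ?_⟩
  simp only [MulEquiv.trans_apply, map_mul, map_inv, hφ, hφ' _ hYx, hφ' _ (hx hP), hφ' _ (hx hQ),
    hφ' _ (hx hT), hφ' _ (hx hS), hφ' _ (hx hc), hψ, hψ' _ hXy, hψ' _ (hy hP), hψ' _ (hy hQ),
    hψ' _ (hy hT), hψ' _ (hy hS), hψ' _ (hy hc), map_one, commutatorElement_def]
  group

theorem exists_prodComm {u : FreeGroup I}
    (hu : ∀ (φ : FreeGroup I ≃* FreeGroup I) (i : I), φ u ∉ genBy {i}ᶜ) (n : ℕ)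
    {C : List ((I × Bool) × (I × Bool))} {R : List (I × Bool)} (hn : R.length ≤ n)
    (hnd : (commLetters C ++ R).Nodup) (hall : ∀ v, v ∈ commLetters C ++ R)
    {φ : FreeGroup I ≃* FreeGroup I} (hφ : φ u = prodComm C * FreeGroup.mk R) :
    ∃ (C' : List ((I × Bool) × (I × Bool))) (ψ : FreeGroup I ≃* FreeGroup I),
      (commLetters C').Nodup ∧ (∀ v, v ∈ commLetters C') ∧ ψ u = prodComm C' := by
  induction n generalizing C R φ with
  | zero =>
    have h1 : R = [] := List.length_eq_zero_iff.1 (Nat.le_zero.1 hn)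
    subst h1
    rw [List.append_nil] at hnd hall
    exact ⟨C, φ, hnd, hall, hφ.trans (mul_one _)⟩
  | succ n ih =>
    cases R with
    | nil =>
      rw [List.append_nil] at hnd hall
      exact ⟨C, φ, hnd, hall, hφ.trans (mul_one _)⟩
    | cons x R =>
      have hxC : x ∉ commLetters C := fun h =>
        (List.nodup_append.1 hnd).2.2 x h x List.mem_cons_self rfl
      have hxR : invLetter x ∈ R := by
        have h1 := hall (invLetter x)
        simp only [List.mem_append, List.mem_cons, invLetter_ne, false_or] at h1
        refine h1.resolve_left fun h => hxC ?_
        rw [← invLetter_invLetter x]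
        exact invLetter_mem_commLetters h
      obtain ⟨P₀, S₀, rfl⟩ := List.append_of_mem hxR
      by_cases hlink : ∃ y ∈ P₀, invLetter y ∈ S₀
      · obtain ⟨y, hyP, hyS⟩ := hlink
        obtain ⟨P, Q, rfl⟩ := List.append_of_mem hyP
        obtain ⟨T, S, rfl⟩ := List.append_of_mem hyS
        have hperm : (commLetters C ++ (x :: (P ++ y :: Q ++ invLetter x ::
            (T ++ invLetter y :: S)))).Perm ([x, y, invLetter x, invLetter y] ++
              (commLetters C ++ (T ++ Q ++ P ++ S))) := by
          rw [List.perm_iff_count]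
          intro z
          simp only [List.count_append, List.count_cons, List.count_nil]
          omega
        have hperm' : (commLetters (C ++ [(x, y)]) ++ (T ++ Q ++ P ++ S)).Perm
            ([x, y, invLetter x, invLetter y] ++ (commLetters C ++ (T ++ Q ++ P ++ S))) := by
          rw [List.perm_iff_count]
          intro z
          simp only [commLetters, List.flatMap_append, List.flatMap_cons, List.flatMap_nil,
            List.count_append, List.count_nil]
          omega
        have hnd' := hperm.nodup_iff.1 hnd
        have hxy : x.1 ≠ y.1 := by
          intro h
          rcases (eq_or_eq_invLetter_iff x y).2 h with h | h
          · simp [h] at hnd'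
          · simp [h] at hnd'
        have hrest : ∀ z ∈ commLetters C ++ (T ++ Q ++ P ++ S), z.1 ∈ ({x.1, y.1}ᶜ : Set I) := by
          intro z hz h
          have h1 : z ∈ [x, y, invLetter x, invLetter y] := by
            rcases h with h | h <;> rcases (eq_or_eq_invLetter_iff _ _).2 h with h | h <;> simp [h]
          exact (List.nodup_append.1 hnd').2.2 z h1 z hz rfl
        obtain ⟨ψ, hψ⟩ := exists_handle_step hxy
          (mk_mem_genBy (L := P) fun z hz => hrest z (by simp [hz]))
          (mk_mem_genBy (L := Q) fun z hz => hrest z (by simp [hz]))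
          (mk_mem_genBy (L := T) fun z hz => hrest z (by simp [hz]))
          (mk_mem_genBy (L := S) fun z hz => hrest z (by simp [hz]))
          (prodComm_mem_genBy (C := C) fun z hz => hrest z (by simp [hz]))
        refine ih (C := C ++ [(x, y)]) (R := T ++ Q ++ P ++ S) (φ := φ.trans ψ) ?_
          (hperm'.nodup_iff.2 hnd') (fun v => hperm'.mem_iff.2 (hperm.mem_iff.1 (hall v))) ?_
        · simp only [List.length_append, List.length_cons] at hn ⊢
          omega
        · have h1 : FreeGroup.mk (x :: (P ++ y :: Q ++ invLetter x :: (T ++ invLetter y :: S))) =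
              FreeGroup.mk [x] * FreeGroup.mk P * FreeGroup.mk [y] * FreeGroup.mk Q *
                (FreeGroup.mk [x])⁻¹ * FreeGroup.mk T * (FreeGroup.mk [y])⁻¹ * FreeGroup.mk S := by
            rw [mk_cons x, mk_append, mk_append, mk_cons y Q, mk_cons (invLetter x), mk_append T,
              mk_cons (invLetter y) S, mk_invLetter, mk_invLetter]
            simp only [mul_assoc]
          have h2 : prodComm (C ++ [(x, y)]) =
              prodComm C * ⁅FreeGroup.mk [x], FreeGroup.mk [y]⁆ := by
            simp [prodComm]
          rw [MulEquiv.trans_apply, hφ, h1, hψ, h2]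
          simp only [mk_append]
      · exfalso
        push Not at hlink
        classical
        have hdis : ∀ y ∈ P₀, y ∉ commLetters C ∧ y ≠ x ∧ y ≠ invLetter x ∧ y ∉ S₀ := by
          intro y hy
          have h1 : (commLetters C ++ x :: (P₀ ++ invLetter x :: S₀)).count y ≤ 1 :=
            List.nodup_iff_count_le_one.1 hnd y
          have h2 := List.count_pos_iff.2 hy
          simp only [List.count_append, List.count_cons] at h1
          refine ⟨fun h => ?_, ?_, ?_, fun h => ?_⟩
          · have := List.count_pos_iff.2 h
            omega
          · rintro rfl
            simp at h1
            omega
          · rintro rfl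
            simp at h1
            omega
          · have := List.count_pos_iff.2 h
            omega
        let T : Set I := {i | ∃ y ∈ P₀, y.1 = i}
        have hP : FreeGroup.mk P₀ ∈ genBy T := mk_mem_genBy fun y hy => ⟨y, hy, rfl⟩
        have hS : FreeGroup.mk S₀ ∈ genBy Tᶜ := by
          refine mk_mem_genBy fun z hz => ?_
          rintro ⟨y, hy, hyz⟩
          rcases (eq_or_eq_invLetter_iff _ _).2 hyz.symm with rfl | rfl
          · exact (hdis _ hy).2.2.2 hz
          · exact hlink y hy hz
        have hC : prodComm C ∈ genBy Tᶜ := by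
          refine prodComm_mem_genBy fun z hz => ?_
          rintro ⟨y, hy, hyz⟩
          rcases (eq_or_eq_invLetter_iff _ _).2 hyz with rfl | rfl
          · exact (hdis _ hy).1 hz
          · exact (hdis _ hy).1 (invLetter_mem_commLetters hz)
        have hX : FreeGroup.mk [x] ∈ genBy Tᶜ := by
          refine mk_mem_genBy fun z hz => ?_
          rw [List.mem_singleton.1 hz]
          rintro ⟨y, hy, hyz⟩
          rcases (eq_or_eq_invLetter_iff _ _).2 hyz with rfl | rfl
          · exact (hdis _ hy).2.1 rfl
          · exact (hdis _ hy).2.2.1 rfl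
        obtain ⟨ψ, hψ, hψ'⟩ := exists_partialConj T (inv_mem hX)
        refine hu (φ.trans ψ) x.1 ?_
        have h1 : (φ.trans ψ) u = prodComm C * (FreeGroup.mk P₀ * FreeGroup.mk S₀) := by
          rw [MulEquiv.trans_apply, hφ, mk_cons x, mk_append, mk_cons (invLetter x), mk_invLetter]
          simp only [map_mul, map_inv, hψ _ hP, hψ' _ hC, hψ' _ hX, hψ' _ hS]
          group
        have hne : ∀ z, z ∈ commLetters C ∨ z ∈ P₀ ∨ z ∈ S₀ → z.1 ∈ ({x.1}ᶜ : Set I) := by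
          intro z hz h
          have h2 := List.nodup_iff_count_le_one.1 hnd z
          have h3 : 0 < (commLetters C).count z + (P₀.count z + S₀.count z) := by
            rcases hz with hz | hz | hz <;> have := List.count_pos_iff.2 hz <;> omega
          simp only [List.count_append, List.count_cons] at h2
          rcases (eq_or_eq_invLetter_iff _ _).2 h with rfl | rfl
          · simp at h2
            omega
          · simp at h2
            omega
        rw [h1]
        exact mul_mem (prodComm_mem_genBy fun z hz => hne z (Or.inl hz))
          (mul_mem (mk_mem_genBy fun z hz => hne z (Or.inr (Or.inl hz)))
            (mk_mem_genBy fun z hz => hne z (Or.inr (Or.inr hz))))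

end Normalization

section Exponents

variable {I : Type} [DecidableEq I]

/-- The exponent sum of the basis element `i`, modulo `m`. -/
def exponentHom (m : ℕ) (i : I) : FreeGroup I →* Multiplicative (ZMod m) :=
  FreeGroup.lift fun i' => Multiplicative.ofAdd (if i' = i then 1 else 0)

theorem toAdd_exponentHom_mk (m : ℕ) (i : I) (L : List (I × Bool)) :
    (exponentHom m i (FreeGroup.mk L)).toAdd = L.count (i, true) - L.count (i, false) := by
  induction L with
  | nil => simp [← FreeGroup.one_eq_mk]
  | cons y L ih =>
    rw [mk_cons, map_mul, toAdd_mul, ih, mk_singleton]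
    obtain ⟨j, b⟩ := y
    cases b <;> by_cases h : j = i <;> simp [exponentHom, h] <;> ring

theorem mem_of_exponentHom_eq_one {i : I} {L : List (I × Bool)}
    (h : exponentHom (L.length + 1) i (FreeGroup.mk L) = 1) {y : I × Bool} (hy : y ∈ L)
    (hi : y.1 = i) (b : Bool) : (i, b) ∈ L := by
  rw [← toAdd_eq_zero, toAdd_exponentHom_mk, sub_eq_zero, ZMod.natCast_eq_natCast_iff] at h
  have hcount := Nat.ModEq.eq_of_lt_of_lt h (Nat.lt_succ_of_le List.count_le_length)
    (Nat.lt_succ_of_le List.count_le_length)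
  obtain ⟨j, c⟩ := y
  obtain rfl : j = i := hi
  have hpos := List.count_pos_iff.2 hy
  refine List.count_pos_iff.1 ?_
  cases b <;> cases c <;> omega

theorem exponentHom_of_mem_genBy {m : ℕ} {i : I} {g : FreeGroup I} (hg : g ∈ genBy {i}ᶜ) :
    exponentHom m i g = 1 := by
  have h : genBy ({i}ᶜ : Set I) ≤ (exponentHom m i).ker := by
    refine (Subgroup.closure_le _).2 ?_
    rintro _ ⟨j, hj, rfl⟩
    have hj' : j ≠ i := hj
    simp [exponentHom, MonoidHom.mem_ker, hj']
  exact h hg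

end Exponents

section Twin

variable {p q d : ℕ} {u : FreeGroup (Fin d × Bool)}

theorem IsTwin.map (hu : IsTwin p q u)
    (φ : FreeGroup (Fin d × Bool) ≃* FreeGroup (Fin d × Bool)) : IsTwin p q (φ u) := by
  intro Q _ _ hQ g
  rw [hu Q hQ g]
  have key : ∀ (φ : FreeGroup (Fin d × Bool) ≃* FreeGroup (Fin d × Bool)) (f : Fin d × Bool → Q),
      FreeGroup.lift (fun i => FreeGroup.lift f (φ (FreeGroup.of i))) =
        (FreeGroup.lift f).comp φ.toMonoidHom := by
    intro φ f
    ext i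
    simp
  have key' : ∀ (φ : FreeGroup (Fin d × Bool) ≃* FreeGroup (Fin d × Bool)) (f : Fin d × Bool → Q)
      (v : FreeGroup (Fin d × Bool)),
      FreeGroup.lift (fun i => FreeGroup.lift f (φ (FreeGroup.of i))) v =
        FreeGroup.lift f (φ v) := fun φ f v => by
    rw [key]
    rfl
  refine Nat.card_congr (Equiv.subtypeEquiv
    { toFun := fun f i => FreeGroup.lift f (φ.symm (FreeGroup.of i))
      invFun := fun f i => FreeGroup.lift f (φ (FreeGroup.of i))
      left_inv := fun f => by
        funext i
        simp only
        rw [key' φ.symm, MulEquiv.symm_apply_apply, FreeGroup.lift_apply_of]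
      right_inv := fun f => by
        funext i
        simp only
        rw [key' φ, MulEquiv.apply_symm_apply, FreeGroup.lift_apply_of] } fun f => ?_)
  simp only [Equiv.coe_fn_mk]
  rw [key' φ.symm, MulEquiv.symm_apply_apply]

theorem IsTwin.exponentHom_eq_one (hu : IsTwin p q u) (m : ℕ) [NeZero m] (i : Fin d × Bool) :
    exponentHom m i u = 1 := by
  refine lift_eq_one_of_measureEquivIn (hu (Multiplicative (ZMod m)) ?_)
    (fun f => lift_orientableRelator f) _
  refine ⟨⊥, ⊤, inferInstance, inferInstance, bot_le, IsPGroup.of_bot, ?_,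
    fun x => ⟨0, Subgroup.mem_top _⟩⟩
  intro a _ b _
  rw [commutatorElement_eq_one_iff_mul_comm.2 (mul_comm a b)]
  exact one_mem _

theorem IsTwin.notMem_genBy [Fact p.Prime] (hu : IsTwin p q u) (hq : 1 < q)
    (i : Fin d × Bool) : u ∉ genBy {i}ᶜ := by
  intro h
  obtain ⟨L, hL, hLi⟩ := exists_mk_eq_of_mem_genBy h
  have h1 := hu.eq_of_wordSum_eq_zero hq hL (ξ := fun g => (exponentHom p i g).toAdd)
    (fun x g => ?_) 1 (FreeGroup.of i)
  · simp [exponentHom] at h1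
  · have h2 : ∀ j : ℕ, exponentHom p i (FreeGroup.mk (L.take j) * g) = exponentHom p i g := by
      intro j
      rw [map_mul, exponentHom_of_mem_genBy
        (mk_mem_genBy fun y hy => hLi y (List.mem_of_mem_take hy)), one_mul]
    have h3 := map_wordSum (AddMonoidHom.mulLeft (exponentHom p i g).toAdd) L x
      (fun _ => (1 : ZMod p))
    rw [hu.wordSum_const hL, map_zero] at h3
    simp only [AddMonoidHom.coe_mulLeft, mul_one] at h3
    simp only [h2]
    exact h3.symm

theorem exists_min_norm {I : Type} [DecidableEq I] (u : FreeGroup I) :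
    ∃ φ : FreeGroup I ≃* FreeGroup I, ∀ ψ : FreeGroup I ≃* FreeGroup I,
      (φ u).norm ≤ (ψ (φ u)).norm := by
  let φ := Function.argmin fun φ : FreeGroup I ≃* FreeGroup I => (φ u).norm
  exact ⟨φ, fun ψ => Function.argmin_le (fun φ : FreeGroup I ≃* FreeGroup I => (φ u).norm)
    (φ.trans ψ)⟩

theorem IsTwin.exists_prodComm [Fact p.Prime] (hu : IsTwin p q u) (hq : 1 < q) (hd : 1 ≤ d) :
    ∃ (C : List (((Fin d × Bool) × Bool) × ((Fin d × Bool) × Bool)))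
      (ψ : FreeGroup (Fin d × Bool) ≃* FreeGroup (Fin d × Bool)),
      (commLetters C).Nodup ∧ (∀ v, v ∈ commLetters C) ∧ ψ u = prodComm C := by
  obtain ⟨φ, hφ⟩ := exists_min_norm u
  have hmk : FreeGroup.mk (φ u).toWord = φ u := FreeGroup.mk_toWord
  have hmem : ∀ i, ∃ y ∈ (φ u).toWord, y.1 = i := by
    intro i
    by_contra! h
    refine (hu.map φ).notMem_genBy hq i ?_
    rw [← hmk]
    exact mk_mem_genBy h
  have hall : ∀ v, v ∈ (φ u).toWord := by
    rintro ⟨i, b⟩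
    obtain ⟨y, hy, hi⟩ := hmem i
    refine mem_of_exponentHom_eq_one ?_ hy hi b
    rw [hmk]
    exact (hu.map φ).exponentHom_eq_one _ i
  have hlen : (φ u).toWord.length ≤ Fintype.card ((Fin d × Bool) × Bool) := by
    refine length_le_card (k := ZMod p) (fun h => ?_) (fun ψ => ?_) hmem
      fun ξ hξ => (hu.map φ).eq_of_wordSum_eq_zero hq hmk hξ
    · have := hall ((⟨0, hd⟩, true), true)
      simp [h] at this
    · rw [hmk]
      exact hφ ψ
  have hnd : (φ u).toWord.Nodup := by
    have h1 : (φ u).toWord.toFinset = Finset.univ := by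
      ext v
      simp [hall v]
    rw [← Multiset.coe_nodup, ← Multiset.toFinset_card_eq_card_iff_nodup]
    have h2 : Multiset.toFinset ((φ u).toWord : Multiset ((Fin d × Bool) × Bool)) =
        Finset.univ := h1
    refine le_antisymm (Multiset.toFinset_card_le _) ?_
    rw [h2, Finset.card_univ]
    exact hlen
  exact SurfaceWord.exists_prodComm (C := []) (fun ψ i => (hu.map ψ).notMem_genBy hq i) _
    (R := (φ u).toWord) le_rfl hnd hall (φ := φ) (by rw [hmk]; exact (one_mul _).symm)

theorem exists_mulEquiv_of_eq_mk {I : Type} {π : I → I × Bool}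
    (hπ : Function.Bijective fun i => (π i).1) :
    ∃ φ : FreeGroup I ≃* FreeGroup I, ∀ i, φ (FreeGroup.of i) = FreeGroup.mk [π i] := by
  let e := Equiv.ofBijective _ hπ
  have he : ∀ i, e i = (π i).1 := fun i => rfl
  let s : I → FreeGroup I → FreeGroup I := fun i g => if (π i).2 then g else g⁻¹
  have hs : ∀ i, s i (FreeGroup.of (e i)) = FreeGroup.mk [π i] := fun i => (mk_singleton _).symm
  let α : FreeGroup I →* FreeGroup I := FreeGroup.lift fun i => s i (FreeGroup.of (e i))
  let β : FreeGroup I →* FreeGroup I :=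
    FreeGroup.lift fun j => s (e.symm j) (FreeGroup.of (e.symm j))
  have hms : ∀ (γ : FreeGroup I →* FreeGroup I) i g, γ (s i g) = s i (γ g) := by
    intro γ i g
    simp only [s]
    split_ifs <;> simp
  have hss : ∀ i g, s i (s i g) = g := by
    intro i g
    simp only [s]
    split_ifs <;> simp
  have h1 : β.comp α = MonoidHom.id _ := by
    ext i
    simp [α, β, hms, hss]
  have h2 : α.comp β = MonoidHom.id _ := by
    ext i
    simp [α, β, hms, hss]
  exact ⟨MonoidHom.toMulEquiv α β h1 h2, fun i => by
    simp only [MonoidHom.toMulEquiv_apply, α, FreeGroup.lift_apply_of, hs]⟩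

theorem length_commLetters {I : Type} (C : List ((I × Bool) × (I × Bool))) :
    (commLetters C).length = 4 * C.length := by
  induction C with
  | nil => rfl
  | cons z C ih =>
    simp only [commLetters, List.flatMap_cons, List.length_append, List.length_cons] at ih ⊢
    simp [ih]
    ring

theorem exists_map_orientableRelator {C : List (((Fin d × Bool) × Bool) × ((Fin d × Bool) × Bool))}
    (hnd : (commLetters C).Nodup) (hall : ∀ v, v ∈ commLetters C) :
    ∃ ψ : FreeGroup (Fin d × Bool) ≃* FreeGroup (Fin d × Bool),
      ψ (orientableRelator d) = prodComm C := by
  have hlen : C.length = d := by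
    have h1 : (commLetters C).length = Fintype.card ((Fin d × Bool) × Bool) := by
      rw [← List.toFinset_card_of_nodup hnd, ← Finset.card_univ]
      congr 1
      ext v
      simp [hall v]
    rw [length_commLetters] at h1
    simp at h1
    omega
  let π : Fin d × Bool → (Fin d × Bool) × Bool := fun i =>
    if i.2 then (C[i.1.1]'(hlen.symm ▸ i.1.2)).2 else (C[i.1.1]'(hlen.symm ▸ i.1.2)).1
  have hsurj : Function.Surjective fun i => (π i).1 := by
    intro i
    obtain ⟨z, hz, hy⟩ := List.mem_flatMap.1 (hall (i, true))
    obtain ⟨t, ht, rfl⟩ := List.mem_iff_getElem.1 hz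
    have h1 : i = (C[t]).1.1 ∨ i = (C[t]).2.1 := by
      simp only [List.mem_cons, List.not_mem_nil, or_false] at hy
      rcases hy with h | h | h | h
      · exact Or.inl (congrArg Prod.fst h)
      · exact Or.inr (congrArg Prod.fst h)
      · exact Or.inl (congrArg Prod.fst h)
      · exact Or.inr (congrArg Prod.fst h)
    rcases h1 with rfl | rfl
    · exact ⟨(⟨t, hlen ▸ ht⟩, false), rfl⟩
    · exact ⟨(⟨t, hlen ▸ ht⟩, true), rfl⟩
  obtain ⟨ψ, hψ⟩ := exists_mulEquiv_of_eq_mk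
    (Finite.injective_iff_surjective.2 hsurj |>.bijective_of_finite)
  refine ⟨ψ, ?_⟩
  unfold orientableRelator prodComm
  rw [map_list_prod, List.map_ofFn]
  congr 1
  refine List.ext_getElem (by simp [hlen]) fun t h1 h2 => ?_
  simp [map_commutatorElement, hψ, π]

end Twin

end SurfaceWord

/-- If `u` is measure equivalent to the orientable surface word `w = [x₁,y₁]⋯[x_d,y_d]` in
every finite group of the pseudovariety `𝒩_p(𝒜_f 𝒩_q)`, then `u` lies in the
`Aut(F)`-orbit of `w`. -/
theorem stmt2 (p q : ℕ) (hp : p.Prime) (hq : q.Prime) (d : ℕ) (hd : 1 ≤ d)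
    (u : FreeGroup (Fin d × Bool))
    (h : ∀ (Q : Type) [Group Q] [Finite Q], MemNpAfNq p q Q →
      MeasureEquivIn (orientableRelator d) u Q) :
    ∃ φ : FreeGroup (Fin d × Bool) ≃* FreeGroup (Fin d × Bool),
      u = φ (orientableRelator d) := by
  have : Fact p.Prime := ⟨hp⟩
  have hu : SurfaceWord.IsTwin p q u := h
  obtain ⟨C, ψ, hnd, hall, hψ⟩ := hu.exists_prodComm hq.one_lt hd
  obtain ⟨ψ', hψ'⟩ := SurfaceWord.exists_map_orientableRelator hnd hall
  exact ⟨ψ'.trans ψ.symm, by rw [MulEquiv.trans_apply, hψ', ← hψ, MulEquiv.symm_apply_apply]⟩
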